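/- For every integer k ≥ 3 and every α > 0 there exists n₀ such that every k-uniform hypergraph H on n ≥ n₀ vertices with minimum (k−2)-degree δ_{k−2}(H) ≥ (5/9 + α)·n²/2 contains a Hamiltonian cycle. -/

import Mathlib

set_option autoImplicit false
set_option linter.unusedSectionVars false
set_option linter.unusedSimpArgs false
set_option linter.unusedVariables false

namespace TH
open Finset

/-- Uniform probability of a predicate on a finite type. -/
noncomputable def pr {α : Type} (P : α → Prop) : ℝ :=
  (({a | P a} : Set α).ncard : ℝ) / (Nat.card α : ℝ)

open Classical in
lemma pr_def {α : Type} [Fintype α] (P : α → Prop) :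
    pr P = ((univ.filter P).card : ℝ) / (Fintype.card α : ℝ) := by
  unfold pr
  rw [Nat.card_eq_fintype_card, Set.ncard_eq_toFinset_card']
  congr 3
  ext; simp

section prlib
variable {α β : Type} [Finite α] [Finite β]

lemma pr_nonneg (P : α → Prop) : 0 ≤ pr P := by unfold pr; positivity

lemma pr_le_one (P : α → Prop) : pr P ≤ 1 := by
  classical
  cases nonempty_fintype α
  rw [pr_def]
  apply div_le_one_of_le₀ _ (by positivity)
  exact_mod_cast (card_le_univ _)

lemma pr_mono {P Q : α → Prop} (h : ∀ a, P a → Q a) : pr P ≤ pr Q := by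
  classical
  cases nonempty_fintype α
  rw [pr_def, pr_def]
  gcongr
  apply h

lemma pr_congr {P Q : α → Prop} (h : ∀ a, P a ↔ Q a) : pr P = pr Q :=
  le_antisymm (pr_mono fun a => (h a).1) (pr_mono fun a => (h a).2)

lemma pr_equiv (e : α ≃ β) (P : β → Prop) : pr (fun a => P (e a)) = pr P := by
  classical
  cases nonempty_fintype α
  cases nonempty_fintype β
  rw [pr_def, pr_def, Fintype.card_congr e]
  congr 2
  apply Finset.card_bij (fun a _ => e a)
  · intro a ha; simpa using ha
  · intro a _ b _ h; exact e.injective h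
  · intro b hb; exact ⟨e.symm b, by simpa using hb, by simp⟩

lemma pr_or_le (P Q : α → Prop) : pr (fun a => P a ∨ Q a) ≤ pr P + pr Q := by
  classical
  cases nonempty_fintype α
  rw [pr_def, pr_def, pr_def, ← add_div]
  gcongr
  have h := card_union_le (univ.filter P) (univ.filter Q)
  refine le_trans ?_ (show ((univ.filter P ∪ univ.filter Q).card : ℝ) ≤ _ by exact_mod_cast h)
  gcongr
  intro a
  simp

open Classical in
lemma pr_eq_sum [Fintype α] (P : α → Prop) : pr P = (∑ a, if P a then (1:ℝ) else 0) / Fintype.card α := by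
  rw [pr_def]; simp

lemma pr_not [Nonempty α] (P : α → Prop) : pr (fun a => ¬ P a) = 1 - pr P := by
  classical
  cases nonempty_fintype α
  have h2 : (0:ℝ) < Fintype.card α := by exact_mod_cast Fintype.card_pos
  rw [eq_sub_iff_add_eq, pr_eq_sum, pr_eq_sum, ← add_div, div_eq_one_iff_eq h2.ne',
    ← Finset.sum_add_distrib]
  trans ∑ _a : α, (1:ℝ)
  · refine Finset.sum_congr rfl fun a _ => ?_
    by_cases h : P a <;> simp [h]
  · simp

/-- `P` is contained in `Q` up to `R`. -/
lemma pr_le_add {P Q R : α → Prop} (h : ∀ a, P a → Q a ∨ R a) : pr P ≤ pr Q + pr R :=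
  (pr_mono h).trans (pr_or_le Q R)

lemma pr_le_add3 {P Q R S : α → Prop} (h : ∀ a, P a → Q a ∨ R a ∨ S a) :
    pr P ≤ pr Q + pr R + pr S := by
  have h1 := pr_le_add (P := P) (Q := Q) (R := fun a => R a ∨ S a) h
  have h2 := pr_or_le R S
  linarith

lemma exists_of_pr_pos {P : α → Prop} (h : 0 < pr P) : ∃ a, P a := by
  classical
  by_contra hc
  push Not at hc
  have : pr P = 0 := by
    unfold pr
    simp [hc]
  linarith

lemma exists_of_pr_lt {P Q : α → Prop} (h : pr P < pr Q) : ∃ a, Q a ∧ ¬ P a := by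
  by_contra hc
  push Not at hc
  exact absurd (pr_mono hc) (not_le.2 h)

open Classical in
lemma card_eq_pr_mul [Fintype α] [Nonempty α] (P : α → Prop) :
    ((univ.filter P).card : ℝ) = pr P * Fintype.card α := by
  rw [pr_def]
  have h2 : (0:ℝ) < Fintype.card α := by exact_mod_cast Fintype.card_pos
  field_simp

lemma pr_prod [Fintype α] (P : α × β → Prop) :
    pr P = (∑ a, pr (fun b => P (a, b))) / Fintype.card α := by
  classical
  cases nonempty_fintype β
  simp only [pr_eq_sum]
  rw [← Finset.sum_div, Fintype.sum_prod_type, Fintype.card_prod, div_div]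
  push_cast
  rw [mul_comm (Fintype.card β : ℝ)]

lemma pr_prod_le {P : α × β → Prop} {c : ℝ} [Nonempty α] (h : ∀ a, pr (fun b => P (a, b)) ≤ c) :
    pr P ≤ c := by
  cases nonempty_fintype α
  rw [pr_prod, div_le_iff₀ (by exact_mod_cast Fintype.card_pos)]
  calc _ ≤ ∑ a : α, c := Finset.sum_le_sum fun a _ => h a
    _ = _ := by simp [mul_comm]

lemma le_pr_prod {P : α × β → Prop} {Q : α → Prop} {c d : ℝ} (hc : 0 ≤ c) (hQ : d ≤ pr Q)
    (h : ∀ a, Q a → c ≤ pr (fun b => P (a, b))) :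
    d * c ≤ pr P := by
  classical
  cases nonempty_fintype α
  refine (mul_le_mul_of_nonneg_right hQ hc).trans ?_
  rw [pr_prod, pr_eq_sum, div_mul_eq_mul_div, Finset.sum_mul]
  gcongr with a
  split_ifs with hq
  · simpa using h a hq
  · simpa using pr_nonneg _

/-- Markov inequality. -/
lemma pr_markov {P : α × β → Prop} {c d : ℝ} (hd : 0 < d) (h : pr P ≤ c * d) :
    pr (fun a => d < pr (fun b => P (a, b))) ≤ c := by
  have := le_pr_prod (P := P) (Q := fun a => d < pr (fun b => P (a, b))) hd.le le_rfl
    (fun a ha => ha.le)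
  exact le_of_mul_le_mul_right (this.trans h) hd

lemma pr_fst [Nonempty β] (P : α → Prop) : pr (fun x : α × β => P x.1) = pr P := by
  classical
  cases nonempty_fintype α
  rw [pr_prod, pr_eq_sum]
  congr 1
  refine Finset.sum_congr rfl fun a _ => ?_
  simp only
  split_ifs with h
  · simp [pr, h, Nat.card_pos.ne']
  · simp [pr, h]

lemma pr_swap (P : α × β → Prop) : pr (fun x : β × α => P (x.2, x.1)) = pr P :=
  pr_equiv (Equiv.prodComm β α) P

lemma pr_snd [Nonempty α] (P : β → Prop) : pr (fun x : α × β => P x.2) = pr P := by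
  rw [← pr_fst (β := α) P, ← pr_swap]

lemma exists_le_of_pr_prod [Nonempty α] {P : α × β → Prop} {c : ℝ} (h : pr P ≤ c) :
    ∃ a, pr (fun b => P (a, b)) ≤ c := by
  by_contra hc
  push Not at hc
  cases nonempty_fintype α
  rw [pr_prod, div_le_iff₀ (by exact_mod_cast Fintype.card_pos)] at h
  have : ∑ a : α, c < ∑ a, pr (fun b => P (a, b)) :=
    Finset.sum_lt_sum_of_nonempty univ_nonempty fun a _ => hc a
  simp [mul_comm] at this
  linarith

lemma pr_le_finset_sum {ι : Type} (s : Finset ι) (P : α → Prop) (Q : ι → α → Prop)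
    (h : ∀ a, P a → ∃ i ∈ s, Q i a) : pr P ≤ ∑ i ∈ s, pr (Q i) := by
  classical
  cases nonempty_fintype α
  simp only [pr_eq_sum]
  rw [← Finset.sum_div, Finset.sum_comm]
  gcongr with a
  split_ifs with hP
  · obtain ⟨i, hi, hq⟩ := h a hP
    calc (1:ℝ) = if Q i a then 1 else 0 := by simp [hq]
      _ ≤ _ := Finset.single_le_sum (f := fun i => if Q i a then (1:ℝ) else 0)
          (fun j _ => by split_ifs <;> norm_num) hi
  · exact Finset.sum_nonneg fun j _ => by split_ifs <;> norm_num

end prlib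

section prpi
variable {V : Type} [Fintype V] [Nonempty V]

/-- Projection onto a subset of the coordinates preserves the uniform measure. -/
lemma pr_comp_inj {ι κ : Type} [Finite ι] [Finite κ]
    (e : κ → ι) (he : Function.Injective e)
    (Q : (κ → V) → Prop) : pr (fun X : ι → V => Q (X ∘ e)) = pr Q := by
  classical
  let E1 : (ι → V) ≃ ({x // x ∈ Set.range e} → V) × ({x // ¬ x ∈ Set.range e} → V) :=
    Equiv.piEquivPiSubtypeProd (fun x => x ∈ Set.range e) (fun _ => V)
  let E2 : (κ → V) ≃ ({x // x ∈ Set.range e} → V) :=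
    Equiv.arrowCongr (Equiv.ofInjective e he) (Equiv.refl V)
  have h1 : pr (fun X : ι → V => Q (X ∘ e)) =
      pr (fun y : ({x // x ∈ Set.range e} → V) × ({x // ¬ x ∈ Set.range e} → V) =>
        Q (E2.symm y.1)) := by
    rw [← pr_equiv E1]
    apply pr_congr
    intro X
    have : X ∘ e = E2.symm (E1 X).1 := by
      ext j
      simp [E1, E2, Equiv.piEquivPiSubtypeProd, Equiv.arrowCongr]
    rw [this]
  rw [h1, pr_fst (fun y => Q (E2.symm y)), pr_equiv E2.symm]

lemma pr_eval {ι : Type} [Finite ι] (i : ι) (Q : V → Prop) :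
    pr (fun X : ι → V => Q (X i)) = pr Q := by
  have h := pr_comp_inj (V := V) (fun _ : Unit => i) (fun _ _ _ => rfl) (fun Y => Q (Y ()))
  have h2 := pr_equiv (Equiv.funUnique Unit V) Q
  have h3 : (fun a : Unit → V => Q ((Equiv.funUnique Unit V) a)) = fun Y => Q (Y ()) := rfl
  rw [h3] at h2
  rw [← h2, ← h]
  rfl

lemma pr_eval2 {ι : Type} [Finite ι] (i j : ι) (hij : i ≠ j) (Q : V → V → Prop) :
    pr (fun X : ι → V => Q (X i) (X j)) = pr (fun p : V × V => Q p.1 p.2) := by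
  have hinj : Function.Injective (fun b : Bool => if b then i else j) := by
    intro a b h; cases a <;> cases b <;> simp_all
  have h := pr_comp_inj (V := V) _ hinj (fun Y => Q (Y true) (Y false))
  have h2 := pr_equiv (Equiv.boolArrowEquivProd V) (fun p => Q p.2 p.1)
  have h3 := pr_swap (fun p : V × V => Q p.2 p.1)
  simp only [Equiv.boolArrowEquivProd] at h2
  simp only [Function.comp_def, if_true, Bool.false_eq_true, if_false] at h
  rw [h]
  refine h2.trans ?_
  rw [← h3]

lemma pr_mem_finset (U : Finset V) : pr (fun x : V => x ∈ U) = U.card / Fintype.card V := by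
  classical
  rw [pr_def]; congr 3; ext; simp

lemma pr_hit {ι : Type} [Fintype ι] (U : Finset V) :
    pr (fun X : ι → V => ∃ i, X i ∈ U) ≤ Fintype.card ι * (U.card / Fintype.card V) := by
  refine (pr_le_finset_sum univ _ (fun i X => X i ∈ U) (by simp)).trans ?_
  calc _ ≤ ∑ _i : ι, ((U.card : ℝ) / Fintype.card V) := by
        apply Finset.sum_le_sum
        intro i _
        rw [← pr_mem_finset]
        exact (pr_eval i (· ∈ U)).le
    _ = _ := by simp

lemma pr_diag : pr (fun p : V × V => p.1 = p.2) = 1 / Fintype.card V := by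
  classical
  rw [pr_prod]
  have : ∀ a : V, pr (fun b => a = b) = 1 / Fintype.card V := by
    intro a
    rw [pr_def]
    congr 1
    have : (univ.filter fun b => a = b) = {a} := by ext; simp [eq_comm]
    simp [this]
  simp only [this]
  have h2 : (0:ℝ) < Fintype.card V := by exact_mod_cast Fintype.card_pos
  simp

lemma pr_not_injective {ι : Type} [Fintype ι] :
    pr (fun X : ι → V => ¬ Function.Injective X) ≤ (Fintype.card ι : ℝ) ^ 2 / Fintype.card V := by
  have h2 : (0:ℝ) < Fintype.card V := by exact_mod_cast Fintype.card_pos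
  refine (pr_le_finset_sum (univ : Finset (ι × ι)) _
    (fun p X => p.1 ≠ p.2 ∧ X p.1 = X p.2) ?_).trans ?_
  · intro X hX
    unfold Function.Injective at hX
    push Not at hX
    obtain ⟨a, b, h, h'⟩ := hX
    exact ⟨(a, b), by simp, h', h⟩
  calc _ ≤ ∑ _p : ι × ι, (1 : ℝ) / Fintype.card V := by
        apply Finset.sum_le_sum
        rintro ⟨i, j⟩ _
        by_cases hij : i = j
        · subst hij
          have : pr (fun X : ι → V => i ≠ i ∧ X i = X i) = 0 := by simp [pr]
          rw [this]; positivity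
        · rw [← pr_diag, ← pr_eval2 i j hij (fun a b => a = b)]
          exact pr_mono fun X h => h.2
    _ = _ := by simp; ring

/-- Independence. -/
lemma pr_pi {ι : Type} [Fintype ι] {A : Type} [Fintype A] (Q : ι → A → Prop) :
    pr (fun X : ι → A => ∀ i, Q i (X i)) = ∏ i, pr (Q i) := by
  classical
  simp only [pr_def]
  rw [Finset.prod_div_distrib]
  congr 1
  · have : (univ.filter fun X : ι → A => ∀ i, Q i (X i)) =
      Fintype.piFinset (fun i => univ.filter (Q i)) := by
      ext X; simp
    rw [← Nat.cast_prod, ← Fintype.card_piFinset, ← this]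
    congr!
  · simp

end prpi
end TH

namespace TH
open Finset

lemma jensen_pow {A : Type} [Fintype A] [Nonempty A] (f : A → ℝ) (hf : ∀ a, 0 ≤ f a) (p : ℕ) :
    ((∑ a, f a) / Fintype.card A) ^ p ≤ (∑ a, f a ^ p) / Fintype.card A := by
  have h2 : (0:ℝ) < Fintype.card A := by exact_mod_cast Fintype.card_pos
  have := Real.pow_arith_mean_le_arith_mean_pow univ (fun _ : A => (1:ℝ) / Fintype.card A) f
    (fun _ _ => by positivity) (by simp) (fun i _ => hf i) p
  calc _ = (∑ i, (1:ℝ) / Fintype.card A * f i) ^ p := by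
        rw [← Finset.mul_sum]; ring
    _ ≤ _ := this
    _ = _ := by rw [← Finset.mul_sum]; ring

section box
variable {V : Type} [Fintype V] [Nonempty V]

/-- The combined function on `Option α`. -/
def oc {α : Type} (v : V) (x : α → V) : Option α → V := fun o => o.elim v x

def ocEquiv (α : Type) : (α → V) × V ≃ (Option α → V) where
  toFun p := oc p.2 p.1
  invFun X := (fun a => X (some a), X none)
  left_inv p := rfl
  right_inv X := by funext o; cases o <;> rfl

def ocmEquiv (α : Type) (m : ℕ) : (Fin m → V) × (α × Fin m → V) ≃ (Option α × Fin m → V) where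
  toFun p := fun q => q.1.elim (p.1 q.2) (fun a => p.2 (a, q.2))
  invFun X := (fun j => X (none, j), fun p => X (some p.1, p.2))
  left_inv p := rfl
  right_inv X := by funext ⟨o, j⟩; cases o <;> rfl

/-- All mixes of the `m` copies satisfy `F`. -/
def Mix {ι : Type} {m : ℕ} (F : (ι → V) → Prop) (X : ι × Fin m → V) : Prop :=
  ∀ g : ι → Fin m, F (fun i => X (i, g i))

def BoxStmt (V : Type) [Fintype V] (m : ℕ) (ι : Type) [Fintype ι] : Prop :=
  ∀ (F : (ι → V) → Prop) (c : ℝ), 0 ≤ c → c ≤ pr F →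
    c ^ (m ^ Fintype.card ι) ≤ pr (fun X : ι × Fin m → V => Mix F X)

lemma box_all (m : ℕ) (ι : Type) [Fintype ι] : BoxStmt V m ι := by
  classical
  refine Fintype.induction_empty_option (P := fun ι _ => BoxStmt V m ι) ?_ ?_ ?_ ι
  · intro α β _ e ih F c hc h
    let _ := Fintype.ofEquiv β e.symm
    have ih' := ih (fun x => F (x ∘ e.symm)) c hc (by
      refine h.trans (le_of_eq ?_)
      have := pr_equiv (Equiv.arrowCongr e (Equiv.refl V)) F
      rw [← this]; rfl)
    rw [← Fintype.card_congr e]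
    refine ih'.trans (le_of_eq ?_)
    have := pr_equiv (Equiv.arrowCongr (e.prodCongr (Equiv.refl (Fin m))) (Equiv.refl V))
      (fun X : β × Fin m → V => Mix F X)
    rw [← this]
    apply pr_congr
    intro X
    constructor
    · intro hX g
      have := hX (g ∘ e)
      convert this using 1
      funext b
      simp [Equiv.arrowCongr]
    · intro hX g
      have := hX (g ∘ e.symm)
      convert this using 1
      funext b
      simp [Equiv.arrowCongr]
  · intro F c hc h
    simp only [Fintype.card_pempty, pow_zero, pow_one]
    refine h.trans (le_of_eq ?_)
    let E0 : (PEmpty × Fin m → V) ≃ (PEmpty → V) := Equiv.ofUnique _ _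
    rw [← pr_equiv E0 F]
    apply pr_congr
    intro X
    constructor
    · intro hX g
      convert hX using 1
      funext i; exact i.elim
    · intro hX
      convert hX (fun i => i.elim) using 1
      funext i; exact i.elim
  · intro α _ ih F c hc h
    have h1 : pr (fun X : Option α × Fin m → V => Mix F X) =
        pr (fun p : (Fin m → V) × (α × Fin m → V) =>
          Mix (fun x : α → V => ∀ j, F (oc (p.1 j) x)) p.2) := by
      rw [← pr_equiv (ocmEquiv α m)]
      apply pr_congr
      rintro ⟨u, X⟩
      constructor
      · intro hX g j
        convert hX (fun o => o.elim j g) using 1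
        funext o; cases o <;> rfl
      · intro hX g
        convert hX (fun a => g (some a)) (g none) using 1
        funext o; cases o <;> rfl
    have h2 : c ^ m ≤ pr (fun p : (Fin m → V) × (α → V) => ∀ j, F (oc (p.1 j) p.2)) := by
      rw [← pr_swap, pr_prod]
      have : ∀ x : α → V, pr (fun b : Fin m → V => ∀ j, F (oc (b j) x)) =
          (pr fun v => F (oc v x)) ^ m := by
        intro x
        rw [pr_pi (fun (_ : Fin m) v => F (oc v x))]
        simp
      simp only [this]
      refine le_trans ?_ (jensen_pow _ (fun _ => pr_nonneg _) m)
      gcongr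
      refine h.trans (le_of_eq ?_)
      rw [← pr_prod (fun p : (α → V) × V => F (oc p.2 p.1)), ← pr_equiv (ocEquiv α)]
      rfl
    rw [h1, pr_prod, Fintype.card_option, pow_succ', pow_mul]
    have ih2 := fun u : Fin m → V => ih (fun x : α → V => ∀ j, F (oc (u j) x)) _ (pr_nonneg _) le_rfl
    generalize m ^ Fintype.card α = M at ih2 ⊢
    have h3 : (c ^ m) ^ M ≤ (pr (fun p : (Fin m → V) × (α → V) => ∀ j, F (oc (p.1 j) p.2))) ^ M :=
      pow_le_pow_left₀ (by positivity) h2 _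
    rw [pr_prod] at h3
    refine h3.trans ((jensen_pow (fun u : Fin m → V => pr (fun x : α → V => ∀ j, F (oc (u j) x)))
      (fun _ => pr_nonneg _) M).trans ?_)
    refine div_le_div_of_nonneg_right ?_ (by positivity)
    exact Finset.sum_le_sum fun u _ => ih2 u

lemma box {ι : Type} [Fintype ι] (m : ℕ) (F : (ι → V) → Prop) (c : ℝ) (hc : 0 ≤ c)
    (h : c ≤ pr F) :
    c ^ (m ^ Fintype.card ι) ≤ pr (fun X : ι × Fin m → V => Mix F X) := by
  exact box_all (V := V) m ι F c hc h
end box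
end TH

namespace TH
open Finset

section part
variable {Ω : Type} [Fintype Ω]

open Classical in
def Insep (G : Ω → Ω → Prop) (τ : ℝ) (X : Finset Ω) : Prop :=
  ∀ A ⊆ X, τ * A.card * (X \ A).card ≤ ∑ a ∈ A, (((X \ A).filter (G a)).card : ℝ)

open Classical in
lemma partition (G : Ω → Ω → Prop) (hG : ∀ a b, G a b → G b a) (τ : ℝ) (hτ : 0 ≤ τ) :
    ∃ f : Ω → Ω, pr (fun p : Ω × Ω => G p.1 p.2 ∧ f p.1 ≠ f p.2) ≤ τ ∧
      ∀ c, Insep G τ (univ.filter (fun a => f a = c)) := by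
  rcases isEmpty_or_nonempty Ω with hE | hE
  · refine ⟨id, ?_, ?_⟩
    · unfold pr; simp [hτ]
    · intro c; exact (hE.false c).elim
  let w : Ω → Ω → ℝ := fun s t => (if G s t then 1 else 0) - τ
  have wsym : ∀ s t, w s t = w t s := by
    intro s t
    have : G s t ↔ G t s := ⟨hG _ _, hG _ _⟩
    simp only [w, this]
  let cost : (Ω → Ω) → ℝ := fun f => ∑ s, ∑ t, if f s ≠ f t then w s t else 0
  obtain ⟨f, -, hf⟩ := Finset.exists_min_image (univ : Finset (Ω → Ω)) cost univ_nonempty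
  have hpos : (0:ℝ) < Fintype.card (Ω × Ω) := by exact_mod_cast Fintype.card_pos
  refine ⟨f, ?_, ?_⟩
  · rw [pr_eq_sum, div_le_iff₀ hpos]
    have h0 := hf (fun _ => Classical.arbitrary Ω) (mem_univ _)
    have h1 : cost (fun _ => Classical.arbitrary Ω) = 0 := by simp [cost]
    rw [h1] at h0
    have h2 : ∑ p : Ω × Ω, (if G p.1 p.2 ∧ f p.1 ≠ f p.2 then (1:ℝ) else 0) ≤
        cost f + ∑ p : Ω × Ω, τ := by
      simp only [cost]
      rw [← Fintype.sum_prod_type' (f := fun s t => if f s ≠ f t then w s t else 0),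
        ← Finset.sum_add_distrib]
      apply Finset.sum_le_sum
      rintro ⟨s, t⟩ -
      by_cases h3 : f s = f t <;> by_cases h4 : G s t <;> simp [h3, h4, w, hτ]
    simp only [sum_const, card_univ, nsmul_eq_mul] at h2
    rw [mul_comm τ]
    refine le_trans (le_of_eq ?_) (h2.trans (by linarith))
    congr!
  · intro c A hA
    set Y := univ.filter (fun a => f a = c) with hY
    rcases A.eq_empty_or_nonempty with rfl | ⟨a0, ha0⟩
    · simp
    rcases (Y \ A).eq_empty_or_nonempty with h | ⟨y0, hy0⟩
    · rw [h]; simp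
    have hns : ¬ Function.Surjective f := by
      intro hs
      have hi := Finite.injective_iff_surjective.2 hs
      have e1 : f a0 = c := by have := hA ha0; simpa [hY] using this
      have e2 : f y0 = c ∧ y0 ∉ A := by simpa [hY] using hy0
      have := hi (e1.trans e2.1.symm)
      exact e2.2 (this ▸ ha0)
    have : ∃ d, ∀ a, f a ≠ d := by
      by_contra hc; push Not at hc; exact hns hc
    obtain ⟨d, hd⟩ := this
    have h0 := hf (fun a => if a ∈ A then d else f a) (mem_univ _)
    have hfA : ∀ a ∈ A, f a = c := fun a ha => by have := hA ha; simpa [hY] using this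
    have key : cost (fun a => if a ∈ A then d else f a) = cost f +
        ((∑ s, ∑ t, if s ∈ A ∧ t ∈ Y \ A then w s t else 0) +
        (∑ s, ∑ t, if t ∈ A ∧ s ∈ Y \ A then w s t else 0)) := by
      simp only [cost]
      rw [← Finset.sum_add_distrib, ← Finset.sum_add_distrib]
      refine Finset.sum_congr rfl fun s _ => ?_
      rw [← Finset.sum_add_distrib, ← Finset.sum_add_distrib]
      refine Finset.sum_congr rfl fun t _ => ?_
      have hds := hd s
      have hdt := hd t
      by_cases hs : s ∈ A <;> by_cases ht : t ∈ A
      · simp [hs, ht, hfA s hs, hfA t ht]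
      · by_cases h : f t = c
        · simp [hs, ht, hfA s hs, h, hY]
          intro h'; exact absurd h' (h ▸ hdt.symm)
        · simp [hs, ht, hfA s hs, h, hY]
          rw [if_neg (fun h' => hdt h'.symm), if_neg (fun h' => h h'.symm)]
      · by_cases h : f s = c
        · simp [hs, ht, hfA t ht, h, hY]
          intro h'; exact absurd h' (h ▸ hds)
        · simp [hs, ht, hfA t ht, h, hY, hds]
      · simp [hs, ht]
    have hsym : (∑ s, ∑ t, if t ∈ A ∧ s ∈ Y \ A then w s t else 0) =
        ∑ s, ∑ t, if s ∈ A ∧ t ∈ Y \ A then w s t else 0 := by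
      rw [Finset.sum_comm]
      refine Finset.sum_congr rfl fun s _ => Finset.sum_congr rfl fun t _ => ?_
      rw [wsym]
    have hval : (∑ s, ∑ t, if s ∈ A ∧ t ∈ Y \ A then w s t else 0) =
        (∑ a ∈ A, (((Y \ A).filter (G a)).card : ℝ)) - τ * A.card * (Y \ A).card := by
      have e1 : ∀ s, (∑ t, if s ∈ A ∧ t ∈ Y \ A then w s t else 0) =
          if s ∈ A then ((((Y \ A).filter (G s)).card : ℝ) - τ * (Y \ A).card) else 0 := by
        intro s
        by_cases hs : s ∈ A
        · simp only [hs, true_and, if_true]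
          rw [← Finset.sum_filter]
          have e2 : (univ.filter fun t => t ∈ Y \ A) = Y \ A := by ext; simp
          rw [e2]
          simp only [w, Finset.sum_sub_distrib]
          simp [mul_comm]
        · simp [hs]
      simp only [e1]
      rw [← Finset.sum_filter, Finset.filter_mem_eq_inter, Finset.univ_inter,
        Finset.sum_sub_distrib]
      simp; ring
    rw [key, hsym, hval] at h0
    linarith

/-- Walks of length at most `K+1`. -/
def Walk (G : Ω → Ω → Prop) : (K : ℕ) → Ω → Ω → (Fin K → Ω) → Prop
  | 0, a, b, _ => G a b
  | K + 1, a, b, z => Walk G K a b (Fin.tail z) ∨ (G a (z 0) ∧ Walk G K (z 0) b (Fin.tail z))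

lemma pr_fin_succ (K : ℕ) (P : (Fin (K+1) → Ω) → Prop) :
    pr P = pr (fun p : Ω × (Fin K → Ω) => P (Fin.cons p.1 p.2)) := by
  rw [← pr_equiv (Fin.consEquiv (fun _ : Fin (K+1) => Ω)) P]
  rfl

lemma pr_true {A : Type} [Finite A] [Nonempty A] {P : A → Prop} (h : ∀ a, P a) : pr P = 1 := by
  unfold pr
  simp [h, Nat.card_pos.ne']

open Classical in
lemma reach (τ ξ : ℝ) (hτ : 0 < τ) (hτ1 : τ ≤ 1) (hξ : 0 < ξ) :
    ∃ (K : ℕ) (c : ℝ), 0 < c ∧ ∀ (Ω : Type) [Fintype Ω] (G : Ω → Ω → Prop)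
      (_ : ∀ a b, G a b → G b a) (X : Finset Ω), Insep G τ X →
      ξ * Fintype.card Ω ≤ X.card → 2 ≤ X.card →
      (∀ a ∈ X, ∃ b, G a b) ∧
      ∀ a ∈ X, ∀ b ∈ X, c ≤ pr (fun z => Walk G K a b z) := by
  obtain ⟨K, hK⟩ := exists_pow_lt_of_lt_one (show (0:ℝ) < τ / 4 by positivity)
    (show 1 - τ / 2 < 1 by linarith)
  set p := τ ^ 2 * ξ / 4 with hp
  have hp0 : 0 < p := by positivity
  refine ⟨K + 1, p ^ (K + 1), by positivity, ?_⟩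
  intro Ω _ G hG X hX hXc hX2
  have hX2' : (2:ℝ) ≤ X.card := by exact_mod_cast hX2
  have hne : Nonempty Ω := by
    obtain ⟨x, hx⟩ := Finset.card_pos.1 (by omega : 0 < X.card)
    exact ⟨x⟩
  have hNpos : (0:ℝ) < Fintype.card Ω := by exact_mod_cast Fintype.card_pos
  have hdeg : ∀ a ∈ X, τ * X.card / 2 ≤ ((X.filter (G a)).card : ℝ) := by
    intro a ha
    have h := hX {a} (by simpa using ha)
    simp only [card_singleton, sum_singleton, Nat.cast_one, mul_one] at h
    rw [Finset.card_sdiff_of_subset (by simpa using ha)] at h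
    have h3 : (((X \ {a}).filter (G a)).card : ℝ) ≤ ((X.filter (G a)).card : ℝ) := by
      gcongr; exact sdiff_subset
    rw [Nat.cast_sub (by rw [card_singleton]; omega)] at h
    simp at h
    nlinarith
  refine ⟨?_, ?_⟩
  · intro a ha
    have := hdeg a ha
    have : (0:ℝ) < ((X.filter (G a)).card : ℝ) := by nlinarith
    obtain ⟨b, hb⟩ := Finset.card_pos.1 (by exact_mod_cast this : 0 < (X.filter (G a)).card)
    exact ⟨b, (mem_filter.1 hb).2⟩
  have stepA : ∀ (K : ℕ) (a b : Ω) (c : ℝ) (D : Finset Ω), 0 ≤ c →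
      (∀ d ∈ D, c ≤ pr (fun z => Walk G K d b z)) → p * Fintype.card Ω ≤ ((D.filter (G a)).card : ℝ) →
      p * c ≤ pr (fun z => Walk G (K+1) a b z) := by
    intro K a b c D hc hD hdeg
    rw [pr_fin_succ]
    refine le_pr_prod (Q := fun z => z ∈ D ∧ G a z) hc ?_ ?_
    · rw [pr_def, le_div_iff₀ hNpos]
      refine hdeg.trans (le_of_eq ?_)
      congr 2
      ext; simp
    · rintro z ⟨hz, hz2⟩
      refine (hD z hz).trans (pr_mono ?_)
      intro y hy
      right
      simpa [hz2, Fin.tail_cons] using hy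
  have stepB : ∀ (K : ℕ) (a b : Ω), pr (fun z => Walk G K a b z) ≤ pr (fun z => Walk G (K+1) a b z) := by
    intro K a b
    rw [pr_fin_succ, ← pr_snd (α := Ω)]
    apply pr_mono
    intro y hy
    left
    simpa [Fin.tail_cons] using hy
  intro a ha b hb
  have hp1 : p ≤ 1 / 4 := by
    have : ξ ≤ 1 := by
      have : (X.card : ℝ) ≤ Fintype.card Ω := by exact_mod_cast card_le_univ X
      by_contra hcon
      nlinarith
    have : τ ^ 2 ≤ 1 := by nlinarith
    rw [hp]; nlinarith
  have main : ∀ K : ℕ, ∃ B ⊆ X, τ * X.card / 2 ≤ (B.card : ℝ) ∧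
      ((X \ B).card : ℝ) ≤ (1 - τ / 2) ^ K * X.card ∧
      ∀ d ∈ B, p ^ K ≤ pr (fun z => Walk G K d b z) := by
    intro K
    induction K with
    | zero =>
      refine ⟨X.filter (G b), filter_subset _ _, hdeg b hb, ?_, ?_⟩
      · simp only [pow_zero, one_mul]
        exact_mod_cast card_le_card sdiff_subset
      · intro d hd
        have hd2 : G d b := hG _ _ (mem_filter.1 hd).2
        rw [pr_true]
        · simp
        · intro z; exact hd2
    | succ K ih =>
      obtain ⟨B, hBX, hB1, hB2, hB3⟩ := ih
      set J := (X \ B).filter (fun a => τ * B.card / 2 ≤ ((B.filter (G a)).card : ℝ)) with hJ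
      have hJX : J ⊆ X \ B := filter_subset _ _
      have hJs : τ / 2 * (X \ B).card ≤ (J.card : ℝ) := by
        have h := hX (X \ B) sdiff_subset
        rw [Finset.sdiff_sdiff_eq_self hBX] at h
        have h2 : ∑ a ∈ X \ B, ((B.filter (G a)).card : ℝ) ≤
            ∑ a ∈ X \ B, ((if τ * B.card / 2 ≤ ((B.filter (G a)).card : ℝ) then (B.card : ℝ) else 0)
              + τ * B.card / 2) := by
          refine Finset.sum_le_sum fun a _ => ?_
          have : ((B.filter (G a)).card : ℝ) ≤ B.card := by
            exact_mod_cast card_le_card (filter_subset _ _)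
          split_ifs with hh
          · have : 0 ≤ τ * B.card / 2 := by positivity
            linarith
          · push Not at hh
            linarith
        rw [Finset.sum_add_distrib, ← Finset.sum_filter] at h2
        simp only [sum_const, nsmul_eq_mul] at h2
        have hBpos : (0:ℝ) < B.card := by nlinarith
        have h3 : τ / 2 * (X \ B).card * B.card ≤ (J.card : ℝ) * B.card := by
          rw [hJ]; linarith
        exact le_of_mul_le_mul_right h3 hBpos
      refine ⟨B ∪ J, union_subset hBX (hJX.trans sdiff_subset), ?_, ?_, ?_⟩
      · refine hB1.trans ?_
        exact_mod_cast card_le_card subset_union_left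
      · have e : X \ (B ∪ J) = (X \ B) \ J := by ext; simp; tauto
        rw [e, Finset.card_sdiff_of_subset hJX, Nat.cast_sub (card_le_card hJX)]
        have : (0:ℝ) ≤ 1 - τ / 2 := by linarith
        calc _ ≤ (1 - τ / 2) * ((X \ B).card : ℝ) := by linarith
          _ ≤ (1 - τ / 2) * ((1 - τ / 2) ^ K * X.card) := by gcongr
          _ = _ := by ring
      · intro d hd
        rcases mem_union.1 hd with hd | hd
        · refine le_trans ?_ ((hB3 d hd).trans (stepB K d b))
          rw [pow_succ]
          have : 0 < p ^ K := by positivity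
          nlinarith
        · rw [pow_succ']
          refine stepA K d b (p ^ K) B (by positivity) hB3 ?_
          refine le_trans ?_ (mem_filter.1 hd).2
          rw [hp]
          nlinarith [mul_le_mul_of_nonneg_left hB1 hτ.le, mul_le_mul_of_nonneg_left hXc (sq_nonneg τ)]
  obtain ⟨B, hBX, hB1, hB2, hB3⟩ := main K
  rw [pow_succ']
  refine stepA K a b (p ^ K) B (by positivity) hB3 ?_
  have h1 := hdeg a ha
  have h2 : ((X.filter (G a)).card : ℝ) ≤ (B.filter (G a)).card + (X \ B).card := by
    have : X.filter (G a) ⊆ B.filter (G a) ∪ (X \ B) := by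
      intro x; simp; tauto
    exact_mod_cast (card_le_card this).trans (card_union_le _ _)
  have h3 : ((X \ B).card : ℝ) ≤ τ / 4 * X.card := hB2.trans (by gcongr)
  have h4 : p * Fintype.card Ω ≤ τ ^ 2 / 4 * X.card := by
    rw [hp]; nlinarith [mul_le_mul_of_nonneg_left hXc (sq_nonneg τ)]
  have h5 : τ ^ 2 ≤ τ := by nlinarith
  nlinarith
end part
end TH

namespace TH
open Finset

section moves
variable {V : Type} [Fintype V] [Nonempty V]

/-- Two states are linked if all mixes satisfy `P`. -/
def Lk {κ : Type} (P : (κ → V) → Prop) (t t' : κ → V) : Prop :=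
  ∀ g : κ → Bool, P (fun i => if g i then t i else t' i)

lemma Lk.symm {κ : Type} {P : (κ → V) → Prop} {t t' : κ → V} (h : Lk P t t') : Lk P t' t := by
  intro g
  convert h (fun i => !g i) using 2
  rename_i i
  cases g i <;> simp

lemma Lk.left {κ : Type} {P : (κ → V) → Prop} {t t' : κ → V} (h : Lk P t t') : P t := by
  simpa using h (fun _ => true)

lemma pr_pair {ι κ1 κ2 : Type} [Finite ι] [Finite κ1] [Finite κ2] (e1 : κ1 → ι) (e2 : κ2 → ι)
    (h : Function.Injective (Sum.elim e1 e2)) (Q : (κ1 → V) → (κ2 → V) → Prop) :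
    pr (fun X : ι → V => Q (X ∘ e1) (X ∘ e2)) = pr (fun p : (κ1 → V) × (κ2 → V) => Q p.1 p.2) := by
  rw [← pr_equiv (Equiv.sumArrowEquivProdArrow κ1 κ2 V), ← pr_comp_inj (V := V) _ h]
  rfl

lemma moves {κ : Type} [Fintype κ] [DecidableEq κ] (P : (κ → V) → Prop) {C : Type}
    (f : (κ → V) → C) (τ : ℝ)
    (hf : pr (fun p : (κ → V) × (κ → V) => Lk P p.1 p.2 ∧ f p.1 ≠ f p.2) ≤ τ) (i : κ)
    (c : ℝ) (hc : 0 ≤ c)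
    (h : c ≤ pr (fun p : (κ → V) × V => P p.1 ∧ P (Function.update p.1 i p.2) ∧
      f p.1 ≠ f (Function.update p.1 i p.2))) :
    c ^ (2 ^ (Fintype.card κ + 1)) ≤ 2 * τ := by
  set F : (Option κ → V) → Prop := fun x => P (x ∘ some) ∧
    P (Function.update (x ∘ some) i (x none)) ∧
    f (x ∘ some) ≠ f (Function.update (x ∘ some) i (x none)) with hF
  have h1 : c ≤ pr F := by
    refine h.trans (le_of_eq ?_)
    rw [← pr_equiv (ocEquiv κ) F]
    rfl
  have h2 := box 2 F c hc h1
  rw [Fintype.card_option] at h2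
  refine h2.trans ?_
  let e1 : κ → Option κ × Fin 2 := fun j => (some j, 0)
  let e2 : κ → Option κ × Fin 2 := fun j => if j = i then (none, 0) else (some j, 1)
  let e3 : κ → Option κ × Fin 2 := fun j => if j = i then (none, 1) else (some j, 0)
  have i1 : Function.Injective (Sum.elim e1 e2) := by
    rintro (a | a) (b | b) hab <;> simp only [Sum.elim_inl, Sum.elim_inr, e1, e2] at hab <;>
      (try split_ifs at hab) <;> simp_all
  have i2 : Function.Injective (Sum.elim e3 e2) := by
    rintro (a | a) (b | b) hab <;> simp only [Sum.elim_inl, Sum.elim_inr, e3, e2] at hab <;>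
      (try split_ifs at hab) <;> simp_all
  have p1 := pr_pair (V := V) e1 e2 i1 (fun t t' => Lk P t t' ∧ f t ≠ f t')
  have p2 := pr_pair (V := V) e3 e2 i2 (fun t t' => Lk P t t' ∧ f t ≠ f t')
  have : pr (fun X : Option κ × Fin 2 → V => Mix F X) ≤
      pr (fun X : Option κ × Fin 2 → V => Lk P (X ∘ e1) (X ∘ e2) ∧ f (X ∘ e1) ≠ f (X ∘ e2)) +
      pr (fun X : Option κ × Fin 2 → V => Lk P (X ∘ e3) (X ∘ e2) ∧ f (X ∘ e3) ≠ f (X ∘ e2)) := by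
    apply pr_le_add
    intro X hX
    have mk : ∀ (g : κ → Fin 2) (a : Fin 2), P (fun j => X (some j, g j)) ∧
        P (Function.update (fun j => X (some j, g j)) i (X (none, a))) ∧
        f (fun j => X (some j, g j)) ≠
          f (Function.update (fun j => X (some j, g j)) i (X (none, a))) := by
      intro g a
      exact hX (fun o => o.elim a g)
    have L1 : Lk P (X ∘ e1) (X ∘ e2) := by
      intro g
      by_cases hi : g i
      · convert (mk (fun j => if g j then 0 else 1) 0).1 using 2
        rename_i j
        by_cases hj : j = i
        · subst hj; simp [hi, e1]
        · cases g j <;> simp [e1, e2, hj]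
      · convert (mk (fun j => if g j then 0 else 1) 0).2.1 using 2
        rename_i j
        by_cases hj : j = i
        · subst hj; simp [hi, e2]
        · cases hgj : g j <;> simp [e1, e2, hj, hgj]
    have L2 : Lk P (X ∘ e3) (X ∘ e2) := by
      intro g
      convert (mk (fun j => if g j then 0 else 1) (if g i then 1 else 0)).2.1 using 2
      rename_i j
      by_cases hj : j = i
      · subst hj; cases hgj : g j <;> simp [e2, e3]
      · cases hgj : g j <;> simp [e3, e2, hj, hgj]
    by_cases hff : f (X ∘ e1) = f (X ∘ e2)
    · right
      refine ⟨L2, ?_⟩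
      intro h3
      have := (mk (fun _ => 0) 1).2.2
      apply this
      have E1 : (X ∘ e1) = fun j => X (some j, 0) := rfl
      have E3 : (X ∘ e3) = Function.update (fun j => X (some j, 0)) i (X (none, 1)) := by
        funext j
        by_cases hj : j = i
        · subst hj; simp [e3]
        · simp [e3, hj]
      rw [← E3, h3]; exact hff
    · exact Or.inl ⟨L1, hff⟩
  rw [p1, p2] at this
  linarith
end moves
end TH

namespace TH
open Finset

section gc
variable {V : Type} [Fintype V] [Nonempty V]

lemma pr_rect {A B : Type} [Finite A] [Finite B] (P : A → Prop) (Q : B → Prop) :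
    pr (fun p : A × B => P p.1 ∧ Q p.2) = pr P * pr Q := by
  classical
  cases nonempty_fintype A
  rw [pr_prod, pr_eq_sum, div_mul_eq_mul_div, Finset.sum_mul]
  congr 1
  refine Finset.sum_congr rfl fun a _ => ?_
  split_ifs with h
  · simp [h]
  · simp [h, pr]

lemma majority {C : Type} [Nonempty C] (N : V → Prop) (f : V → C) (η : ℝ)
    (h : pr (fun p : V × V => N p.1 ∧ N p.2 ∧ f p.1 ≠ f p.2) ≤ η) :
    ∃ o : C, pr (fun y => N y ∧ f y ≠ o) ≤ √η := by
  have hη : 0 ≤ η := (pr_nonneg _).trans h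
  rcases eq_or_lt_of_le hη with h0 | h0
  · -- all equal
    by_cases hN : ∃ y, N y
    · obtain ⟨y0, hy0⟩ := hN
      refine ⟨f y0, ?_⟩
      rw [← h0] at h ⊢
      by_contra hc
      simp only [Real.sqrt_zero, not_le] at hc
      obtain ⟨y, hy⟩ := exists_of_pr_pos hc
      have : 0 < pr (fun p : V × V => N p.1 ∧ N p.2 ∧ f p.1 ≠ f p.2) := by
        rw [pr_def]
        have hm : (y, y0) ∈ (@Finset.filter (V × V) (fun p => N p.1 ∧ N p.2 ∧ f p.1 ≠ f p.2)
          (fun _ => Classical.propDecidable _) univ) := by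
          simp [hy.1, hy0, hy.2]
        have h1 : 0 < _ := Finset.card_pos.2 ⟨_, hm⟩
        have h2 : (0:ℝ) < Fintype.card (V × V) := by exact_mod_cast Fintype.card_pos
        have h3 := (Nat.cast_pos (α := ℝ)).2 h1
        exact div_pos h3 h2
      linarith
    · push Not at hN
      refine ⟨Classical.arbitrary C, ?_⟩
      refine le_trans (le_of_eq ?_) (Real.sqrt_nonneg _)
      simp [pr, hN]
  · by_contra hc
    push Not at hc
    have hs : 0 < √η := Real.sqrt_pos.2 h0
    have h1 : √η < pr N := (hc (Classical.arbitrary C)).trans_le (pr_mono fun a ha => ha.1)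
    have h2 := le_pr_prod (P := fun p : V × V => N p.1 ∧ N p.2 ∧ f p.1 ≠ f p.2) (Q := N)
      hs.le le_rfl (fun a ha => by
        refine (hc (f a)).le.trans (pr_mono ?_)
        intro b hb
        exact ⟨ha, hb.1, fun h => hb.2 h.symm⟩)
    have h3 : √η * √η = η := Real.mul_self_sqrt hη
    nlinarith

lemma majority_avg {C : Type} [Nonempty C] (L : V → V → Prop) (f : V → V → C) (η : ℝ)
    (h : pr (fun p : V × (V × V) => L p.1 p.2.1 ∧ L p.1 p.2.2 ∧ f p.1 p.2.1 ≠ f p.1 p.2.2) ≤ η) :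
    ∃ o : V → C, pr (fun p : V × V => L p.1 p.2 ∧ f p.1 p.2 ≠ o p.1) ≤ √η := by
  set e : V → ℝ := fun x => pr (fun p : V × V => L x p.1 ∧ L x p.2 ∧ f x p.1 ≠ f x p.2) with he
  have := fun x => majority (L x) (f x) (e x) le_rfl
  choose o ho using this
  refine ⟨o, ?_⟩
  have hn : (0:ℝ) < Fintype.card V := by exact_mod_cast Fintype.card_pos
  rw [pr_prod]
  have h1 : (∑ a, pr (fun b => L a b ∧ f a b ≠ o a)) / Fintype.card V ≤
      (∑ a, √(e a)) / Fintype.card V := by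
    gcongr with a
    exact ho a
  refine h1.trans ?_
  apply Real.le_sqrt_of_sq_le
  refine (jensen_pow (fun a => √(e a)) (fun _ => Real.sqrt_nonneg _) 2).trans ?_
  rw [pr_prod] at h
  refine le_trans (le_of_eq ?_) h
  congr 1
  exact Finset.sum_congr rfl fun a _ => Real.sq_sqrt (pr_nonneg _)

lemma graph_color {C : Type} (L : V → V → Prop) (hL : ∀ x y, L x y → L y x) (f : V → V → C)
    (α η : ℝ) (hαη : 4 * √η < α)
    (hd : 5 / 9 + α ≤ pr (fun p : V × V => L p.1 p.2))
    (h1 : pr (fun p : V × (V × V) => L p.1 p.2.1 ∧ L p.1 p.2.2 ∧ f p.1 p.2.1 ≠ f p.1 p.2.2) ≤ η)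
    (h2 : pr (fun p : V × (V × V) => L p.2.1 p.1 ∧ L p.2.2 p.1 ∧ f p.2.1 p.1 ≠ f p.2.2 p.1) ≤ η) :
    ∃ (c : C) (X : V → Prop), 2 / 3 ≤ pr X ∧
      pr (fun p : V × V => L p.1 p.2 ∧ ¬ (X p.1 ∧ X p.2 ∧ f p.1 p.2 = c)) ≤
        (1 - pr X) ^ 2 + 4 * √η := by
  have hC : Nonempty C := ⟨f (Classical.arbitrary V) (Classical.arbitrary V)⟩
  obtain ⟨o, ho⟩ := majority_avg L f η h1
  obtain ⟨q, hq⟩ := majority_avg (fun x y => L y x) (fun x y => f y x) η h2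
  have ho' : pr (fun p : V × V => L p.1 p.2 ∧ f p.2 p.1 ≠ o p.2) ≤ √η := by
    rw [← pr_swap]
    refine le_trans (pr_mono ?_) ho
    rintro ⟨x, y⟩ ⟨a, b⟩
    exact ⟨hL _ _ a, b⟩
  have hq' : pr (fun p : V × V => L p.1 p.2 ∧ f p.2 p.1 ≠ q p.1) ≤ √η := by
    refine le_trans (pr_mono ?_) hq
    rintro ⟨x, y⟩ ⟨a, b⟩
    exact ⟨hL _ _ a, b⟩
  have hq'' : pr (fun p : V × V => L p.1 p.2 ∧ f p.1 p.2 ≠ q p.2) ≤ √η := by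
    rw [← pr_swap]
    refine le_trans (pr_mono ?_) hq
    rintro ⟨x, y⟩ ⟨a, b⟩
    exact ⟨a, b⟩
  set L' : V → V → Prop := fun x y => L x y ∧ f x y = o x ∧ f x y = q y ∧ f y x = o y ∧ f y x = q x
    with hL'
  have hLL' : pr (fun p : V × V => L p.1 p.2 ∧ ¬ L' p.1 p.2) ≤ 4 * √η := by
    have a1 : pr (fun p : V × V => L p.1 p.2 ∧ ¬ L' p.1 p.2) ≤ _ + _ :=
      pr_le_add (Q := fun p : V × V => (L p.1 p.2 ∧ f p.1 p.2 ≠ o p.1) ∨ (L p.1 p.2 ∧ f p.1 p.2 ≠ q p.2))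
       (R := fun p : V × V => (L p.1 p.2 ∧ f p.2 p.1 ≠ o p.2) ∨ (L p.1 p.2 ∧ f p.2 p.1 ≠ q p.1))
       (by rintro ⟨x, y⟩ ⟨h, h'⟩; simp only [hL'] at h' ⊢; tauto)
    have a2 := pr_or_le (fun p : V × V => (L p.1 p.2 ∧ f p.1 p.2 ≠ o p.1)) (fun p => (L p.1 p.2 ∧ f p.1 p.2 ≠ q p.2))
    have a3 := pr_or_le (fun p : V × V => (L p.1 p.2 ∧ f p.2 p.1 ≠ o p.2)) (fun p => (L p.1 p.2 ∧ f p.2 p.1 ≠ q p.1))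
    linarith
  have hdL' : 5 / 9 < pr (fun p : V × V => L' p.1 p.2) := by
    have := pr_le_add (P := fun p : V × V => L p.1 p.2) (Q := fun p => L' p.1 p.2)
      (R := fun p : V × V => L p.1 p.2 ∧ ¬ L' p.1 p.2) (by intro a ha; tauto)
    linarith
  have hn : (0:ℝ) < Fintype.card V := by exact_mod_cast Fintype.card_pos
  -- a large class
  have hx0 : ∃ x0, 5 / 9 < pr (fun y => o y = q x0 ∧ q y = o x0) := by
    by_contra hc
    push Not at hc
    have : pr (fun p : V × V => L' p.1 p.2) ≤ 5 / 9 := by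
      apply pr_prod_le
      intro x
      refine le_trans (pr_mono ?_) (hc x)
      intro y hy
      simp only [hL'] at hy
      exact ⟨hy.2.2.2.1.symm.trans hy.2.2.2.2, hy.2.2.1.symm.trans hy.2.1⟩
    linarith
  obtain ⟨x0, hx0⟩ := hx0
  generalize q x0 = d at hx0
  generalize o x0 = c at hx0
  by_cases hcd : c = d
  · subst hcd
    set X : V → Prop := fun y => o y = c ∧ q y = c with hX
    have hsub : ∀ x y, L' x y → (X x ∧ X y ∧ f x y = c) ∨ (¬ X x ∧ ¬ X y) := by
      intro x y h
      simp only [hL', hX] at h ⊢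
      obtain ⟨-, e1, e2, e3, e4⟩ := h
      rw [e2] at e1; rw [e4] at e3
      rw [e2, ← e1, ← e3]
      tauto
    have hnX : pr (fun y => ¬ X y) = 1 - pr X := pr_not X
    have hb : pr (fun p : V × V => L' p.1 p.2) ≤ pr X * pr X + (1 - pr X) * (1 - pr X) := by
      rw [← hnX, ← pr_rect, ← pr_rect]
      apply pr_le_add
      rintro ⟨x, y⟩ h
      rcases hsub x y h with h | h
      · exact Or.inl ⟨h.1, h.2.1⟩
      · exact Or.inr h
    refine ⟨c, X, ?_, ?_⟩
    · by_contra hc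
      push Not at hc
      nlinarith
    · rw [sq, ← hnX, ← pr_rect]
      refine le_trans (pr_le_add ?_) (add_le_add_right hLL' _)
      rintro ⟨x, y⟩ ⟨h, h'⟩
      by_cases hl : L' x y
      · left
        rcases hsub x y hl with h3 | h3
        · exact absurd h3 h'
        · exact h3
      · exact Or.inr ⟨h, hl⟩
  · exfalso
    set A : V → Prop := fun y => o y = d ∧ q y = c with hA
    set B : V → Prop := fun y => o y = c ∧ q y = d with hB
    have hsub : ∀ x y, L' x y → (A x ∧ B y) ∨ (B x ∧ A y) ∨ ((¬ (A x ∨ B x)) ∧ (¬ (A y ∨ B y))) := by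
      intro x y h
      simp only [hL', hA, hB] at h ⊢
      obtain ⟨-, e1, e2, e3, e4⟩ := h
      rw [e2] at e1; rw [e4] at e3
      rw [← e1, ← e3]
      tauto
    have hAB : pr (fun y => A y ∨ B y) = pr A + pr B := by
      classical
      have hdis : ∀ y, ¬ (A y ∧ B y) := by
        rintro y ⟨⟨h1, h2⟩, ⟨h3, h4⟩⟩
        exact hcd (h3.symm.trans h1)
      rw [pr_eq_sum, pr_eq_sum, pr_eq_sum, ← add_div, ← Finset.sum_add_distrib]
      congr 1
      refine Finset.sum_congr rfl fun y _ => ?_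
      have := hdis y
      by_cases h1 : A y <;> by_cases h2 : B y
      · exact absurd ⟨h1, h2⟩ this
      · simp [h1, h2]
      · simp [h1, h2]
      · simp [h1, h2]
    have hO := pr_not (fun y => A y ∨ B y)
    have hb : pr (fun p : V × V => L' p.1 p.2) ≤ pr A * pr B + pr B * pr A +
        (1 - (pr A + pr B)) * (1 - (pr A + pr B)) := by
      rw [← hAB, ← hO, ← pr_rect, ← pr_rect, ← pr_rect]
      apply pr_le_add3
      rintro ⟨x, y⟩ h
      exact hsub x y h
    have h0 := pr_nonneg (fun y => ¬ (A y ∨ B y))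
    rw [hO, hAB] at h0
    have h1 := pr_nonneg B
    nlinarith
end gc
end TH

namespace TH
open Finset

section st
variable {V : Type} {q : ℕ}

/-- The state with first two entries `x`, `y` and remaining entries `S`. -/
def st (x y : V) (S : Fin q → V) : Fin (q+2) → V :=
  Fin.cons (α := fun _ => V) x (Fin.cons (α := fun _ => V) y S)

@[simp] lemma st_zero (x y : V) (S : Fin q → V) : st x y S 0 = x := rfl
@[simp] lemma st_one (x y : V) (S : Fin q → V) : st x y S 1 = y := rfl
@[simp] lemma st_succ (x y : V) (S : Fin q → V) (j : Fin q) : st x y S j.succ.succ = S j := rfl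

lemma st_update_zero (x y u : V) (S : Fin q → V) : Function.update (st x y S) 0 u = st u y S := by
  unfold st; rw [Fin.update_cons_zero]

lemma st_update_one (x y u : V) (S : Fin q → V) : Function.update (st x y S) 1 u = st x u S := by
  unfold st
  rw [show (1 : Fin (q+2)) = Fin.succ 0 from rfl, ← Fin.cons_update, Fin.update_cons_zero]

lemma st_update_succ (x y u : V) (S : Fin q → V) (j : Fin q) :
    Function.update (st x y S) j.succ.succ u = st x y (Function.update S j u) := by
  unfold st
  rw [← Fin.cons_update, ← Fin.cons_update]

def stEquiv (V : Type) (q : ℕ) : (Fin q → V) × (V × V) ≃ (Fin (q+2) → V) where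
  toFun p := st p.2.1 p.2.2 p.1
  invFun t := (fun j => t j.succ.succ, (t 0, t 1))
  left_inv p := rfl
  right_inv t := by
    funext i
    refine Fin.cases rfl (fun i => ?_) i
    refine Fin.cases rfl (fun i => ?_) i
    rfl

variable [Fintype V] [Nonempty V]

lemma pr_st (P : (Fin (q+2) → V) → Prop) :
    pr P = pr (fun p : (Fin q → V) × (V × V) => P (st p.2.1 p.2.2 p.1)) :=
  (pr_equiv (stEquiv V q) P).symm

lemma pr_and_or {A : Type} [Finite A] (P Q : A → Prop) :
    pr (fun a => P a ∨ Q a) + pr (fun a => P a ∧ Q a) = pr P + pr Q := by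
  classical
  cases nonempty_fintype A
  simp only [pr_eq_sum]
  rw [← add_div, ← add_div, ← Finset.sum_add_distrib, ← Finset.sum_add_distrib]
  congr 1
  refine Finset.sum_congr rfl fun a _ => ?_
  by_cases h1 : P a <;> by_cases h2 : Q a <;> simp [h1, h2]

lemma overlap (X X' : V → Prop) (R R' : V × V → Prop) (β : ℝ)
    (hX : 2/3 ≤ pr X) (hX' : 2/3 ≤ pr X')
    (h1 : ∀ p, R p → X p.1 ∧ X p.2) (h2 : ∀ p, R' p → X' p.1 ∧ X' p.2)
    (hR : 5/9 + β - (1 - pr X)^2 ≤ pr R) (hR' : 5/9 + β - (1 - pr X')^2 ≤ pr R') :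
    2 * β ≤ pr (fun p => R p ∧ R' p) := by
  have a1 := pr_and_or R R'
  have a2 := pr_and_or (fun p : V × V => X p.1 ∧ X p.2) (fun p : V × V => X' p.1 ∧ X' p.2)
  have a3 := pr_and_or X X'
  have a4 : pr (fun p => R p ∨ R' p) ≤
      pr (fun p : V × V => (X p.1 ∧ X p.2) ∨ (X' p.1 ∧ X' p.2)) := by
    apply pr_mono
    rintro p (h | h)
    · exact Or.inl (h1 p h)
    · exact Or.inr (h2 p h)
  have a5 : pr (fun p : V × V => (X p.1 ∧ X p.2) ∧ (X' p.1 ∧ X' p.2)) =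
      pr (fun v => X v ∧ X' v) * pr (fun v => X v ∧ X' v) := by
    rw [← pr_rect]
    apply pr_congr
    intro p; tauto
  rw [pr_rect, pr_rect, a5] at a2
  have a6 := pr_le_one (fun a => X a ∨ X' a)
  have a7 := pr_le_one X
  have a8 := pr_le_one X'
  set w := pr (fun v => X v ∧ X' v)
  set x := pr X
  set x' := pr X'
  have hw : x + x' - 1 ≤ w := by linarith
  have hw2 : (x + x' - 1)^2 ≤ w * w := by nlinarith
  nlinarith [sq_nonneg (x - x'), mul_nonneg (by linarith : 0 ≤ 1/3 - (x - x')) (by linarith : 0 ≤ 1/3 + (x - x'))]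

/-- Hybrid argument: a colour of `q`-tuples which rarely changes under moves is nearly constant. -/
lemma hybrid {C : Type} (c : (Fin q → V) → C) (ε : ℝ)
    (h : ∀ j : Fin q, pr (fun p : (Fin q → V) × V => c p.1 ≠ c (Function.update p.1 j p.2)) ≤ ε) :
    ∃ c0, pr (fun S => c S ≠ c0) ≤ q * ε := by
  let H : ℕ → (Fin q → V) × (Fin q → V) → (Fin q → V) := fun j p i => if i.1 < j then p.2 i else p.1 i
  have key : pr (fun p : (Fin q → V) × (Fin q → V) => c p.1 ≠ c p.2) ≤ q * ε := by
    refine (pr_le_finset_sum (univ : Finset (Fin q)) _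
      (fun j p => c (H j.1 p) ≠ c (H (j.1+1) p)) ?_).trans ?_
    · intro p hp
      by_contra hc
      push Not at hc
      have : ∀ j : ℕ, j ≤ q → c (H j p) = c p.1 := by
        intro j
        induction j with
        | zero => intro _; congr 1
        | succ j ih =>
          intro hj
          rw [← ih (by omega)]
          exact (hc ⟨j, by omega⟩ (mem_univ _)).symm
      apply hp
      rw [← this q le_rfl]
      congr 1
      funext i
      simp [H]
    · have : ∀ j : Fin q, pr (fun p => c (H j.1 p) ≠ c (H (j.1+1) p)) ≤ ε := by
        intro j
        refine le_trans (le_of_eq ?_) (h j)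
        let e1 : Fin q → Fin q ⊕ Fin q := fun i => if i.1 < j.1 then Sum.inr i else Sum.inl i
        let e2 : Unit → Fin q ⊕ Fin q := fun _ => Sum.inr j
        have hinj : Function.Injective (Sum.elim e1 e2) := by
          rintro (a | a) (b | b) hab <;> simp only [Sum.elim_inl, Sum.elim_inr, e1, e2] at hab <;>
            (try split_ifs at hab) <;> simp_all
        have h1 := pr_pair (V := V) e1 e2 hinj
          (fun S u => c S ≠ c (Function.update S j (u ())))
        have h2 := pr_equiv ((Equiv.refl (Fin q → V)).prodCongr (Equiv.funUnique Unit V))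
          (fun p : (Fin q → V) × V => c p.1 ≠ c (Function.update p.1 j p.2))
        rw [← h2]
        refine Eq.trans ?_ h1
        rw [← pr_equiv (Equiv.sumArrowEquivProdArrow (Fin q) (Fin q) V)]
        apply pr_congr
        intro X
        have E1 : H j.1 ((Equiv.sumArrowEquivProdArrow (Fin q) (Fin q) V) X) = X ∘ e1 := by
          funext i
          simp only [H, e1, Function.comp]
          split_ifs <;> rfl
        have E2 : H (j.1+1) ((Equiv.sumArrowEquivProdArrow (Fin q) (Fin q) V) X) =
            Function.update (X ∘ e1) j ((X ∘ e2) ()) := by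
          funext i
          by_cases hij : i = j
          · subst hij; simp [H, e2, Equiv.sumArrowEquivProdArrow]
          · have : i.1 ≠ j.1 := fun h => hij (Fin.ext h)
            simp only [H, e1, Function.comp, Function.update_of_ne hij]
            by_cases h3 : i.1 < j.1
            · rw [if_pos (by omega), if_pos h3]; rfl
            · rw [if_neg (by omega), if_neg h3]; rfl
        rw [E1, E2]
      calc _ ≤ ∑ _j : Fin q, ε := Finset.sum_le_sum fun j _ => this j
        _ = _ := by simp
  obtain ⟨S0, hS0⟩ := exists_le_of_pr_prod key
  refine ⟨c S0, le_trans (pr_mono ?_) hS0⟩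
  intro S hS h
  exact hS h.symm

end st
end TH

namespace TH
open Finset

def eqA (V : Type) (q : ℕ) : (Fin q → V) × (V × (V × V)) ≃ (Fin (q+2) → V) × V where
  toFun p := (st p.2.2.1 p.2.1 p.1, p.2.2.2)
  invFun t := (fun j => t.1 j.succ.succ, (t.1 1, (t.1 0, t.2)))
  left_inv p := rfl
  right_inv t := by
    have := (stEquiv V q).right_inv t.1
    exact Prod.ext this rfl

def eqB (V : Type) (q : ℕ) : (Fin q → V) × (V × (V × V)) ≃ (Fin (q+2) → V) × V where
  toFun p := (st p.2.1 p.2.2.1 p.1, p.2.2.2)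
  invFun t := (fun j => t.1 j.succ.succ, (t.1 0, (t.1 1, t.2)))
  left_inv p := rfl
  right_inv t := by
    have := (stEquiv V q).right_inv t.1
    exact Prod.ext this rfl

def eqC (V : Type) (q : ℕ) : ((Fin q → V) × V) × (V × V) ≃ (Fin (q+2) → V) × V where
  toFun p := (st p.2.1 p.2.2 p.1.1, p.1.2)
  invFun t := ((fun j => t.1 j.succ.succ, t.2), (t.1 0, t.1 1))
  left_inv p := rfl
  right_inv t := by
    have := (stEquiv V q).right_inv t.1
    exact Prod.ext this rfl

lemma eqA_apply (V : Type) (q : ℕ) (p) : eqA V q p = (st p.2.2.1 p.2.1 p.1, p.2.2.2) := rfl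
lemma eqB_apply (V : Type) (q : ℕ) (p) : eqB V q p = (st p.2.1 p.2.2.1 p.1, p.2.2.2) := rfl
lemma eqC_apply (V : Type) (q : ℕ) (p) : eqC V q p = (st p.2.1 p.2.2 p.1.1, p.1.2) := rfl

section struct
variable {V : Type} {q : ℕ} [Fintype V] [Nonempty V]

lemma pr_update {ι : Type} [Finite ι] [DecidableEq ι] (j : ι) (Q : (ι → V) → Prop) :
    pr (fun p : (ι → V) × V => Q (Function.update p.1 j p.2)) = pr Q := by
  let e : ι → Option ι := fun i => if i = j then none else some i
  have he : Function.Injective e := by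
    intro a b hab
    simp only [e] at hab
    split_ifs at hab <;> simp_all
  rw [← pr_comp_inj (V := V) e he, ← pr_equiv (ocEquiv ι)]
  apply pr_congr
  intro p
  have : Function.update p.1 j p.2 = ((ocEquiv ι) p) ∘ e := by
    funext i
    by_cases h : i = j
    · subst h
      simp only [Function.update_self, Function.comp, e, if_true]; rfl
    · simp only [Function.update_of_ne h, Function.comp, e, if_neg h]; rfl
  rw [this]

def Hyp (q : ℕ) (α : ℝ) (P : (Fin (q+2) → V) → Prop) : Prop :=
  (∀ (σ : Equiv.Perm (Fin (q+2))) (t : Fin (q+2) → V), P t → P (t ∘ σ)) ∧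
  (∀ S : Fin q → V, Function.Injective S →
    5/9 + α ≤ pr (fun p : V × V => P (st p.1 p.2 S))) ∧
  (∀ t, P t → Function.Injective t)

/-- The structure of the pairs extending `S` to a state of `T`. -/
def GoodX (β : ℝ) (T : (Fin (q+2) → V) → Prop) (S : Fin q → V) (X : V → Prop) : Prop :=
  4/9 + β ≤ pr (fun p : V × V => X p.1 ∧ X p.2 ∧ T (st p.1 p.2 S)) ∧
  2/3 * pr X - 1/9 + β ≤ pr (fun p : V × V => X p.1 ∧ X p.2 ∧ T (st p.1 p.2 S))

def GoodS (β : ℝ) (T : (Fin (q+2) → V) → Prop) (S : Fin q → V) : Prop :=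
  ∃ X : V → Prop, GoodX β T S X

lemma st_swap (x y : V) (S : Fin q → V) : st x y S ∘ (Equiv.swap 0 1) = st y x S := by
  funext i
  refine Fin.cases (by simp) (fun i => ?_) i
  refine Fin.cases (by simp) (fun i => ?_) i
  simp only [Function.comp]
  rw [Equiv.swap_apply_of_ne_of_ne (Fin.succ_ne_zero _)]
  · simp
  · intro h
    have := congrArg Fin.val h
    simp at this

lemma const_color {C : Type} (α η η0 η1 : ℝ) (hα : 0 < α) (hη1 : 0 < η1) (hη0 : 0 < η0)
    (h41 : 4 * √η1 ≤ α / 2) (h4 : 4 * √η1 ≤ η / 2)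
    (P : (Fin (q+2) → V) → Prop) (hP : Hyp q α P) (f : (Fin (q+2) → V) → C)
    (hm : ∀ i, pr (fun p : (Fin (q+2) → V) × V => P p.1 ∧ P (Function.update p.1 i p.2) ∧
      f p.1 ≠ f (Function.update p.1 i p.2)) ≤ η0)
    (hn : (q:ℝ)^2 / Fintype.card V ≤ η0 / η1)
    (hM : η0 * (3 / η1 + q * (1/α + 6/η1)) ≤ η / 2) :
    ∃ c0 : C, pr (fun S => ¬ GoodS (α/2) (fun t => P t ∧ f t = c0) S) ≤ η ∧
      pr (fun t => P t ∧ f t ≠ c0) ≤ 1/9 + η := by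
  have hC : Nonempty C := ⟨f (fun _ => Classical.arbitrary V)⟩
  obtain ⟨hsymm, hdeg, hinj⟩ := hP
  set BA : (Fin q → V) → V × (V × V) → Prop := fun S p =>
    P (st p.2.1 p.1 S) ∧ P (st p.2.2 p.1 S) ∧ f (st p.2.1 p.1 S) ≠ f (st p.2.2 p.1 S) with hBA
  set BB : (Fin q → V) → V × (V × V) → Prop := fun S p =>
    P (st p.1 p.2.1 S) ∧ P (st p.1 p.2.2 S) ∧ f (st p.1 p.2.1 S) ≠ f (st p.1 p.2.2 S) with hBB
  have hA : pr (fun p : (Fin q → V) × (V × (V × V)) => BA p.1 p.2) ≤ η0 := by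
    refine le_trans (le_of_eq ?_) (hm 0)
    rw [← pr_equiv (eqA V q)]
    apply pr_congr
    rintro ⟨S, y, x, x'⟩
    simp only [hBA, eqA_apply, st_update_zero]
  have hB : pr (fun p : (Fin q → V) × (V × (V × V)) => BB p.1 p.2) ≤ η0 := by
    refine le_trans (le_of_eq ?_) (hm 1)
    rw [← pr_equiv (eqB V q)]
    apply pr_congr
    rintro ⟨S, y, x, x'⟩
    simp only [hBB, eqB_apply, st_update_one]
  set good : (Fin q → V) → Prop := fun S => Function.Injective S ∧ pr (BA S) ≤ η1 ∧ pr (BB S) ≤ η1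
    with hgood
  have hbad : pr (fun S => ¬ good S) ≤ 3 * η0 / η1 := by
    have a1 := pr_le_add3 (P := fun S => ¬ good S) (Q := fun S : Fin q → V => ¬ Function.Injective S)
      (R := fun S => η1 < pr (BA S)) (S := fun S => η1 < pr (BB S)) (by
        intro S hS
        by_contra hc
        push Not at hc
        exact hS hc)
    have a2 := pr_not_injective (V := V) (ι := Fin q)
    rw [Fintype.card_fin] at a2
    have a3 : pr (fun S => η1 < pr (BA S)) ≤ η0 / η1 :=
      pr_markov (P := fun p : (Fin q → V) × (V × (V × V)) => BA p.1 p.2) hη1 (by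
        rw [div_mul_cancel₀ _ hη1.ne']; exact hA)
    have a4 : pr (fun S => η1 < pr (BB S)) ≤ η0 / η1 :=
      pr_markov (P := fun p : (Fin q → V) × (V × (V × V)) => BB p.1 p.2) hη1 (by
        rw [div_mul_cancel₀ _ hη1.ne']; exact hB)
    have : 3 * η0 / η1 = η0 / η1 + η0 / η1 + η0 / η1 := by ring
    linarith
  have hgc : ∀ S, ∃ (c : C) (X : V → Prop), good S → 2/3 ≤ pr X ∧
      pr (fun p : V × V => P (st p.1 p.2 S) ∧ ¬ (X p.1 ∧ X p.2 ∧ f (st p.1 p.2 S) = c)) ≤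
        (1 - pr X)^2 + 4 * √η1 := by
    intro S
    by_cases hS : good S
    · obtain ⟨c, X, h1, h2⟩ := graph_color (fun x y => P (st x y S))
        (fun x y h => by rw [← st_swap]; exact hsymm _ _ h)
        (fun x y => f (st x y S)) α η1 (by linarith) (hdeg S hS.1) hS.2.2 hS.2.1
      exact ⟨c, X, fun _ => ⟨h1, h2⟩⟩
    · exact ⟨Classical.arbitrary C, fun _ => True, fun h => absurd h hS⟩
  choose c X hcX using hgc
  set R : (Fin q → V) → V × V → Prop := fun S p => P (st p.1 p.2 S) ∧
    (X S p.1 ∧ X S p.2 ∧ f (st p.1 p.2 S) = c S) with hR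
  have hRl : ∀ S, good S → 5/9 + α/2 - (1 - pr (X S))^2 ≤ pr (R S) := by
    intro S hS
    have h1 := (hcX S hS).2
    have h2 := hdeg S hS.1
    have h3 := pr_le_add (P := fun p : V × V => P (st p.1 p.2 S)) (Q := R S)
      (R := fun p : V × V => P (st p.1 p.2 S) ∧ ¬ (X S p.1 ∧ X S p.2 ∧ f (st p.1 p.2 S) = c S))
      (by intro p hp; simp only [hR]; tauto)
    linarith
  have hq0 : (0:ℝ) ≤ q := by positivity
  obtain ⟨c0, hc0⟩ := hybrid c (η0 / α + 6 * η0 / η1) (by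
    intro j
    have a1 := pr_le_add3 (P := fun p : (Fin q → V) × V => c p.1 ≠ c (Function.update p.1 j p.2))
      (Q := fun p : (Fin q → V) × V => ¬ good p.1) (R := fun p => ¬ good (Function.update p.1 j p.2))
      (S := fun p => good p.1 ∧ good (Function.update p.1 j p.2) ∧ c p.1 ≠ c (Function.update p.1 j p.2))
      (by intro p hp; tauto)
    have a2 := pr_fst (β := V) (fun S => ¬ good S)
    have a3 := pr_update (V := V) j (fun S => ¬ good S)
    have a4 : pr (fun p : (Fin q → V) × V => good p.1 ∧ good (Function.update p.1 j p.2) ∧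
        c p.1 ≠ c (Function.update p.1 j p.2)) ≤ η0 / α := by
      rw [le_div_iff₀ hα]
      refine (le_pr_prod (P := fun p : ((Fin q → V) × V) × (V × V) =>
        P (st p.2.1 p.2.2 p.1.1) ∧ P (st p.2.1 p.2.2 (Function.update p.1.1 j p.1.2)) ∧
        f (st p.2.1 p.2.2 p.1.1) ≠ f (st p.2.1 p.2.2 (Function.update p.1.1 j p.1.2)))
        hα.le le_rfl ?_).trans (le_trans (le_of_eq ?_) (hm j.succ.succ))
      · rintro ⟨S, u⟩ ⟨g1, g2, g3⟩
        have := overlap (X S) (X (Function.update S j u)) (R S) (R (Function.update S j u)) (α/2)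
          (hcX _ g1).1 (hcX _ g2).1 (fun p hp => ⟨hp.2.1, hp.2.2.1⟩) (fun p hp => ⟨hp.2.1, hp.2.2.1⟩)
          (hRl _ g1) (hRl _ g2)
        refine le_trans (by linarith) (this.trans (pr_mono ?_))
        rintro p ⟨h1, h2⟩
        refine ⟨h1.1, h2.1, ?_⟩
        rw [h1.2.2.2, h2.2.2.2]
        exact g3
      · rw [← pr_equiv (eqC V q)]
        apply pr_congr
        rintro ⟨⟨S, u⟩, x, y⟩
        simp only [eqC_apply, st_update_succ]
    have : 6 * η0 / η1 = 3 * η0 / η1 + 3 * η0 / η1 := by ring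
    linarith)
  have hfin : pr (fun S => ¬ (good S ∧ c S = c0)) ≤ η / 2 := by
    have := pr_le_add (P := fun S => ¬ (good S ∧ c S = c0)) (Q := fun S => ¬ good S)
      (R := fun S => c S ≠ c0) (by intro S hS; tauto)
    have e : η0 * (3 / η1 + q * (1/α + 6/η1)) = 3 * η0 / η1 + q * (η0 / α + 6 * η0 / η1) := by
      field_simp
    linarith
  have hη : 0 ≤ η / 2 := (pr_nonneg _).trans hfin
  refine ⟨c0, ?_, ?_⟩
  · refine le_trans (pr_mono ?_) (hfin.trans (by linarith))
    intro S hS hc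
    apply hS
    obtain ⟨g, hc⟩ := hc
    have h1 := (hcX S g).1
    have h2 := hRl S g
    have h3 : pr (R S) ≤ pr (fun p : V × V => X S p.1 ∧ X S p.2 ∧
        (P (st p.1 p.2 S) ∧ f (st p.1 p.2 S) = c0)) := by
      apply pr_mono
      rintro p ⟨h4, h5, h6, h7⟩
      exact ⟨h5, h6, h4, h7.trans hc⟩
    have h4 := pr_le_one (X S)
    refine ⟨X S, ?_, ?_⟩
    · nlinarith
    · nlinarith
  · rw [pr_st]
    have := pr_le_add (P := fun p : (Fin q → V) × (V × V) => P (st p.2.1 p.2.2 p.1) ∧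
      f (st p.2.1 p.2.2 p.1) ≠ c0) (Q := fun p => (good p.1 ∧ c p.1 = c0) ∧ P (st p.2.1 p.2.2 p.1) ∧
      f (st p.2.1 p.2.2 p.1) ≠ c0) (R := fun p => ¬ (good p.1 ∧ c p.1 = c0))
      (by intro p hp; tauto)
    rw [pr_fst (β := V × V) (fun S => ¬ (good S ∧ c S = c0))] at this
    have h2 : pr (fun p : (Fin q → V) × (V × V) => (good p.1 ∧ c p.1 = c0) ∧ P (st p.2.1 p.2.2 p.1) ∧
      f (st p.2.1 p.2.2 p.1) ≠ c0) ≤ 1/9 + η/2 := by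
      apply pr_prod_le
      intro S
      by_cases hS : good S ∧ c S = c0
      · have h3 := (hcX S hS.1).2
        have h4 := (hcX S hS.1).1
        have h5 := pr_le_one (X S)
        refine le_trans (pr_mono ?_) (h3.trans (by nlinarith))
        rintro p ⟨_, h6, h7⟩
        refine ⟨h6, fun h8 => h7 (h8.2.2.trans hS.2)⟩
      · refine le_trans (le_of_eq ?_) (by linarith : (0:ℝ) ≤ 1/9 + η/2)
        simp [pr, hS]
    linarith

theorem structure_thm (q : ℕ) (α : ℝ) (hα : 0 < α) (η : ℝ) (hη : 0 < η) :
    ∃ (K : ℕ) (c : ℝ) (n0 : ℕ), 0 < c ∧ ∀ (V : Type) [Fintype V] [Nonempty V]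
      (P : (Fin (q+2) → V) → Prop), Hyp q α P → n0 ≤ Fintype.card V →
      ∃ T : (Fin (q+2) → V) → Prop, (∀ t, T t → P t) ∧
        (∀ a b, T a → T b → c ≤ pr (fun z => Walk (Lk P) K a b z)) ∧
        pr (fun S => ¬ GoodS (α/2) T S) ≤ η ∧ pr (fun t => P t ∧ ¬ T t) ≤ 1/9 + η := by
  wlog hη2 : η ≤ 1/2 generalizing η
  · obtain ⟨K, c, n0, hc, h⟩ := this (1/2) (by norm_num) le_rfl
    refine ⟨K, c, n0, hc, fun V _ _ P hP hn => ?_⟩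
    obtain ⟨T, h1, h2, h3, h4⟩ := h V P hP hn
    push Not at hη2
    exact ⟨T, h1, h2, by linarith, by linarith⟩
  set η1 : ℝ := (min α η / 8)^2 with hη1
  have hmin : 0 < min α η := lt_min hα hη
  have hη1p : 0 < η1 := by positivity
  have hsq : √η1 = min α η / 8 := Real.sqrt_sq (by positivity)
  set M : ℝ := 3 / η1 + q * (1/α + 6/η1) with hM
  have hMp : 0 < M := by positivity
  set η0 : ℝ := η / (2 * M) with hη0
  have hη0p : 0 < η0 := by positivity
  set τ : ℝ := min 1 (η0 ^ (2 ^ (q+2+1)) / 4) with hτ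
  have hτp : 0 < τ := lt_min one_pos (by positivity)
  obtain ⟨K, c, hc, hreach⟩ := reach τ (2/9) hτp (min_le_left _ _) (by norm_num)
  obtain ⟨n1, hn1⟩ := exists_nat_gt ((q:ℝ)^2 / (η0 / η1))
  refine ⟨K, c, max n1 9, hc, ?_⟩
  intro V _ _ P hP hn
  classical
  have hn9 : 9 ≤ Fintype.card V := (le_max_right _ _).trans hn
  have hnn1 : n1 ≤ Fintype.card V := (le_max_left _ _).trans hn
  have hnp : (0:ℝ) < Fintype.card V := by exact_mod_cast (by omega : 0 < Fintype.card V)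
  obtain ⟨f, hf1, hf2⟩ := partition (Lk P) (fun a b h => h.symm) τ hτp.le
  obtain ⟨c0, hc1, hc2⟩ := const_color α η η0 η1 hα hη1p hη0p
    (by rw [hsq]; have := min_le_left α η; linarith)
    (by rw [hsq]; have := min_le_right α η; linarith) P hP f (by
      intro i
      by_contra hcon
      push Not at hcon
      have := moves P f τ hf1 i η0 hη0p.le hcon.le
      rw [Fintype.card_fin] at this
      have h2 : τ ≤ η0 ^ (2 ^ (q+2+1)) / 4 := min_le_right _ _
      have h3 : 0 < η0 ^ (2 ^ (q+2+1)) := by positivity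
      linarith)
    (by
      have h1 : (n1:ℝ) ≤ Fintype.card V := by exact_mod_cast hnn1
      rw [div_le_iff₀ hnp]
      rw [div_lt_iff₀ (by positivity)] at hn1
      have : 0 < η0 / η1 := by positivity
      nlinarith)
    (by rw [← hM, hη0]; field_simp; norm_num)
  set X := univ.filter (fun a => f a = c0) with hX
  have hprX : 2/9 ≤ pr (fun t => P t ∧ f t = c0) := by
    have h1 : 1/2 * (4/9) ≤ pr (fun t => P t ∧ f t = c0) := by
      rw [pr_st]
      refine le_pr_prod (Q := fun S => GoodS (α/2) (fun t => P t ∧ f t = c0) S) (by norm_num) ?_ ?_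
      · have := pr_not (fun S => GoodS (α/2) (fun t => P t ∧ f t = c0) S)
        linarith
      · rintro S ⟨Y, hY1, hY2⟩
        refine le_trans (by linarith) (hY1.trans (pr_mono ?_))
        intro p hp; exact hp.2.2
    linarith
  have hNp : (0:ℝ) < Fintype.card (Fin (q+2) → V) := by exact_mod_cast Fintype.card_pos
  have hXc : 2/9 * (Fintype.card (Fin (q+2) → V) : ℝ) ≤ X.card := by
    have h2 : 2/9 ≤ pr (fun t => f t = c0) := hprX.trans (pr_mono fun t ht => ht.2)
    rw [pr_def, le_div_iff₀ hNp] at h2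
    refine h2.trans (le_of_eq ?_)
    congr 2
    rw [hX]
    congr!
  have hX2 : 2 ≤ X.card := by
    have h3 : Fintype.card V ≤ Fintype.card (Fin (q+2) → V) := by
      rw [Fintype.card_fun, Fintype.card_fin]
      exact Nat.le_self_pow (by omega) _
    have h4 : (9:ℝ) ≤ Fintype.card (Fin (q+2) → V) := by exact_mod_cast hn9.trans h3
    have : (2:ℝ) ≤ X.card := by linarith
    exact_mod_cast this
  obtain ⟨r1, r2⟩ := hreach (Fin (q+2) → V) (Lk P) (fun a b h => h.symm) X (by convert hf2 c0) hXc hX2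
  have hXP : ∀ t, f t = c0 → P t := by
    intro t ht
    obtain ⟨b, hb⟩ := r1 t (by simp [hX, ht])
    exact hb.left
  refine ⟨fun t => P t ∧ f t = c0, fun t h => h.1, ?_, hc1, ?_⟩
  · intro a b ha hb
    exact r2 a (by simp [hX, ha.2]) b (by simp [hX, hb.2])
  · refine le_trans (pr_mono ?_) hc2
    rintro t ⟨h1, h2⟩
    exact ⟨h1, fun h => h2 ⟨h1, h⟩⟩
end struct
end TH

namespace TH
open Finset

section sel
variable {V : Type} [Fintype V] [Nonempty V]

open Classical in
lemma sel_step {ι I : Type} [Fintype ι] [Fintype I] [Nonempty I] (A : I → (ι → V) → Prop) (c : ℝ)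
    (hc : 0 < c) (hA : ∀ i, c ≤ pr (A i)) (U : Finset V) (w : I → ℝ) (hw : ∀ i, 0 < w i)
    (hU : (Fintype.card ι : ℝ) * U.card ≤ c/4 * Fintype.card V)
    (hn : (Fintype.card ι : ℝ)^2 ≤ c/4 * Fintype.card V) :
    ∃ x : ι → V, (∃ i, A i x) ∧ (∀ a, x a ∉ U) ∧ Function.Injective x ∧
      ∑ i, (if A i x then w i / 2 else w i) ≤ (1 - c/4) * ∑ i, w i := by
  have hnp : (0:ℝ) < Fintype.card V := by exact_mod_cast Fintype.card_pos
  set ok : (ι → V) → Prop := fun x => (∀ a, x a ∉ U) ∧ Function.Injective x with hok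
  have hbad : pr (fun x => ¬ ok x) ≤ c/2 := by
    have h1 := pr_le_add (P := fun x => ¬ ok x) (Q := fun x => ∃ a, x a ∈ U)
      (R := fun x : ι → V => ¬ Function.Injective x) (by
        intro x hx; simp only [hok] at hx
        by_contra hcon; push Not at hcon
        exact hx ⟨hcon.1, hcon.2⟩)
    have h2 := pr_hit (V := V) (ι := ι) U
    have h3 := pr_not_injective (V := V) (ι := ι)
    have h4 : (Fintype.card ι : ℝ) * (U.card / Fintype.card V) ≤ c/4 := by
      rw [← mul_div_assoc, div_le_iff₀ hnp]; exact hU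
    have h5 : (Fintype.card ι : ℝ)^2 / Fintype.card V ≤ c/4 := by
      rw [div_le_iff₀ hnp]; exact hn
    linarith
  have hgood : ∀ i, c/2 ≤ pr (fun x => A i x ∧ ok x) := by
    intro i
    have := pr_le_add (P := A i) (Q := fun x => A i x ∧ ok x) (R := fun x => ¬ ok x)
      (by intro x hx; tauto)
    have := hA i
    linarith
  -- averaging
  set g : (ι → V) → ℝ := fun x => ∑ i, if A i x ∧ ok x then w i else 0 with hg
  have hNp : (0:ℝ) < Fintype.card (ι → V) := by exact_mod_cast Fintype.card_pos
  have havg : c/2 * (∑ i, w i) * Fintype.card (ι → V) ≤ ∑ x, g x := by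
    simp only [hg]
    rw [Finset.sum_comm, Finset.mul_sum, Finset.sum_mul]
    refine Finset.sum_le_sum fun i _ => ?_
    have h1 := hgood i
    rw [pr_eq_sum, le_div_iff₀ hNp] at h1
    have h2 : ∑ x : ι → V, (if A i x ∧ ok x then w i else 0) =
        w i * ∑ x : ι → V, (if A i x ∧ ok x then (1:ℝ) else 0) := by
      rw [Finset.mul_sum]
      refine Finset.sum_congr rfl fun x _ => ?_
      split_ifs <;> simp
    rw [h2]
    calc _ = w i * (c/2 * Fintype.card (ι → V)) := by ring
      _ ≤ _ := by
        refine mul_le_mul_of_nonneg_left ?_ (hw i).le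
        convert h1
  have hWp : 0 < ∑ i, w i := Finset.sum_pos (fun i _ => hw i) univ_nonempty
  obtain ⟨x, -, hx⟩ := Finset.exists_le_of_sum_le (s := (univ : Finset (ι → V)))
    (f := fun _ => c/2 * ∑ i, w i) (g := g) univ_nonempty (by
      simp only [sum_const, card_univ, nsmul_eq_mul]
      linarith)
  have hgpos : 0 < g x := lt_of_lt_of_le (by positivity) hx
  have hex : ∃ i, A i x ∧ ok x := by
    by_contra hcon
    push Not at hcon
    have : g x = 0 := by
      simp only [hg]
      refine Finset.sum_eq_zero fun i _ => ?_
      rw [if_neg]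
      intro h; exact hcon i h.1 h.2
    linarith
  obtain ⟨i0, hi0, hokx⟩ := hex
  refine ⟨x, ⟨i0, hi0⟩, hokx.1, hokx.2, ?_⟩
  have : ∑ i, (if A i x then w i / 2 else w i) = ∑ i, w i - g x / 2 := by
    simp only [hg]
    rw [Finset.sum_div, ← Finset.sum_sub_distrib]
    refine Finset.sum_congr rfl fun i _ => ?_
    by_cases h : A i x <;> simp [h, hokx]
    ring
  rw [this]
  linarith

open Classical in
lemma sel_greedy {ι I : Type} [Fintype ι] [Fintype I] [Nonempty I] (A : I → (ι → V) → Prop) (c : ℝ)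
    (hc : 0 < c) (hA : ∀ i, c ≤ pr (A i)) (U : Finset V) (N : ℕ)
    (hU : (Fintype.card ι : ℝ) * U.card ≤ c/8 * Fintype.card V)
    (hN : (Fintype.card ι : ℝ)^2 * N ≤ c/8 * Fintype.card V)
    (hn : (Fintype.card ι : ℝ)^2 ≤ c/4 * Fintype.card V) :
    ∃ Z : ℕ → ι → V, (∀ j < N, ∃ i, A i (Z j)) ∧ (∀ j < N, ∀ a, Z j a ∉ U) ∧
      (∀ j < N, ∀ j' < N, ∀ a a', Z j a = Z j' a' → j = j' ∧ a = a') ∧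
      ∑ i, (1/2 : ℝ) ^ ((range N).filter (fun j => A i (Z j))).card ≤
        Fintype.card I * (1 - c/4) ^ N := by
  have hc1 : c ≤ 1 := (hA (Classical.arbitrary I)).trans (pr_le_one _)
  induction N with
  | zero => exact ⟨fun _ _ => Classical.arbitrary V, by simp, by simp, by simp, by simp⟩
  | succ N ih =>
    push_cast at hN
    obtain ⟨Z, z1, z2, z3, z4⟩ := ih (by nlinarith [sq_nonneg (Fintype.card ι : ℝ)])
    set U' : Finset V := U ∪ (range N).biUnion (fun j => univ.image (Z j)) with hU'
    have hU'c : (U'.card : ℝ) ≤ U.card + N * Fintype.card ι := by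
      have h1 : ((range N).biUnion (fun j => univ.image (Z j))).card ≤ N * Fintype.card ι := by
        calc _ ≤ ∑ j ∈ range N, (univ.image (Z j)).card := card_biUnion_le
          _ ≤ ∑ j ∈ range N, Fintype.card ι := Finset.sum_le_sum fun j _ => card_image_le
          _ = _ := by simp
      have h2 := card_union_le U ((range N).biUnion (fun j => univ.image (Z j)))
      exact_mod_cast h2.trans (by omega)
    obtain ⟨x, x1, x2, x3, x4⟩ := sel_step A c hc hA U'
      (fun i => (1/2 : ℝ) ^ ((range N).filter (fun j => A i (Z j))).card) (fun i => by positivity)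
      (by
        have : (0:ℝ) ≤ Fintype.card ι := by positivity
        nlinarith [mul_le_mul_of_nonneg_left hU'c this, sq_nonneg (Fintype.card ι : ℝ)]) hn
    have zne : ∀ j < N, Function.update Z N x j = Z j := by
      intro j hj
      rw [Function.update_of_ne (by omega)]
    have hxZ : ∀ j < N, ∀ a a', x a ≠ Z j a' := by
      intro j hj a a' h
      apply x2 a
      rw [hU', mem_union, mem_biUnion]
      exact Or.inr ⟨j, by simpa using hj, by simp [h]⟩
    refine ⟨Function.update Z N x, ?_, ?_, ?_, ?_⟩
    · intro j hj
      rcases Nat.lt_succ_iff_lt_or_eq.1 hj with h | h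
      · rw [zne j h]; exact z1 j h
      · subst h; simpa using x1
    · intro j hj
      rcases Nat.lt_succ_iff_lt_or_eq.1 hj with h | h
      · rw [zne j h]; exact z2 j h
      · subst h
        intro a h2
        rw [Function.update_self] at h2
        exact x2 a (by rw [hU']; exact mem_union_left _ h2)
    · intro j hj j' hj' a a' h
      rcases Nat.lt_succ_iff_lt_or_eq.1 hj with h1 | h1 <;>
      rcases Nat.lt_succ_iff_lt_or_eq.1 hj' with h2 | h2
      · rw [zne j h1, zne j' h2] at h
        exact z3 j h1 j' h2 a a' h
      · subst h2
        rw [zne j h1, Function.update_self] at h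
        exact absurd h.symm (hxZ j h1 _ _)
      · subst h1
        rw [zne j' h2, Function.update_self] at h
        exact absurd h (hxZ j' h2 _ _)
      · subst h1; subst h2
        rw [Function.update_self] at h
        exact ⟨rfl, x3 h⟩
    · have h0 : (0:ℝ) ≤ 1 - c/4 := by linarith
      calc _ = ∑ i, (if A i x then (1/2 : ℝ) ^ ((range N).filter (fun j => A i (Z j))).card / 2
              else (1/2 : ℝ) ^ ((range N).filter (fun j => A i (Z j))).card) := by
            refine Finset.sum_congr rfl fun i _ => ?_
            have e : (range N).filter (fun j => A i (Function.update Z N x j)) =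
                (range N).filter (fun j => A i (Z j)) := by
              refine Finset.filter_congr fun j hj => ?_
              rw [zne j (by simpa using hj)]
            rw [Finset.range_add_one, Finset.filter_insert, Function.update_self, e]
            split_ifs with h
            · rw [card_insert_of_notMem (by simp), pow_succ]; ring
            · rfl
        _ ≤ _ := x4
        _ ≤ (1 - c/4) * (Fintype.card I * (1 - c/4) ^ N) := by gcongr
        _ = _ := by ring

open Classical in
lemma selection (d C : ℕ) (c ζ : ℝ) (hc : 0 < c) (hζ : 0 < ζ) :
    ∃ n0 : ℕ, ∀ (V ι I : Type) [Fintype V] [Nonempty V] [Fintype ι] [Fintype I] [Nonempty I]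
      (A : I → (ι → V) → Prop) (U : Finset V) (N : ℕ),
      n0 ≤ Fintype.card V → Fintype.card ι = d → Fintype.card I ≤ (Fintype.card V) ^ C →
      (∀ i, c ≤ pr (A i)) → (d : ℝ) * U.card ≤ c/8 * Fintype.card V →
      (d : ℝ)^2 * N ≤ c/8 * Fintype.card V → ζ * Fintype.card V ≤ N →
      ∃ Z : ℕ → ι → V, (∀ j < N, ∃ i, A i (Z j)) ∧ (∀ j < N, ∀ a, Z j a ∉ U) ∧
      (∀ j < N, ∀ j' < N, ∀ a a', Z j a = Z j' a' → j = j' ∧ a = a') ∧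
      ∀ i, c/8 * N ≤ (((range N).filter (fun j => A i (Z j))).card : ℝ) := by
  have hlim := (isLittleO_pow_exp_pos_mul_atTop (k := C) (show 0 < c/8*ζ by positivity)).def
    (show (0:ℝ) < 1/2 by norm_num)
  obtain ⟨x0, hx0⟩ := Filter.eventually_atTop.1 hlim
  obtain ⟨n1, hn1⟩ := exists_nat_ge x0
  obtain ⟨n2, hn2⟩ := exists_nat_ge ((d:ℝ)^2 / (c/4))
  refine ⟨max n1 n2, ?_⟩
  intro V ι I _ _ _ _ _ A U N hn hd hI hA hU hN hNn
  have hn1' : (n1:ℝ) ≤ Fintype.card V := by exact_mod_cast (le_max_left _ _).trans hn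
  have hn2' : (n2:ℝ) ≤ Fintype.card V := by exact_mod_cast (le_max_right _ _).trans hn
  have hnp : (0:ℝ) < Fintype.card V := by exact_mod_cast Fintype.card_pos
  have hc1 : c ≤ 1 := (hA (Classical.arbitrary I)).trans (pr_le_one _)
  obtain ⟨Z, z1, z2, z3, z4⟩ := sel_greedy A c hc hA U N (by rw [hd]; exact hU)
    (by rw [hd]; exact hN) (by
      rw [hd]
      rw [div_le_iff₀ (by positivity)] at hn2
      nlinarith)
  refine ⟨Z, z1, z2, z3, ?_⟩
  intro i
  by_contra hcon
  push Not at hcon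
  set h := ((range N).filter (fun j => A i (Z j))).card with hh
  have e1 : (1/2:ℝ)^h ≤ Fintype.card I * (1 - c/4)^N := by
    refine le_trans ?_ z4
    exact Finset.single_le_sum (f := fun i => (1/2 : ℝ) ^ ((range N).filter (fun j => A i (Z j))).card)
      (fun i _ => by positivity) (mem_univ i)
  have e2 : Real.exp (-(h:ℝ)) ≤ (1/2:ℝ)^h := by
    have : Real.exp (-1) ≤ 1/2 := by
      rw [Real.exp_neg, one_div]
      apply inv_anti₀ (by norm_num)
      have := Real.add_one_le_exp (1:ℝ)
      linarith
    calc _ = (Real.exp (-1))^h := by rw [← Real.exp_nat_mul]; congr 1; ring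
      _ ≤ _ := by gcongr
  have e3 : (1 - c/4)^N ≤ Real.exp (-(c/4) * N) := by
    have : 1 - c/4 ≤ Real.exp (-(c/4)) := by
      have := Real.add_one_le_exp (-(c/4)); linarith
    calc _ ≤ (Real.exp (-(c/4)))^N := by
          gcongr
          linarith
      _ = _ := by rw [← Real.exp_nat_mul]; congr 1; ring
  have e4 : (Fintype.card I : ℝ) ≤ (Fintype.card V : ℝ)^C := by exact_mod_cast hI
  have e5 := hx0 (Fintype.card V) (hn1.trans hn1')
  rw [Real.norm_of_nonneg (by positivity), Real.norm_of_nonneg (by positivity)] at e5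
  have e6 : Real.exp (c/8*ζ * Fintype.card V) ≤ Real.exp (c/8*N) := by
    apply Real.exp_le_exp.2
    nlinarith
  have e7 : Real.exp (-(c/8*N)) < Real.exp (-(h:ℝ)) := by
    apply Real.exp_lt_exp.2; linarith
  have e8 : Real.exp (-(c/4) * N) = Real.exp (-(c/8*N)) * Real.exp (-(c/8*N)) := by
    rw [← Real.exp_add]; congr 1; ring
  have e9 : Real.exp (c/8*N) * Real.exp (-(c/8*N)) = 1 := by
    rw [← Real.exp_add]; simp
  have p1 := Real.exp_pos (-(c/8*N))
  have p2 := Real.exp_pos (c/8*N)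
  have e10 : Real.exp (-(c/8*N)) ≤ (1/2 * Real.exp (c/8*N)) * (Real.exp (-(c/8*N)) * Real.exp (-(c/8*N))) := by
    have q1 : (Fintype.card I : ℝ) ≤ 1/2 * Real.exp (c/8*N) := by linarith
    calc _ ≤ Fintype.card I * (1 - c/4)^N := by linarith
      _ ≤ (1/2 * Real.exp (c/8*N)) * (Real.exp (-(c/8*N)) * Real.exp (-(c/8*N))) := by
        rw [← e8]
        apply mul_le_mul q1 e3 _ (by positivity)
        exact pow_nonneg (by linarith) _
  have e11 : (1/2 * Real.exp (c/8*N)) * (Real.exp (-(c/8*N)) * Real.exp (-(c/8*N))) =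
      1/2 * Real.exp (-(c/8*N)) := by
    rw [show (1/2 * Real.exp (c/8*N)) * (Real.exp (-(c/8*N)) * Real.exp (-(c/8*N))) =
      1/2 * (Real.exp (c/8*N) * Real.exp (-(c/8*N))) * Real.exp (-(c/8*N)) by ring, e9]; ring
  linarith
end sel
end TH

namespace TH
open Finset

section lists
variable {V : Type} [Fintype V] [Nonempty V] {k : ℕ}

/-- All windows of length `k` satisfy `P`. -/
def Tight (P : (Fin k → V) → Prop) (l : List V) : Prop := ∀ t : Fin k → V, List.ofFn t <:+: l → P t

lemma Tight.mono {P : (Fin k → V) → Prop} {l l' : List V} (h : Tight P l) (h' : l' <:+: l) : Tight P l' :=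
  fun t ht => h t (ht.trans h')

lemma glue {P : (Fin k → V) → Prop} {p q r : List V} (h1 : Tight P (p ++ q)) (h2 : Tight P (q ++ r))
    (hk : k ≤ q.length + 1) : Tight P (p ++ q ++ r) := by
  rintro t ⟨s, s', h⟩
  by_cases hs : s.length < p.length
  · apply h1
    have a1 : (s ++ List.ofFn t) <+: (p ++ q ++ r) := ⟨s', h⟩
    have a2 : (p ++ q) <+: (p ++ q ++ r) := ⟨r, rfl⟩
    have a3 := List.prefix_of_prefix_length_le a1 a2 (by simp; omega)
    obtain ⟨u, hu⟩ := a3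
    exact ⟨s, u, hu⟩
  · push Not at hs
    apply h2
    have a1 : p <+: (p ++ q ++ r) := ⟨q ++ r, by simp⟩
    have a2 : s <+: (p ++ q ++ r) := ⟨List.ofFn t ++ s', by simpa using h⟩
    obtain ⟨u, hu⟩ := List.prefix_of_prefix_length_le a1 a2 hs
    refine ⟨u, s', ?_⟩
    rw [← hu] at h
    simpa using h

lemma tight_lk {P : (Fin k → V) → Prop} (hP : ∀ (σ : Equiv.Perm (Fin k)) t, P t → P (t ∘ σ))
    {t t' : Fin k → V} (h : Lk P t t') : Tight P (List.ofFn t ++ List.ofFn t') := by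
  rintro u ⟨s, s', hs⟩
  rcases Nat.eq_zero_or_pos k with rfl | hk
  · have : u = t := Subsingleton.elim _ _
    rw [this]; exact h.left
  have hlen : s.length + k + s'.length = k + k := by
    have := congrArg List.length hs
    simp at this; omega
  have : NeZero k := ⟨hk.ne'⟩
  have hu : ∀ j : Fin k, (List.ofFn t ++ List.ofFn t')[s.length + j.1]? = some (u j) := by
    intro j
    rw [← hs, List.append_assoc, List.getElem?_append_right (by omega), Nat.add_sub_cancel_left,
      List.getElem?_append_left (by simp)]
    simp
  have key : u = (fun i => if (decide (s.length ≤ i.1)) then t i else t' i) ∘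
      (Equiv.addLeft (Fin.ofNat k s.length)) := by
    funext j
    have := hu j
    show u j = if (decide (s.length ≤ (Fin.ofNat k s.length + j).1)) then t (Fin.ofNat k s.length + j) else t' (Fin.ofNat k s.length + j)
    have hv : (Fin.ofNat k s.length + j).1 = (s.length + j.1) % k := by
      simp [Fin.val_add]
    have hj := j.2
    by_cases hc : s.length + j.1 < k
    · rw [List.getElem?_append_left (by simpa using hc)] at this
      rw [Nat.mod_eq_of_lt hc] at hv
      have e : Fin.ofNat k s.length + j = ⟨s.length + j.1, hc⟩ := Fin.ext hv
      rw [e]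
      simp [hc] at this
      simp [this]
    · rw [List.getElem?_append_right (by simpa using hc)] at this
      have hv2 : (s.length + j.1) % k = s.length + j.1 - k := by
        rw [Nat.mod_eq_sub_mod (by omega), Nat.mod_eq_of_lt (by omega)]
      rw [hv2] at hv
      have e : Fin.ofNat k s.length + j = ⟨s.length + j.1 - k, by omega⟩ := Fin.ext hv
      rw [e]
      have h3 : s.length + j.1 - k < k := by omega
      have h4 : ¬ (s.length ≤ s.length + j.1 - k) := by omega
      simp [h3] at this
      simp [h4, this]
  rw [key]
  exact hP _ _ (h _)

/-- A tight list starting with the block `a` and ending with the block `b`. -/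
def Item (P : (Fin k → V) → Prop) (a : Fin k → V) (l : List V) (b : Fin k → V) : Prop :=
  Tight P l ∧ (∃ l2, l = List.ofFn a ++ l2) ∧ (∃ l1, l = l1 ++ List.ofFn b)

def Conn (P : (Fin k → V) → Prop) (b : Fin k → V) (c : List V) (a : Fin k → V) : Prop :=
  Tight P (List.ofFn b ++ c ++ List.ofFn a)

lemma Item.conn {P : (Fin k → V) → Prop} {a b a' : Fin k → V} {l c : List V} (h : Item P a l b)
    (hc : Conn P b c a') : Tight P (l ++ c ++ List.ofFn a') := by
  obtain ⟨h1, -, l1, rfl⟩ := h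
  have := glue (p := l1) (q := List.ofFn b) (r := c ++ List.ofFn a') h1
    (by simpa [Conn] using hc) (by simp)
  simpa using this

lemma Item.append {P : (Fin k → V) → Prop} {a b a' b' : Fin k → V} {l c l' : List V} (h : Item P a l b)
    (hc : Conn P b c a') (h' : Item P a' l' b') : Item P a (l ++ c ++ l') b' := by
  have h0 := h.conn hc
  obtain ⟨h1, ⟨l2, rfl⟩, -⟩ := h
  obtain ⟨h1', ⟨l2', h2'⟩, ⟨l1', h3'⟩⟩ := h'
  refine ⟨?_, ⟨l2 ++ c ++ l', by simp⟩, ⟨List.ofFn a ++ l2 ++ c ++ l1', by rw [h3']; simp⟩⟩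
  subst h2'
  have := glue (p := List.ofFn a ++ l2 ++ c) (q := List.ofFn a') (r := l2') h0 h1' (by simp)
  simpa using this

lemma item_single {P : (Fin k → V) → Prop} {a : Fin k → V} (h : P a) : Item P a (List.ofFn a) a := by
  refine ⟨?_, ⟨[], by simp⟩, ⟨[], by simp⟩⟩
  intro t ht
  have : List.ofFn t = List.ofFn a := ht.eq_of_length (by simp)
  rw [List.ofFn_injective this]; exact h

lemma conn_lk {P : (Fin k → V) → Prop} (hP : ∀ (σ : Equiv.Perm (Fin k)) t, P t → P (t ∘ σ))
    {t t' : Fin k → V} (h : Lk P t t') : Conn P t [] t' := by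
  simpa [Conn] using tight_lk hP h

lemma Item.append_lk {P : (Fin k → V) → Prop} (hP : ∀ (σ : Equiv.Perm (Fin k)) t, P t → P (t ∘ σ))
    {a b a' b' : Fin k → V} {l l' : List V} (h : Item P a l b)
    (hc : Lk P b a') (h' : Item P a' l' b') : Item P a (l ++ l') b' := by
  simpa using h.append (conn_lk hP hc) h'

lemma walk_conn {P : (Fin k → V) → Prop} (hP : ∀ (σ : Equiv.Perm (Fin k)) t, P t → P (t ∘ σ))
    (K : ℕ) (a b : Fin k → V) (z : Fin K → Fin k → V) (h : Walk (Lk P) K a b z) :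
    ∃ c : List V, Conn P a c b ∧ k ∣ c.length ∧
      (c : Multiset V) ≤ ∑ i, (List.ofFn (z i) : Multiset V) := by
  induction K generalizing a with
  | zero => exact ⟨[], conn_lk hP h, by simp, by simp⟩
  | succ K ih =>
    rcases h with h | ⟨h1, h2⟩
    · obtain ⟨c, h1, h2, h3⟩ := ih a _ h
      refine ⟨c, h1, h2, h3.trans ?_⟩
      rw [Fin.sum_univ_succ]
      exact Multiset.le_add_left _ _
    · obtain ⟨c, h3, h4, h5⟩ := ih (z 0) _ h2
      refine ⟨List.ofFn (z 0) ++ c, ?_, by simpa using h4, ?_⟩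
      · have := glue (p := List.ofFn a) (q := List.ofFn (z 0)) (r := c ++ List.ofFn b)
          (tight_lk hP h1) (by simpa [Conn] using h3) (by simp)
        simpa [Conn] using this
      · rw [Fin.sum_univ_succ, ← Multiset.coe_add]
        exact add_le_add_right h5 _

/-- Joining. -/
def J (l c : ℕ → List V) : ℕ → List V
  | 0 => l 0
  | t+1 => J l c t ++ c t ++ l (t+1)

lemma J_item {P : (Fin k → V) → Prop} (a b : ℕ → Fin k → V) (l c : ℕ → List V) (t : ℕ)
    (hl : ∀ i ≤ t, Item P (a i) (l i) (b i)) (hc : ∀ i < t, Conn P (b i) (c i) (a (i+1))) :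
    Item P (a 0) (J l c t) (b t) := by
  induction t with
  | zero => exact hl 0 le_rfl
  | succ t ih =>
    exact (ih (fun i hi => hl i (by omega)) (fun i hi => hc i (by omega))).append
      (hc t (by omega)) (hl _ le_rfl)

lemma J_coe (l c : ℕ → List V) (t : ℕ) :
    (J l c t : Multiset V) = ∑ i ∈ range (t+1), (l i : Multiset V) + ∑ i ∈ range t, (c i : Multiset V) := by
  induction t with
  | zero => simp [J]
  | succ t ih =>
    rw [J, ← Multiset.coe_add, ← Multiset.coe_add, ih, sum_range_succ _ (t+1), sum_range_succ (fun i => (c i : Multiset V)) t]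
    abel

lemma nodup_sum {ι : Type} (s : Finset ι) (f : ι → Multiset V) (h : ∀ i ∈ s, (f i).Nodup)
    (h2 : ∀ i ∈ s, ∀ j ∈ s, i ≠ j → Disjoint (f i) (f j)) : (∑ i ∈ s, f i).Nodup := by
  classical
  induction s using Finset.induction_on with
  | empty => simp
  | insert a s ha ih =>
    rw [sum_insert ha, Multiset.nodup_add]
    refine ⟨h a (mem_insert_self _ _), ih (fun i hi => h i (mem_insert_of_mem hi))
      (fun i hi j hj => h2 i (mem_insert_of_mem hi) j (mem_insert_of_mem hj)), ?_⟩
    rw [Multiset.disjoint_left]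
    intro x hx hx2
    rw [Multiset.mem_sum] at hx2
    obtain ⟨i, hi, hxi⟩ := hx2
    exact Multiset.disjoint_left.1 (h2 a (mem_insert_self _ _) i (mem_insert_of_mem hi)
      (by rintro rfl; exact ha hi)) hx hxi

/-- Greedy choice of distinct representatives. -/
lemma greedy_rep (M N : ℕ) (G : ℕ → ℕ → Prop) [∀ i, DecidablePred (G i)]
    (h : ∀ i < M, M ≤ #((range N).filter (G i))) :
    ∃ j : ℕ → ℕ, (∀ i < M, j i < N ∧ G i (j i)) ∧ ∀ i < M, ∀ i' < M, j i = j i' → i = i' := by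
  suffices H : ∀ t ≤ M, ∃ j : ℕ → ℕ, (∀ i < t, j i < N ∧ G i (j i)) ∧
      ∀ i < t, ∀ i' < t, j i = j i' → i = i' from H M le_rfl
  intro t ht
  induction t with
  | zero => exact ⟨fun _ => 0, by simp, by simp⟩
  | succ t ih =>
    obtain ⟨j, h1, h2⟩ := ih (by omega)
    have : ((range t).image j).card < #((range N).filter (G t)) :=
      by
      have h3 : ((range t).image j).card ≤ t := card_image_le.trans (by simp)
      have h4 := h t (by omega)
      omega
    obtain ⟨x, hx, hx2⟩ := exists_mem_notMem_of_card_lt_card this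
    rw [mem_filter, mem_range] at hx
    have hx3 : ∀ i < t, j i ≠ x := fun i hi he => hx2 (mem_image.2 ⟨i, mem_range.2 hi, he⟩)
    refine ⟨Function.update j t x, ?_, ?_⟩
    · intro i hi
      by_cases he : i = t
      · subst he; simpa using hx
      · rw [Function.update_of_ne he]; exact h1 i (by omega)
    · intro i hi i' hi' hh
      by_cases he : i = t <;> by_cases he' : i' = t
      · omega
      · subst he; rw [Function.update_self, Function.update_of_ne he'] at hh
        exact absurd hh.symm (hx3 i' (by omega))
      · subst he'; rw [Function.update_self, Function.update_of_ne he] at hh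
        exact absurd hh (hx3 i (by omega))
      · rw [Function.update_of_ne he, Function.update_of_ne he'] at hh
        exact h2 i (by omega) i' (by omega) hh

lemma sum_le_reindex (M N : ℕ) (j : ℕ → ℕ) (hj : ∀ i < M, j i < N)
    (hinj : ∀ i < M, ∀ i' < M, j i = j i' → i = i') (f D : ℕ → Multiset V)
    (h : ∀ i < M, f i ≤ D (j i)) : ∑ i ∈ range M, f i ≤ ∑ i ∈ range N, D i := by
  classical
  calc ∑ i ∈ range M, f i ≤ ∑ i ∈ range M, D (j i) := sum_le_sum (fun i hi => h i (mem_range.1 hi))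
    _ = ∑ x ∈ (range M).image j, D x := by
        rw [sum_image]
        intro a ha b hb hab
        exact hinj a (by simpa using ha) b (by simpa using hb) hab
    _ ≤ _ := by
        apply sum_le_sum_of_subset
        intro x hx
        obtain ⟨i, hi, rfl⟩ := mem_image.1 hx
        exact mem_range.2 (hj i (mem_range.1 hi))

/-- Closing up. -/
lemma close_cycle (hk : 0 < k) {P : (Fin k → V) → Prop} (a : Fin k → V) (L l2 : List V)
    (hL : L = List.ofFn a ++ l2) (hnd : L.Nodup) (hcov : ∀ v, v ∈ L)
    (hT : Tight P (L ++ List.ofFn a)) :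
    ∃ f : ZMod (Fintype.card V) → V, Function.Bijective f ∧
      ∀ i, P (fun j : Fin k => f (i + (j.1 : ZMod (Fintype.card V)))) := by
  classical
  have hlen : L.length = Fintype.card V := by
    rw [← List.toFinset_card_of_nodup hnd, ← card_univ]
    congr 1; ext v; simp [hcov]
  have hkn : k ≤ Fintype.card V := by rw [← hlen, hL]; simp
  have : NeZero (Fintype.card V) := ⟨by omega⟩
  refine ⟨fun i => L[i.val]'(by rw [hlen]; exact ZMod.val_lt i), ?_, ?_⟩
  · rw [Fintype.bijective_iff_injective_and_card]
    refine ⟨?_, by rw [ZMod.card]⟩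
    intro i i' h
    exact ZMod.val_injective _ ((hnd.getElem_inj_iff).1 h)
  · intro i
    apply hT
    refine ⟨(L ++ List.ofFn a).take i.val, (L ++ List.ofFn a).drop (i.val + k), ?_⟩
    have hi := ZMod.val_lt i
    have e : List.ofFn (fun j : Fin k => L[(i + (j.1 : ZMod (Fintype.card V))).val]'(by
        rw [hlen]; exact ZMod.val_lt _)) = ((L ++ List.ofFn a).drop i.val).take k := by
      apply List.ext_getElem
      · simp [hlen]; omega
      · intro m h1 h2
        have hm : m < k := by simpa using h1
        simp only [List.getElem_ofFn, List.getElem_take, List.getElem_drop]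
        have hv : (i + (m : ZMod (Fintype.card V))).val = (i.val + m) % Fintype.card V := by
          rw [ZMod.val_add, ZMod.val_natCast]; simp
        by_cases hc : i.val + m < L.length
        · rw [List.getElem_append_left hc]
          have : (i + (m : ZMod (Fintype.card V))).val = i.val + m := by
            rw [hv, Nat.mod_eq_of_lt (by omega)]
          simp [this]
        · rw [List.getElem_append_right (by omega)]
          have : (i + (m : ZMod (Fintype.card V))).val = i.val + m - L.length := by
            rw [hv, Nat.mod_eq_sub_mod (by omega), Nat.mod_eq_of_lt (by omega), hlen]
          simp only [this]
          have hlt : i.val + m - L.length < (List.ofFn a).length := by simp; omega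
          have h5 : L[i.val + m - L.length]? = some ((List.ofFn a)[i.val + m - L.length]) := by
            have h6 : L[i.val + m - L.length]? = (List.ofFn a ++ l2)[i.val + m - L.length]? :=
              congrArg (fun x : List V => x[i.val + m - L.length]?) hL
            rw [h6, List.getElem?_append_left hlt, List.getElem?_eq_getElem hlt]
          rw [List.getElem?_eq_getElem (by omega)] at h5
          exact Option.some.inj h5
    rw [e, List.append_assoc, ← List.drop_drop, List.take_append_drop, List.take_append_drop]

end lists
end TH

namespace TH
open Finset

lemma val_map_sum {A V : Type} (s : Finset A) (f : A → V) :
    s.val.map f = ∑ a ∈ s, ({f a} : Multiset V) := by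
  have h := Multiset.map_map (fun x => ({x} : Multiset V)) f s.val
  have h2 := Multiset.sum_map_singleton (s.val.map f)
  rw [h] at h2
  exact h2.symm

lemma ofFn_sum {V : Type} {k : ℕ} (f : Fin k → V) :
    (List.ofFn f : Multiset V) = ∑ a, ({f a} : Multiset V) := by
  rw [← val_map_sum, Fin.univ_val_map]

lemma pool (k K : ℕ) (c ζ : ℝ) (hc : 0 < c) (hζ : 0 < ζ) :
    ∃ n0 : ℕ, ∀ (V : Type) [Fintype V] [Nonempty V] (P T : (Fin k → V) → Prop) (U : Finset V) (N : ℕ),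
      (∀ (σ : Equiv.Perm (Fin k)) t, P t → P (t ∘ σ)) → n0 ≤ Fintype.card V →
      (∃ t, T t) → (∀ a b, T a → T b → c ≤ pr (fun z => Walk (Lk P) K a b z)) →
      ((K * k : ℕ) : ℝ) * U.card ≤ c/8 * Fintype.card V →
      ((K * k : ℕ) : ℝ)^2 * N ≤ c/8 * Fintype.card V → ζ * Fintype.card V ≤ N →
      ∃ R : Multiset V, R.Nodup ∧ (∀ v ∈ R, v ∉ U) ∧ R.card = K * k * N ∧
        ∀ (M : ℕ) (a b : ℕ → Fin k → V), (M : ℝ) ≤ c/8 * N → (∀ i < M, T (b i) ∧ T (a (i+1))) →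
          ∃ l : ℕ → List V, (∀ i < M, Conn P (b i) (l i) (a (i+1)) ∧ k ∣ (l i).length) ∧
            ∑ i ∈ range M, (l i : Multiset V) ≤ R := by
  classical
  obtain ⟨n0, h0⟩ := selection (K*k) (2*k) c ζ hc hζ
  refine ⟨n0, fun V _ _ P T U N hP hn ⟨t0, ht0⟩ hW hU hN hN2 => ?_⟩
  let I := {t : Fin k → V // T t} × {t : Fin k → V // T t}
  have : Nonempty I := ⟨(⟨t0, ht0⟩, ⟨t0, ht0⟩)⟩
  let A : I → (Fin K × Fin k → V) → Prop := fun i z => Walk (Lk P) K i.1.1 i.2.1 (fun x y => z (x, y))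
  have hA : ∀ i, c ≤ pr (A i) := by
    intro i
    refine (hW _ _ i.1.2 i.2.2).trans (le_of_eq ?_)
    rw [← pr_equiv (Equiv.curry (Fin K) (Fin k) V)]
    rfl
  have hI : Fintype.card I ≤ Fintype.card V ^ (2*k) := by
    rw [Fintype.card_prod, two_mul, pow_add]
    have : Fintype.card {t : Fin k → V // T t} ≤ Fintype.card V ^ k := by
      refine (Fintype.card_subtype_le _).trans ?_
      simp
    exact Nat.mul_le_mul this this
  obtain ⟨Z, h1, h2, h3, h4⟩ := h0 V (Fin K × Fin k) I A U N hn (by simp) hI hA hU hN hN2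
  let D : ℕ → Multiset V := fun j => (univ : Finset (Fin K × Fin k)).val.map (Z j)
  have hDs : ∀ j, D j = ∑ x : Fin K, (List.ofFn (fun y => Z j (x, y)) : Multiset V) := by
    intro j
    simp only [ofFn_sum]
    rw [← Fintype.sum_prod_type' (fun x y => ({Z j (x, y)} : Multiset V))]
    exact val_map_sum _ _
  have hmem : ∀ j v, v ∈ D j ↔ ∃ a, Z j a = v := by
    intro j v; simp [D]
  refine ⟨∑ j ∈ range N, D j, ?_, ?_, ?_, ?_⟩
  · apply nodup_sum
    · intro j hj
      refine Multiset.Nodup.map_on ?_ univ.nodup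
      intro x _ y _ hxy
      exact (h3 j (mem_range.1 hj) j (mem_range.1 hj) x y hxy).2
    · intro i hi j hj hij
      rw [Multiset.disjoint_left]
      intro v hv hv2
      obtain ⟨a, rfl⟩ := (hmem _ _).1 hv
      obtain ⟨a', ha'⟩ := (hmem _ _).1 hv2
      exact hij (h3 j (mem_range.1 hj) i (mem_range.1 hi) _ _ ha').1.symm
  · intro v hv
    rw [Multiset.mem_sum] at hv
    obtain ⟨j, hj, hv⟩ := hv
    obtain ⟨a, rfl⟩ := (hmem _ _).1 hv
    exact h2 j (mem_range.1 hj) a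
  · rw [Multiset.card_sum]
    simp [D, mul_comm]
  · intro M a b hM hT
    let G : ℕ → ℕ → Prop := fun i j => ∃ h : i < M, A (⟨b i, (hT i h).1⟩, ⟨a (i+1), (hT i h).2⟩) (Z j)
    obtain ⟨jj, g1, g2⟩ := greedy_rep M N G (by
      intro i hi
      have h5 := h4 (⟨b i, (hT i hi).1⟩, ⟨a (i+1), (hT i hi).2⟩)
      have h6 := hM.trans h5
      have h7 := Nat.cast_le.1 h6
      refine h7.trans (card_le_card ?_)
      intro j hj
      rw [mem_filter] at hj ⊢
      exact ⟨hj.1, hi, hj.2⟩)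
    have : ∀ i, ∃ l : List V, i < M → (Conn P (b i) l (a (i+1)) ∧ k ∣ l.length ∧
        (l : Multiset V) ≤ D (jj i)) := by
      intro i
      by_cases hi : i < M
      · obtain ⟨h5, h6, h7⟩ := g1 i hi
        obtain ⟨l, l1, l2, l3⟩ := walk_conn hP K _ _ _ h7
        exact ⟨l, fun _ => ⟨l1, l2, by rw [hDs]; exact l3⟩⟩
      · exact ⟨[], fun h => absurd h hi⟩
    choose l hl using this
    exact ⟨l, fun i hi => ⟨(hl i hi).1, (hl i hi).2.1⟩,
      sum_le_reindex M N jj (fun i hi => (g1 i hi).1) g2 _ D (fun i hi => (hl i hi).2.2)⟩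

end TH

namespace TH
open Finset

section ab
variable {V : Type} [Fintype V] [Nonempty V] {r : ℕ}

def p0 (r : ℕ) : Fin (r+1+2) := (0 : Fin (r+1)).succ.succ

def FA (P T : (Fin (r+1+2) → V) → Prop) (v : Fin (r+1+2) → V)
    (Y : Fin (r+1+2) × Fin (r+1+2) → V) : Prop :=
  T (fun i => Y (i, p0 r)) ∧ (∀ i, T (fun j => Y (i, j))) ∧
    ∀ i, P (Function.update (fun j => Y (i, j)) (p0 r) (v i))

lemma pr_T_lower {q : ℕ} (β η : ℝ) (hβ : 0 < β) (T : (Fin (q+2) → V) → Prop)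
    (h : pr (fun S => ¬ GoodS β T S) ≤ η) (hη : η ≤ 1) : (1 - η) * (4/9) ≤ pr T := by
  rw [pr_st]
  rw [pr_not] at h
  refine le_pr_prod (Q := fun S => GoodS β T S) (by norm_num) (by linarith) ?_
  rintro S ⟨X, hX, -⟩
  refine le_trans (by linarith) (hX.trans (pr_mono fun p hp => hp.2.2))

lemma ab_row (α β δ : ℝ) (hα : 0 < α) (hβ : 0 < β) (hδ : δ ≤ 1/4)
    (P T : (Fin (r+1+2) → V) → Prop) (hP : Hyp (r+1) α P)
    (hn : (4 * (r+1)^2 : ℝ) ≤ Fintype.card V) (w0 v0 : V)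
    (hw : pr (fun R : Fin r → V => ¬ GoodS β T (Fin.cons w0 R)) ≤ δ) :
    α/2 ≤ pr (fun x : Fin (r+1+2) → V => T (Function.update x (p0 r) w0) ∧
      P (Function.update x (p0 r) v0)) := by
  have hnp : (0:ℝ) < Fintype.card V := by exact_mod_cast Fintype.card_pos
  rw [pr_st]
  have hQ : (1:ℝ)/2 ≤ pr (fun S : Fin (r+1) → V => GoodS β T (Fin.cons w0 (Fin.tail S)) ∧
      Function.Injective (Fin.cons v0 (Fin.tail S) : Fin (r+1) → V)) := by
    rw [pr_fin_succ]
    simp only [Fin.tail_cons]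
    rw [pr_snd (fun R : Fin r → V => GoodS β T (Fin.cons w0 R) ∧
      Function.Injective (Fin.cons v0 R : Fin (r+1) → V))]
    have h1 := pr_not (fun R : Fin r → V => GoodS β T (Fin.cons w0 R) ∧
      Function.Injective (Fin.cons v0 R : Fin (r+1) → V))
    have h2 : pr (fun R : Fin r → V => ¬ (GoodS β T (Fin.cons w0 R) ∧
      Function.Injective (Fin.cons v0 R : Fin (r+1) → V))) ≤
        pr (fun R : Fin r → V => ¬ GoodS β T (Fin.cons w0 R)) +
        pr (fun R : Fin r → V => ¬ Function.Injective R) +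
        pr (fun R : Fin r → V => ∃ i, R i ∈ ({v0} : Finset V)) := by
      apply pr_le_add3
      intro R hR
      by_contra hc
      push Not at hc
      refine hR ⟨hc.1, ?_⟩
      rw [Fin.cons_injective_iff]
      refine ⟨?_, hc.2.1⟩
      rintro ⟨i, hi⟩
      exact hc.2.2 i (by simp [hi])
    have h3 := pr_not_injective (V := V) (ι := Fin r)
    have h4 := pr_hit (V := V) (ι := Fin r) {v0}
    simp only [Fintype.card_fin, card_singleton] at h3 h4
    have h5 : (r:ℝ)^2 / Fintype.card V + r * ((1:ℕ) / Fintype.card V) ≤ 1/4 := by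
      rw [← mul_div_assoc, ← add_div, div_le_iff₀ hnp]
      push_cast
      nlinarith [(Nat.cast_nonneg r : (0:ℝ) ≤ r)]
    linarith
  have := le_pr_prod (P := fun p : (Fin (r+1) → V) × (V × V) =>
      T (Function.update (st p.2.1 p.2.2 p.1) (p0 r) w0) ∧
      P (Function.update (st p.2.1 p.2.2 p.1) (p0 r) v0)) hα.le hQ ?_
  · linarith
  rintro S ⟨⟨X, hX, -⟩, hinj⟩
  have e1 : ∀ a b u, Function.update (st a b S) (p0 r) u = st a b (Fin.cons u (Fin.tail S)) := by
    intro a b u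
    rw [p0, st_update_succ]
    congr 1
    conv_lhs => rw [← Fin.cons_self_tail S]
    rw [Fin.update_cons_zero]
  simp only [e1]
  have h1 := hP.2.1 _ hinj
  have h2 : 4/9 + β ≤ pr (fun p : V × V => T (st p.1 p.2 (Fin.cons w0 (Fin.tail S)))) :=
    hX.trans (pr_mono fun p hp => hp.2.2)
  have h3 := pr_and_or (fun p : V × V => T (st p.1 p.2 (Fin.cons w0 (Fin.tail S))))
    (fun p : V × V => P (st p.1 p.2 (Fin.cons v0 (Fin.tail S))))
  have h4 := pr_le_one (fun p : V × V => T (st p.1 p.2 (Fin.cons w0 (Fin.tail S))) ∨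
    P (st p.1 p.2 (Fin.cons v0 (Fin.tail S))))
  linarith

lemma ab_density (α β δ : ℝ) (hα : 0 < α) (hβ : 0 < β) (hδ0 : 0 < δ) (hδ : δ ≤ 1/4)
    (hδ2 : (r+1+2) * δ ≤ 1/9)
    (P T : (Fin (r+1+2) → V) → Prop) (hP : Hyp (r+1) α P)
    (hn : (4 * (r+1)^2 : ℝ) ≤ Fintype.card V)
    (hT : pr (fun S => ¬ GoodS β T S) ≤ δ * δ) (v : Fin (r+1+2) → V) :
    1/4 * (α/2)^(r+1+2) ≤ pr (FA P T v) := by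
  classical
  let good : V → Prop := fun w0 => ¬ (δ < pr (fun R : Fin r → V => ¬ GoodS β T (Fin.cons w0 R)))
  have hg : pr (fun w0 => ¬ good w0) ≤ δ := by
    rw [pr_fin_succ] at hT
    have := pr_markov hδ0 hT
    simpa [good] using this
  have hTl := pr_T_lower β (δ*δ) hβ T hT (by nlinarith)
  let e : Fin (r+1+2) × Fin (r+1+2) → Fin (r+1+2) ⊕ (Fin (r+1+2) × Fin (r+1+2)) :=
    fun p => if p.2 = p0 r then Sum.inl p.1 else Sum.inr p
  have he : Function.Injective e := by
    rintro ⟨a, b⟩ ⟨a', b'⟩ h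
    simp only [e] at h
    split_ifs at h <;> simp_all
  rw [← pr_comp_inj e he, ← pr_equiv ((Equiv.sumArrowEquivProdArrow _ _ V).trans
    ((Equiv.refl _).prodCongr (Equiv.curry _ _ V))).symm]
  have hQ : (1:ℝ)/4 ≤ pr (fun w : Fin (r+1+2) → V => T w ∧ ∀ i, good (w i)) := by
    have h1 : pr T ≤ pr (fun w : Fin (r+1+2) → V => T w ∧ ∀ i, good (w i)) +
        pr (fun w : Fin (r+1+2) → V => ∃ i, ¬ good (w i)) := by
      apply pr_le_add
      intro w hw
      by_cases h : ∀ i, good (w i)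
      · exact Or.inl ⟨hw, h⟩
      · push Not at h; exact Or.inr h
    have h2 : pr (fun w : Fin (r+1+2) → V => ∃ i, ¬ good (w i)) ≤ (r+1+2) * δ := by
      refine (pr_le_finset_sum univ _ (fun i w => ¬ good (w i)) (fun w ⟨i, hi⟩ =>
        ⟨i, mem_univ _, hi⟩)).trans ?_
      refine (sum_le_sum (fun i _ => (pr_eval i (fun x => ¬ good x)).le.trans hg)).trans ?_
      simp
    nlinarith
  refine le_pr_prod (by positivity) hQ ?_
  rintro w ⟨hw, hgood⟩
  have h1 : (α/2)^(r+1+2) ≤ ∏ i, pr (fun x : Fin (r+1+2) → V => T (Function.update x (p0 r) (w i)) ∧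
      P (Function.update x (p0 r) (v i))) := by
    have : ∏ i : Fin (r+1+2), (α/2) = (α/2)^(r+1+2) := by rw [prod_const, card_univ, Fintype.card_fin]
    rw [← this]
    apply prod_le_prod
    · intros; positivity
    · intro i _
      exact ab_row α β δ hα hβ hδ P T hP hn _ _ (not_lt.1 (hgood i))
  rw [← pr_pi] at h1
  refine h1.trans (pr_mono ?_)
  intro x hx
  have e2 : ∀ i j, (((Equiv.sumArrowEquivProdArrow (Fin (r+1+2)) (Fin (r+1+2) × Fin (r+1+2)) V).trans
    ((Equiv.refl _).prodCongr (Equiv.curry _ _ V))).symm (w, x) ∘ e) (i, j) =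
      Function.update (x i) (p0 r) (w i) j := by
    intro i j
    by_cases h : j = p0 r
    · subst h
      simp [e]
    · simp [e, h, Function.update_of_ne h]
  refine ⟨?_, ?_, ?_⟩
  · simp only [e2]; simpa using hw
  · intro i; simp only [e2]; exact (hx i).1
  · intro i
    have : (fun j => (((Equiv.sumArrowEquivProdArrow (Fin (r+1+2)) (Fin (r+1+2) × Fin (r+1+2)) V).trans
    ((Equiv.refl _).prodCongr (Equiv.curry _ _ V))).symm (w, x) ∘ e) (i, j)) =
      Function.update (x i) (p0 r) (w i) := funext (e2 i)
    rw [this]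
    simpa using (hx i).2

end ab
end TH

namespace TH
open Finset

section gadget
variable {V : Type} [Fintype V] [Nonempty V] {r : ℕ}

abbrev GX (r : ℕ) (V : Type) := (Fin (r+1+2) × Fin (r+1+2)) × Fin 5 → V

def gR (X : GX r V) (i : Fin (r+1+2)) (c : Fin 5) : Fin (r+1+2) → V := fun j => X ((i, j), c)
def gW (X : GX r V) (c : Fin 5) : Fin (r+1+2) → V := fun i => X ((i, p0 r), c)

def gl (X : GX r V) (s : ℕ) : List V :=
  if h : s < r+1+2 then List.ofFn (gR X ⟨s, h⟩ 0) ++ List.ofFn (gR X ⟨s, h⟩ 1) ++ List.ofFn (gR X ⟨s, h⟩ 2)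
  else List.ofFn (gW X 3) ++ List.ofFn (gW X 4)

def gl' (X : GX r V) (v : Fin (r+1+2) → V) (s : ℕ) : List V :=
  if h : s < r+1+2 then List.ofFn (gR X ⟨s, h⟩ 0) ++
    List.ofFn (Function.update (gR X ⟨s, h⟩ 1) (p0 r) (v ⟨s, h⟩)) ++ List.ofFn (gR X ⟨s, h⟩ 2)
  else List.ofFn (gW X 3) ++ List.ofFn (gW X 1) ++ List.ofFn (gW X 4)

def ga (X : GX r V) (s : ℕ) : Fin (r+1+2) → V :=
  if h : s < r+1+2 then gR X ⟨s, h⟩ 0 else gW X 3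
def gb (X : GX r V) (s : ℕ) : Fin (r+1+2) → V :=
  if h : s < r+1+2 then gR X ⟨s, h⟩ 2 else gW X 4

variable {P T : (Fin (r+1+2) → V) → Prop}

lemma mix_row {v : Fin (r+1+2) → V} {X : GX r V} (h : Mix (FA P T v) X) (i : Fin (r+1+2))
    (g : Fin (r+1+2) → Fin 5) : T (fun j => X ((i, j), g j)) :=
  (h (fun p => g p.2)).2.1 i

lemma mix_row' {v : Fin (r+1+2) → V} {X : GX r V} (h : Mix (FA P T v) X) (i : Fin (r+1+2))
    (g : Fin (r+1+2) → Fin 5) : P (Function.update (fun j => X ((i, j), g j)) (p0 r) (v i)) :=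
  (h (fun p => g p.2)).2.2 i

lemma mix_cen {v : Fin (r+1+2) → V} {X : GX r V} (h : Mix (FA P T v) X)
    (g : Fin (r+1+2) → Fin 5) : T (fun i => X ((i, p0 r), g i)) :=
  (h (fun p => g p.1)).1

lemma lk_of_choice {Q : (Fin (r+1+2) → V) → Prop} {f : Fin (r+1+2) → Fin 5 → V}
    (h : ∀ g : Fin (r+1+2) → Fin 5, Q (fun j => f j (g j))) (c c' : Fin 5) :
    Lk Q (fun j => f j c) (fun j => f j c') := by
  intro g
  have := h (fun j => if g j then c else c')
  convert this using 2
  rename_i j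
  split_ifs <;> rfl

lemma ga_T {v : Fin (r+1+2) → V} {X : GX r V} (h : Mix (FA P T v) X) (s : ℕ) : T (ga X s) := by
  unfold ga; split_ifs with hs
  · exact mix_row h _ (fun _ => 0)
  · exact mix_cen h (fun _ => 3)

lemma gb_T {v : Fin (r+1+2) → V} {X : GX r V} (h : Mix (FA P T v) X) (s : ℕ) : T (gb X s) := by
  unfold gb; split_ifs with hs
  · exact mix_row h _ (fun _ => 2)
  · exact mix_cen h (fun _ => 4)

lemma gl_item (hP : ∀ (σ : Equiv.Perm (Fin (r+1+2))) t, P t → P (t ∘ σ)) (hT : ∀ t, T t → P t)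
    {v : Fin (r+1+2) → V} {X : GX r V} (h : Mix (FA P T v) X) (s : ℕ) :
    Item P (ga X s) (gl X s) (gb X s) := by
  unfold ga gl gb
  split_ifs with hs
  · have h1 : ∀ c, Item P (gR X ⟨s, hs⟩ c) (List.ofFn (gR X ⟨s, hs⟩ c)) (gR X ⟨s, hs⟩ c) :=
      fun c => item_single (hT _ (mix_row h _ (fun _ => c)))
    have h2 : ∀ c c', Lk P (gR X ⟨s, hs⟩ c) (gR X ⟨s, hs⟩ c') := fun c c' =>
      lk_of_choice (f := fun j c => X ((⟨s, hs⟩, j), c)) (fun g => hT _ (mix_row h ⟨s, hs⟩ g)) c c'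
    exact ((h1 0).append_lk hP (h2 0 1) (h1 1)).append_lk hP (h2 1 2) (h1 2)
  · have h1 : ∀ c, Item P (gW X c) (List.ofFn (gW X c)) (gW X c) :=
      fun c => item_single (hT _ (mix_cen h (fun _ => c)))
    have h2 : ∀ c c', Lk P (gW X c) (gW X c') := fun c c' =>
      lk_of_choice (f := fun i c => X ((i, p0 r), c)) (fun g => hT _ (mix_cen h g)) c c'
    exact (h1 3).append_lk hP (h2 3 4) (h1 4)

lemma gl'_item (hP : ∀ (σ : Equiv.Perm (Fin (r+1+2))) t, P t → P (t ∘ σ)) (hT : ∀ t, T t → P t)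
    {v : Fin (r+1+2) → V} {X : GX r V} (h : Mix (FA P T v) X) (s : ℕ) :
    Item P (ga X s) (gl' X v s) (gb X s) := by
  classical
  unfold ga gl' gb
  split_ifs with hs
  · have h1 : ∀ c, Item P (gR X ⟨s, hs⟩ c) (List.ofFn (gR X ⟨s, hs⟩ c)) (gR X ⟨s, hs⟩ c) :=
      fun c => item_single (hT _ (mix_row h _ (fun _ => c)))
    have h2 : ∀ c, Lk P (gR X ⟨s, hs⟩ c) (Function.update (gR X ⟨s, hs⟩ 1) (p0 r) (v ⟨s, hs⟩)) := by
      intro c g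
      by_cases hg : g (p0 r)
      · convert hT _ (mix_row h ⟨s, hs⟩ (fun j => if g j then c else 1)) using 2
        rename_i j
        by_cases hj : g j
        · simp [hj, gR]
        · have : j ≠ p0 r := by rintro rfl; exact hj hg
          simp [hj, gR, this]
      · convert mix_row' h ⟨s, hs⟩ (fun j => if g j then c else 1) using 2
        rename_i j
        by_cases hj : j = p0 r
        · subst hj; simp [hg]
        · rw [Function.update_of_ne hj]
          by_cases hj2 : g j <;> simp [hj2, gR, hj]
    have h3 : P (Function.update (gR X ⟨s, hs⟩ 1) (p0 r) (v ⟨s, hs⟩)) :=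
      mix_row' h ⟨s, hs⟩ (fun _ => 1)
    exact ((h1 0).append_lk hP (h2 0) (item_single h3)).append_lk hP (h2 2).symm (h1 2)
  · have h1 : ∀ c, Item P (gW X c) (List.ofFn (gW X c)) (gW X c) :=
      fun c => item_single (hT _ (mix_cen h (fun _ => c)))
    have h2 : ∀ c c', Lk P (gW X c) (gW X c') := fun c c' =>
      lk_of_choice (f := fun i c => X ((i, p0 r), c)) (fun g => hT _ (mix_cen h g)) c c'
    exact ((h1 3).append_lk hP (h2 3 1) (h1 1)).append_lk hP (h2 1 4) (h1 4)

lemma gl_len (X : GX r V) (s : ℕ) : (r+1+2) ∣ (gl X s).length := by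
  unfold gl; split_ifs
  · simp only [List.length_append, List.length_ofFn]
    exact ⟨3, by ring⟩
  · simp only [List.length_append, List.length_ofFn]
    exact ⟨2, by ring⟩

lemma gl_sum (X : GX r V) : ∑ s ∈ range (r+1+2+1), (gl X s : Multiset V) ≤ univ.val.map X := by
  rw [sum_range_succ, Finset.sum_range]
  have h1 : ∀ i : Fin (r+1+2), (gl X i : Multiset V) = ∑ j, {X ((i,j),0)} + ∑ j, {X ((i,j),1)}
      + ∑ j, {X ((i,j),2)} := by
    intro i
    simp only [gl, i.2, dif_pos, ← Multiset.coe_add, ofFn_sum]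
    rfl
  have h2 : (gl X (r+1+2) : Multiset V) = ∑ i, {X ((i, p0 r),3)} + ∑ i, {X ((i, p0 r),4)} := by
    simp only [gl, lt_irrefl, dif_neg, not_false_eq_true, ← Multiset.coe_add, ofFn_sum]
    rfl
  rw [sum_congr rfl (fun i _ => h1 i), h2, val_map_sum, Fintype.sum_prod_type_right, Fin.sum_univ_five]
  simp only [Fintype.sum_prod_type, sum_add_distrib]
  rw [add_assoc (∑ x, ∑ y, {X ((x,y),0)} + _ + _)]
  refine add_le_add_right (add_le_add ?_ ?_) _
  · exact sum_le_sum (fun i _ => single_le_sum (f := fun j => ({X ((i,j),3)} : Multiset V)) (fun _ _ => zero_le) (mem_univ (p0 r)))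
  · exact sum_le_sum (fun i _ => single_le_sum (f := fun j => ({X ((i,j),4)} : Multiset V)) (fun _ _ => zero_le) (mem_univ (p0 r)))

lemma gl'_sum (X : GX r V) (v : Fin (r+1+2) → V) : ∑ s ∈ range (r+1+2+1), (gl' X v s : Multiset V) =
    ∑ s ∈ range (r+1+2+1), (gl X s : Multiset V) + ∑ i, {v i} := by
  classical
  rw [sum_range_succ, sum_range_succ (fun s => (gl X s : Multiset V)), Finset.sum_range, Finset.sum_range]
  have h1 : ∀ i : Fin (r+1+2), (gl' X v i : Multiset V) + {X ((i, p0 r), 1)} = (gl X i : Multiset V) + {v i} := by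
    intro i
    simp only [gl, gl', i.2, dif_pos, ← Multiset.coe_add, ofFn_sum]
    have h3 : ∀ f : Fin (r+1+2) → V, ∑ a, ({f a} : Multiset V) = {f (p0 r)} + ∑ a ∈ univ.erase (p0 r), {f a} :=
      fun f => (add_sum_erase _ (fun a => ({f a} : Multiset V)) (mem_univ _)).symm
    have h4 : ∑ a, ({Function.update (gR X i 1) (p0 r) (v i) a} : Multiset V) + {X ((i, p0 r), 1)} =
        ∑ a, ({gR X i 1 a} : Multiset V) + {v i} := by
      rw [h3, h3 (gR X i 1)]
      have h5 : ∑ a ∈ univ.erase (p0 r), ({Function.update (gR X i 1) (p0 r) (v i) a} : Multiset V) =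
          ∑ a ∈ univ.erase (p0 r), ({gR X i 1 a} : Multiset V) := by
        apply sum_congr rfl
        intro a ha
        rw [Function.update_of_ne (ne_of_mem_erase ha)]
      rw [h5, Function.update_self]
      show _ = {X ((i, p0 r), 1)} + _ + _
      abel
    have h6 : ∀ A B C D E F : Multiset V, B + D = E + F → A + B + C + D = A + E + C + F := by
      intro A B C D E F h
      calc A + B + C + D = A + C + (B + D) := by abel
        _ = _ := by rw [h]; abel
    exact h6 _ _ _ _ _ _ h4
  have h2 : (gl' X v (r+1+2) : Multiset V) = (gl X (r+1+2) : Multiset V) + ∑ i, {X ((i, p0 r), 1)} := by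
    simp only [gl, gl', lt_irrefl, dif_neg, not_false_eq_true, ← Multiset.coe_add, ofFn_sum]
    show _ = _ + _ + ∑ i, {gW X 1 i}
    abel
  have h3 := sum_congr (rfl : (univ : Finset (Fin (r+1+2))) = univ) (fun i _ => h1 i)
  rw [sum_add_distrib, sum_add_distrib] at h3
  calc _ = (∑ i : Fin (r+1+2), (gl' X v i : Multiset V) + ∑ i, {X ((i, p0 r), 1)}) + (gl X (r+1+2) : Multiset V) := by
        rw [h2]; abel
    _ = _ := by rw [h3]; abel

lemma sum_range_blocks {M : Type} [AddCommMonoid M] (N s : ℕ) (hs : 0 < s) (f : ℕ → ℕ → M) :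
    ∑ t ∈ range (N * s), f (t / s) (t % s) = ∑ j ∈ range N, ∑ x ∈ range s, f j x := by
  induction N with
  | zero => simp
  | succ N ih =>
    rw [Nat.succ_mul, sum_range_add, ih, sum_range_succ]
    congr 1
    apply sum_congr rfl
    intro x hx
    rw [mem_range] at hx
    have e1 : (N * s + x) / s = N := by
      rw [mul_comm, Nat.mul_add_div hs, Nat.div_eq_of_lt hx, add_zero]
    have e2 : (N * s + x) % s = x := by
      rw [mul_comm, Nat.mul_add_mod, Nat.mod_eq_of_lt hx]
    rw [e1, e2]

end gadget
end TH

namespace TH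
open Finset

def seq3 {β : Type} (x0 : β) (f : ℕ → β) (G : ℕ) (x1 : β) : ℕ → β :=
  fun t => if t = 0 then x0 else if t ≤ G then f (t-1) else x1

lemma seq3_ind {β : Type} (x0 : β) (f : ℕ → β) (G : ℕ) (x1 : β) (Q : β → Prop) (h0 : Q x0)
    (h : ∀ t < G, Q (f t)) (h1 : Q x1) (t : ℕ) : Q (seq3 x0 f G x1 t) := by
  unfold seq3
  split_ifs
  · exact h0
  · exact h _ (by omega)
  · exact h1

lemma seq3_sum {M : Type} [AddCommMonoid M] {β : Type} (g : β → M) (x0 : β) (f : ℕ → β) (G : ℕ) (x1 : β) :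
    ∑ t ∈ range (G+1+1), g (seq3 x0 f G x1 t) = g x0 + g x1 + ∑ t ∈ range G, g (f t) := by
  rw [sum_range_succ, sum_range_succ']
  have h1 : seq3 x0 f G x1 (G+1) = x1 := by simp [seq3]
  have h2 : seq3 x0 f G x1 0 = x0 := by simp [seq3]
  rw [h1, h2]
  have h3 : ∑ t ∈ range G, g (seq3 x0 f G x1 (t+1)) = ∑ t ∈ range G, g (f t) := by
    apply sum_congr rfl
    intro t ht
    rw [mem_range] at ht
    have : t + 1 ≤ G := ht
    simp [seq3, this]
  rw [h3]; abel

lemma list_getD_sum {V : Type} (L : List V) (d : V) :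
    ∑ t ∈ range L.length, ({L.getD t d} : Multiset V) = (L : Multiset V) := by
  induction L with
  | nil => simp
  | cons x L ih =>
    rw [List.length_cons, sum_range_succ']
    simp only [List.getD_cons_succ, List.getD_cons_zero]
    rw [ih, add_comm, Multiset.singleton_add]; rfl

/-- cutting a finset into blocks -/
lemma blocks {V : Type} [Nonempty V] (k : ℕ) (hk : 0 < k) (Z : Finset V) (s : ℕ) (hs : Z.card = s * k) :
    ∃ v : ℕ → Fin k → V, ∑ i ∈ range s, ∑ x, ({v i x} : Multiset V) = Z.val := by
  let d := Classical.arbitrary V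
  refine ⟨fun i x => Z.toList.getD (i * k + x) d, ?_⟩
  have h := list_getD_sum Z.toList d
  rw [Finset.length_toList, hs, Finset.coe_toList] at h
  rw [← h]
  have h2 := sum_range_blocks s k hk (fun i x => ({Z.toList.getD (i * k + x) d} : Multiset V))
  simp only [Nat.div_add_mod'] at h2
  rw [h2]
  apply sum_congr rfl
  intro i _
  rw [Finset.sum_range]

lemma ab_assemble {V : Type} [Fintype V] [Nonempty V] {r : ℕ} {P T : (Fin (r+1+2) → V) → Prop}
    (hP : ∀ (σ : Equiv.Perm (Fin (r+1+2))) t, P t → P (t ∘ σ)) (hT : ∀ t, T t → P t)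
    (e e' : Fin (r+1+2) → V) (he : T e) (he' : T e')
    (N s : ℕ) (X : ℕ → GX r V) (hX : ∀ j < N, ∃ v, Mix (FA P T v) (X j))
    (hs : ∀ v, (s : ℝ) ≤ ({j ∈ (range N : Set ℕ) | Mix (FA P T v) (X j)} : Set ℕ).ncard)
    (c : ℕ → List V)
    (hc : ∀ i < N * (r+1+2+1) + 1, Conn P (seq3 e (fun t => gb (X (t / (r+1+2+1))) (t % (r+1+2+1))) (N * (r+1+2+1)) e' i)
      (c i) (seq3 e (fun t => ga (X (t / (r+1+2+1))) (t % (r+1+2+1))) (N * (r+1+2+1)) e' (i+1)) ∧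
      (r+1+2) ∣ (c i).length) :
    ∃ A : List V, Item P e A e' ∧ (r+1+2) ∣ A.length ∧
      (A : Multiset V) = (List.ofFn e : Multiset V) + (List.ofFn e' : Multiset V) +
        ∑ j ∈ range N, ∑ x ∈ range (r+1+2+1), (gl (X j) x : Multiset V) +
        ∑ i ∈ range (N * (r+1+2+1) + 1), (c i : Multiset V) ∧
      ∀ Z : Finset V, (r+1+2) ∣ Z.card → Z.card ≤ s * (r+1+2) → ∃ A' : List V, Item P e A' e' ∧
        (A' : Multiset V) = A + Z.val := by
  classical
  set G := N * (r+1+2+1) with hG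
  have hdiv : ∀ t < G, t / (r+1+2+1) < N := fun t ht => Nat.div_lt_of_lt_mul (by rw [mul_comm]; exact ht)
  -- general statement
  have main : ∀ f : ℕ → ℕ → List V, (∀ j < N, ∀ x, Item P (ga (X j) x) (f j x) (gb (X j) x)) →
      ∃ A : List V, Item P e A e' ∧ 
      (A : Multiset V) = (List.ofFn e : Multiset V) + (List.ofFn e' : Multiset V) +
        ∑ j ∈ range N, ∑ x ∈ range (r+1+2+1), (f j x : Multiset V) +
        ∑ i ∈ range (G + 1), (c i : Multiset V) := by
    intro f hf
    refine ⟨J (seq3 (List.ofFn e) (fun t => f (t / (r+1+2+1)) (t % (r+1+2+1))) G (List.ofFn e')) c (G+1), ?_, ?_⟩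
    · have := J_item (P := P) (seq3 e (fun t => ga (X (t / (r+1+2+1))) (t % (r+1+2+1))) G e')
        (seq3 e (fun t => gb (X (t / (r+1+2+1))) (t % (r+1+2+1))) G e')
        (seq3 (List.ofFn e) (fun t => f (t / (r+1+2+1)) (t % (r+1+2+1))) G (List.ofFn e')) c (G+1) ?_
        (fun i hi => (hc i hi).1)
      · simpa [seq3] using this
      · intro i _
        unfold seq3
        split_ifs with h1 h2
        · exact item_single (hT _ he)
        · exact hf _ (hdiv _ (by omega)) _
        · exact item_single (hT _ he')
    · rw [J_coe, seq3_sum (fun l : List V => (l : Multiset V)),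
        sum_range_blocks N (r+1+2+1) (by omega) (fun j x => (f j x : Multiset V))]
  obtain ⟨A, hA, hA2⟩ := main (fun j x => gl (X j) x) (fun j hj x => by
    obtain ⟨v, hv⟩ := hX j hj
    exact gl_item hP hT hv x)
  refine ⟨A, hA, ?_, hA2, ?_⟩
  · rw [← Multiset.coe_card, hA2]
    simp only [Multiset.card_add, Multiset.card_sum, Multiset.coe_card, List.length_ofFn]
    refine Nat.dvd_add (Nat.dvd_add (Nat.dvd_add (dvd_refl _) (dvd_refl _)) ?_) ?_
    · exact dvd_sum fun j _ => dvd_sum fun x _ => gl_len (X j) x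
    · exact dvd_sum fun i hi => (hc i (mem_range.1 hi)).2
  · intro Z hZ1 hZ2
    obtain ⟨m, hm⟩ := hZ1
    have hms : m ≤ s := by
      rw [hm, mul_comm] at hZ2
      exact Nat.le_of_mul_le_mul_right hZ2 (by omega)
    obtain ⟨v, hv⟩ := blocks (r+1+2) (by omega) Z m (by rw [hm, mul_comm])
    obtain ⟨jj, g1, g2⟩ := greedy_rep m N (fun i j => Mix (FA P T (v i)) (X j)) (by
      intro i hi
      have := Nat.cast_le.1 (hs (v i))
      refine hms.trans (this.trans (le_of_eq ?_))
      rw [← Set.ncard_coe_finset]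
      congr 1
      ext j; simp)
    let f : ℕ → ℕ → List V := fun j x => if h : ∃ i, i < m ∧ jj i = j then gl' (X j) (v h.choose) x else gl (X j) x
    let ex : ℕ → Multiset V := fun j => if h : ∃ i, i < m ∧ jj i = j then ∑ x, {v h.choose x} else 0
    obtain ⟨A', hA', hA2'⟩ := main f (fun j hj x => by
      obtain ⟨v0, hv0⟩ := hX j hj
      simp only [f]
      split_ifs with h
      · have h2 := h.choose_spec
        have h3 := (g1 _ h2.1).2
        rw [h2.2] at h3
        exact gl'_item hP hT h3 x
      · exact gl_item hP hT hv0 x)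
    refine ⟨A', hA', ?_⟩
    have hsum : ∀ j, ∑ x ∈ range (r+1+2+1), (f j x : Multiset V) = ∑ x ∈ range (r+1+2+1), (gl (X j) x : Multiset V) + ex j := by
      intro j
      simp only [f, ex]
      split_ifs with h
      · exact gl'_sum (X j) _
      · simp
    have hex : ∑ j ∈ range N, ex j = Z.val := by
      rw [← hv]
      have h1 : ∀ i < m, ex (jj i) = ∑ x, {v i x} := by
        intro i hi
        have h : ∃ i', i' < m ∧ jj i' = jj i := ⟨i, hi, rfl⟩
        simp only [ex, dif_pos h]
        have h2 := h.choose_spec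
        rw [g2 _ h2.1 _ hi h2.2]
      rw [← sum_congr rfl (fun i hi => h1 i (mem_range.1 hi)), ← sum_image (f := ex) (g := jj)]
      · symm
        apply sum_subset
        · intro x hx
          obtain ⟨i, hi, rfl⟩ := mem_image.1 hx
          exact mem_range.2 (g1 i (mem_range.1 hi)).1
        · intro j _ hj
          have : ¬ ∃ i, i < m ∧ jj i = j := by
            rintro ⟨i, hi, hij⟩
            exact hj (mem_image.2 ⟨i, mem_range.2 hi, hij⟩)
          simp only [ex, dif_neg this]
      · intro a ha b hb hab
        exact g2 a (by simpa using ha) b (by simpa using hb) hab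
    rw [hA2', hA2, sum_congr rfl (fun j _ => hsum j), sum_add_distrib, hex]
    abel

end TH

namespace TH
open Finset

lemma ceil_bound (ζ : ℝ) (hζ : 0 < ζ) (n : ℕ) (hn : 1 ≤ ζ * n) :
    ζ * n ≤ (⌈ζ * n⌉₊ : ℝ) ∧ (⌈ζ * n⌉₊ : ℝ) ≤ 2 * ζ * n := by
  refine ⟨Nat.le_ceil _, ?_⟩
  have := Nat.ceil_lt_add_one (show 0 ≤ ζ * n by positivity)
  linarith

lemma exists_small (B x : ℝ) (hB : 0 ≤ B) (hx : 0 < x) : ∃ ζ : ℝ, 0 < ζ ∧ ζ * B ≤ x ∧ ζ ≤ x := by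
  refine ⟨x / (B + 1), by positivity, ?_, ?_⟩
  · rw [div_mul_eq_mul_div, div_le_iff₀ (by positivity)]; nlinarith
  · rw [div_le_iff₀ (by positivity)]; nlinarith

set_option maxHeartbeats 4000000 in
theorem absorber (r : ℕ) (α : ℝ) (hα : 0 < α) (θ : ℝ) (hθ : 0 < θ) :
    ∃ (ρ : ℝ) (n0 : ℕ), 0 < ρ ∧ ∀ (V : Type) [Fintype V] [Nonempty V]
      (P : (Fin (r+1+2) → V) → Prop), Hyp (r+1) α P → n0 ≤ Fintype.card V →
      ∃ T : (Fin (r+1+2) → V) → Prop, (∀ t, T t → P t) ∧ pr (fun t => P t ∧ ¬ T t) ≤ 1/9 + 1/100 ∧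
        ∀ e e' : Fin (r+1+2) → V, T e → T e' →
          ((List.ofFn e : Multiset V) + (List.ofFn e' : Multiset V)).Nodup →
          ∀ U : Finset V, (U.card : ℝ) ≤ ρ * Fintype.card V → (∀ i, e i ∉ U) → (∀ i, e' i ∉ U) →
          ∃ A : List V, (∀ v ∈ A, v ∉ U) ∧ Item P e A e' ∧ A.Nodup ∧ (A.length : ℝ) ≤ θ * Fintype.card V ∧
            (r+1+2) ∣ A.length ∧ ∀ Z : Finset V, (r+1+2) ∣ Z.card → (Z.card : ℝ) ≤ ρ * Fintype.card V →
              ∃ A' : List V, Item P e A' e' ∧ (A' : Multiset V) = A + Z.val := by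
  classical
  have hk0 : (0:ℝ) < (r+1+2) := by positivity
  obtain ⟨δ, hδ0, hδ1, hδ2⟩ := exists_small (r+1+2) (1/9) (by positivity) (by norm_num)
  obtain ⟨K, c, nA, hc, hstr⟩ := structure_thm (r+1) α hα (min (δ*δ) (1/100)) (by positivity)
  set k : ℕ := r+1+2 with hk
  set c1 : ℝ := (1/4 * (α/2)^k)^(5^(k*k)) with hc1
  have hc1p : 0 < c1 := by positivity
  set d1 : ℕ := k*k*5 with hd1
  -- choose constants
  obtain ⟨ζ2, hζ2, hζ2a, -⟩ := exists_small (2 * ((K*k:ℕ):ℝ)^2 + 2 * (K*k:ℕ)) (min (c/8) (θ/4)) (by positivity) (by positivity)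
  obtain ⟨ζ1, hζ1, hζ1a, -⟩ := exists_small (2 * (d1:ℝ)^2 + 2 * (k+1) + 2 * (K*k:ℕ) * d1 + 2 * d1)
    (min (min (c1/8) (c/8*ζ2/2)) (min (c/16) (θ/4))) (by positivity) (by positivity)
  obtain ⟨nS, hsel⟩ := selection d1 k c1 ζ1 hc1p hζ1
  obtain ⟨nP, hpool⟩ := pool k K c ζ2 hc hζ2
  set y : ℝ := min (min ζ1 ζ2) (min (min (c1/16) (c/32)) (min (θ/4) (c/8*ζ2/2))) with hy
  have hyp : 0 < y := by positivity
  obtain ⟨nB, hnB⟩ := exists_nat_ge ((4 * (r+1)^2 + 1 + d1 * (2 * k) + (K*k:ℕ) * (2*k) + 2 * k : ℝ) / min y 1)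
  obtain ⟨ρ', hρ0, hρ1, -⟩ := exists_small ((d1:ℝ) + (K*k:ℕ)) (min (c1/16) (c/32)) (by positivity) (by positivity)
  refine ⟨min (c1/16 * ζ1) ρ', max (max nA nS) (max nP (max nB (⌈16/(c1*ζ1)⌉₊))), by positivity, ?_⟩
  intro V _ _ P hP hn
  have hnA : nA ≤ Fintype.card V := by omega
  have hnS : nS ≤ Fintype.card V := by omega
  have hnP : nP ≤ Fintype.card V := by omega
  have hnB' : nB ≤ Fintype.card V := by omega
  have hnC : ⌈16/(c1*ζ1)⌉₊ ≤ Fintype.card V := by omega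
  set n := Fintype.card V with hnn
  have hnp : (0:ℝ) < n := by exact_mod_cast (Fintype.card_pos (α := V))
  have hC : 16 ≤ c1*ζ1*n := by
    have h1 := (Nat.le_ceil (16/(c1*ζ1))).trans (Nat.cast_le.2 hnC)
    rw [div_le_iff₀ (by positivity)] at h1
    linarith
  have hB : (4 * (r+1)^2 + 1 + d1 * (2 * k) + (K*k:ℕ) * (2*k) + 2 * k : ℝ) ≤ min y 1 * n := by
    have h1 := hnB.trans (Nat.cast_le.2 hnB')
    rw [div_le_iff₀ (by positivity)] at h1
    linarith
  have hB1 : (4 * (r+1)^2 + 1 + d1 * (2 * k) + (K*k:ℕ) * (2*k) + 2 * k : ℝ) ≤ y * n :=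
    hB.trans (by gcongr; exact min_le_left _ _)
  have hB2 : (4 * (r+1)^2 + 1 + d1 * (2 * k) + (K*k:ℕ) * (2*k) + 2 * k : ℝ) ≤ 1 * n :=
    hB.trans (by gcongr; exact min_le_right _ _)
  have z1 : (0:ℝ) ≤ 4 * (r+1)^2 := by positivity
  have z2 : (0:ℝ) ≤ d1 * (2 * k) := by positivity
  have z3 : (0:ℝ) ≤ (K*k:ℕ) * (2*k) := by positivity
  have z4 : (0:ℝ) ≤ 2 * k := by positivity
  have y1 : y * n ≤ ζ1 * n := by gcongr; exact (min_le_left _ _).trans (min_le_left _ _)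
  have y2 : y * n ≤ ζ2 * n := by gcongr; exact (min_le_left _ _).trans (min_le_right _ _)
  have y3 : y * n ≤ c1/16 * n := by
    gcongr; exact (min_le_right _ _).trans ((min_le_left _ _).trans (min_le_left _ _))
  have y4 : y * n ≤ c/32 * n := by
    gcongr; exact (min_le_right _ _).trans ((min_le_left _ _).trans (min_le_right _ _))
  have y5 : y * n ≤ θ/4 * n := by
    gcongr; exact (min_le_right _ _).trans ((min_le_right _ _).trans (min_le_left _ _))
  have y6 : y * n ≤ c/8*ζ2/2 * n := by
    gcongr; exact (min_le_right _ _).trans ((min_le_right _ _).trans (min_le_right _ _))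
  obtain ⟨T, hT1, hT2, hT3, hT4⟩ := hstr V P hP hnA
  refine ⟨T, hT1, hT4.trans (by linarith [min_le_right (δ*δ) ((1:ℝ)/100)]), ?_⟩
  intro e e' he he' hnd U hU hU1 hU2
  have u0 : (U.card : ℝ) ≤ ρ' * n := hU.trans (by gcongr; exact min_le_right _ _)
  have u1 : ((d1:ℝ) + (K*k:ℕ)) * U.card ≤ min (c1/16) (c/32) * n := by
    calc ((d1:ℝ) + (K*k:ℕ)) * U.card ≤ ((d1:ℝ) + (K*k:ℕ)) * (ρ' * n) := by gcongr
      _ = (ρ' * ((d1:ℝ) + (K*k:ℕ))) * n := by ring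
      _ ≤ _ := by gcongr
  have u2 : min (c1/16) (c/32) * n ≤ c1/16 * n := by gcongr; exact min_le_left _ _
  have u3 : min (c1/16) (c/32) * n ≤ c/32 * n := by gcongr; exact min_le_right _ _
  have u4 : (0:ℝ) ≤ d1 * U.card := by positivity
  have u5 : (0:ℝ) ≤ (K*k:ℕ) * U.card := by positivity
  rw [add_mul] at u1
  set N1 := ⌈ζ1 * n⌉₊ with hN1
  set N2 := ⌈ζ2 * n⌉₊ with hN2
  obtain ⟨a1, a2⟩ := ceil_bound ζ1 hζ1 n (by linarith)
  obtain ⟨b1, b2⟩ := ceil_bound ζ2 hζ2 n (by linarith)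
  -- consequences
  have w0 : ζ1 * (2 * (d1:ℝ)^2 + 2 * (k+1) + 2 * (K*k:ℕ) * d1 + 2 * d1) * n ≤ _ * n :=
    mul_le_mul_of_nonneg_right hζ1a hnp.le
  have v0 : ζ2 * (2 * ((K*k:ℕ):ℝ)^2 + 2 * (K*k:ℕ)) * n ≤ _ * n :=
    mul_le_mul_of_nonneg_right hζ2a hnp.le
  have N1a : (d1:ℝ)^2 * N1 ≤ 2 * ζ1 * (d1:ℝ)^2 * n := by
    calc (d1:ℝ)^2 * N1 ≤ (d1:ℝ)^2 * (2 * ζ1 * n) := by gcongr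
      _ = _ := by ring
  have N1b : (k+1 : ℝ) * N1 ≤ 2 * ζ1 * (k+1) * n := by
    calc (k+1 : ℝ) * N1 ≤ (k+1) * (2 * ζ1 * n) := by gcongr
      _ = _ := by ring
  have N1c : ((K*k:ℕ) * d1 : ℝ) * N1 ≤ 2 * ζ1 * ((K*k:ℕ) * d1) * n := by
    calc ((K*k:ℕ) * d1 : ℝ) * N1 ≤ ((K*k:ℕ) * d1) * (2 * ζ1 * n) := by gcongr
      _ = _ := by ring
  have N1d : (d1 : ℝ) * N1 ≤ 2 * ζ1 * d1 * n := by
    calc (d1 : ℝ) * N1 ≤ d1 * (2 * ζ1 * n) := by gcongr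
      _ = _ := by ring
  have N2a : ((K*k:ℕ):ℝ)^2 * N2 ≤ 2 * ζ2 * ((K*k:ℕ):ℝ)^2 * n := by
    calc ((K*k:ℕ):ℝ)^2 * N2 ≤ ((K*k:ℕ):ℝ)^2 * (2 * ζ2 * n) := by gcongr
      _ = _ := by ring
  have N2b : ((K*k:ℕ):ℝ) * N2 ≤ 2 * ζ2 * ((K*k:ℕ):ℝ) * n := by
    calc ((K*k:ℕ):ℝ) * N2 ≤ ((K*k:ℕ):ℝ) * (2 * ζ2 * n) := by gcongr
      _ = _ := by ring
  have p1 : 0 ≤ 2 * ζ1 * (d1:ℝ)^2 * n := by positivity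
  have p2 : 0 ≤ 2 * ζ1 * (k+1) * n := by positivity
  have p3 : 0 ≤ 2 * ζ1 * ((K*k:ℕ) * d1) * n := by positivity
  have p4 : 0 ≤ 2 * ζ1 * d1 * n := by positivity
  have p5 : 0 ≤ 2 * ζ2 * ((K*k:ℕ):ℝ)^2 * n := by positivity
  have p6 : 0 ≤ 2 * ζ2 * ((K*k:ℕ):ℝ) * n := by positivity
  have W : 2 * ζ1 * (d1:ℝ)^2 * n + 2 * ζ1 * (k+1) * n + 2 * ζ1 * ((K*k:ℕ) * d1) * n + 2 * ζ1 * d1 * n ≤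
      (min (min (c1/8) (c/8*ζ2/2)) (min (c/16) (θ/4))) * n := by
    refine le_trans (le_of_eq (by ring)) w0
  have W1 : (min (min (c1/8) (c/8*ζ2/2)) (min (c/16) (θ/4))) * n ≤ c1/8 * n := by
    gcongr; exact (min_le_left _ _).trans (min_le_left _ _)
  have W2 : (min (min (c1/8) (c/8*ζ2/2)) (min (c/16) (θ/4))) * n ≤ c/8*ζ2/2 * n := by
    gcongr; exact (min_le_left _ _).trans (min_le_right _ _)
  have W3 : (min (min (c1/8) (c/8*ζ2/2)) (min (c/16) (θ/4))) * n ≤ c/16 * n := by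
    gcongr; exact (min_le_right _ _).trans (min_le_left _ _)
  have W4 : (min (min (c1/8) (c/8*ζ2/2)) (min (c/16) (θ/4))) * n ≤ θ/4 * n := by
    gcongr; exact (min_le_right _ _).trans (min_le_right _ _)
  have X0 : 2 * ζ2 * ((K*k:ℕ):ℝ)^2 * n + 2 * ζ2 * ((K*k:ℕ):ℝ) * n ≤ (min (c/8) (θ/4)) * n := by
    refine le_trans (le_of_eq (by ring)) v0
  have X1 : (min (c/8) (θ/4)) * n ≤ c/8 * n := by gcongr; exact min_le_left _ _
  have X2 : (min (c/8) (θ/4)) * n ≤ θ/4 * n := by gcongr; exact min_le_right _ _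
  -- selection of gadgets
  set EE : Multiset V := (List.ofFn e : Multiset V) + (List.ofFn e' : Multiset V) with hEE
  have hEEc : EE.card = 2 * k := by
    rw [hEE, Multiset.card_add, Multiset.coe_card, Multiset.coe_card, List.length_ofFn, List.length_ofFn, two_mul]
  have hUc : ((EE.toFinset.card : ℕ) : ℝ) ≤ 2 * k := by
    have : EE.toFinset.card ≤ EE.card := Multiset.toFinset_card_le _
    rw [hEEc] at this
    exact_mod_cast this
  have hdens : ∀ v : Fin (r+1+2) → V, c1 ≤ pr (Mix (m := 5) (FA P T v)) := by
    intro v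
    have h1 := ab_density α (α/2) δ hα (by positivity) hδ0 (by linarith) (by linarith) P T hP
      (by linarith) (hT3.trans (min_le_left _ _)) v
    have h2 := box 5 (FA P T v) _ (by positivity) h1
    rw [Fintype.card_prod, Fintype.card_fin] at h2
    exact h2
  obtain ⟨X, x1, x2, x3, x4⟩ := hsel V ((Fin (r+1+2) × Fin (r+1+2)) × Fin 5) (Fin (r+1+2) → V)
    (fun v => Mix (m := 5) (FA P T v)) (EE.toFinset ∪ U) N1 hnS (by simp [hd1, hk]) (by simp [hk]) hdens
    (by
      have hcu : ((EE.toFinset ∪ U).card : ℝ) ≤ EE.toFinset.card + U.card := by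
        exact_mod_cast card_union_le _ _
      calc (d1:ℝ) * (EE.toFinset ∪ U).card ≤ d1 * (2*k + U.card) := by gcongr; linarith
        _ = d1 * (2*k) + d1 * U.card := by ring
        _ ≤ c1/8 * n := by linarith) (by linarith) a1
  set DG : Multiset V := ∑ j ∈ range N1, univ.val.map (X j) with hDG
  have hDGc : DG.card = N1 * d1 := by
    rw [hDG, Multiset.card_sum]
    simp [hd1, hk]
  have hDGnd : DG.Nodup := by
    apply nodup_sum
    · intro j hj
      refine Multiset.Nodup.map_on ?_ univ.nodup
      intro x _ y _ hxy
      exact (x3 j (mem_range.1 hj) j (mem_range.1 hj) x y hxy).2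
    · intro i hi j hj hij
      rw [Multiset.disjoint_left]
      intro v hv hv2
      obtain ⟨a, -, rfl⟩ := Multiset.mem_map.1 hv
      obtain ⟨a', -, ha'⟩ := Multiset.mem_map.1 hv2
      exact hij (x3 j (mem_range.1 hj) i (mem_range.1 hi) _ _ ha').1.symm
  have hDGdis : Disjoint EE DG := by
    rw [Multiset.disjoint_left]
    intro v hv hv2
    rw [hDG, Multiset.mem_sum] at hv2
    obtain ⟨j, hj, hv2⟩ := hv2
    obtain ⟨a, -, rfl⟩ := Multiset.mem_map.1 hv2
    exact x2 j (mem_range.1 hj) a (mem_union_left _ (Multiset.mem_toFinset.2 hv))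
  have hU2c : (((EE + DG).toFinset.card : ℕ) : ℝ) ≤ 2 * k + d1 * N1 := by
    have : (EE + DG).toFinset.card ≤ (EE + DG).card := Multiset.toFinset_card_le _
    rw [Multiset.card_add, hEEc, hDGc] at this
    have h2 : (((EE + DG).toFinset.card : ℕ) : ℝ) ≤ ((2 * k + N1 * d1 : ℕ) : ℝ) := by exact_mod_cast this
    push_cast at h2
    linarith
  obtain ⟨R, r1, r2, r3, r4⟩ := hpool V P T ((EE + DG).toFinset ∪ U) N2 hP.1 hnP ⟨e, he⟩ hT2
    (by
      have hcu : (((EE + DG).toFinset ∪ U).card : ℝ) ≤ (EE + DG).toFinset.card + U.card := by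
        exact_mod_cast card_union_le _ _
      calc ((K*k:ℕ):ℝ) * ((EE + DG).toFinset ∪ U).card ≤ (K*k:ℕ) * (2 * k + d1 * N1 + U.card) := by
            gcongr; linarith
        _ = (K*k:ℕ) * (2*k) + ((K*k:ℕ) * d1 : ℝ) * N1 + (K*k:ℕ) * U.card := by ring
        _ ≤ c/16 * n + c/16 * n := by linarith
        _ = c/8 * n := by ring) (by linarith) b1
  obtain ⟨l, l1, l2⟩ := r4 (N1 * (r+1+2+1) + 1)
    (seq3 e (fun t => ga (X (t / (r+1+2+1))) (t % (r+1+2+1))) (N1 * (r+1+2+1)) e')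
    (seq3 e (fun t => gb (X (t / (r+1+2+1))) (t % (r+1+2+1))) (N1 * (r+1+2+1)) e') (by
      have h1 : ((N1 * (r+1+2+1) + 1 : ℕ) : ℝ) = (k+1) * N1 + 1 := by
        rw [hk]; push_cast; ring
      rw [h1]
      calc (k+1) * (N1:ℝ) + 1 ≤ c/8*ζ2/2 * n + c/8*ζ2/2 * n := by linarith
        _ = c/8 * (ζ2 * n) := by ring
        _ ≤ c/8 * N2 := by gcongr) (by
      intro i hi
      have hdiv : ∀ t < N1 * (r+1+2+1), t / (r+1+2+1) < N1 := fun t ht =>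
        Nat.div_lt_of_lt_mul (by rw [mul_comm]; exact ht)
      constructor
      · apply seq3_ind _ _ _ _ T he _ he'
        intro t ht
        obtain ⟨v, hv⟩ := x1 _ (hdiv t ht)
        exact gb_T hv _
      · apply seq3_ind _ _ _ _ T he _ he'
        intro t ht
        obtain ⟨v, hv⟩ := x1 _ (hdiv t ht)
        exact ga_T hv _)
  obtain ⟨A, A1, A2, A3, A4⟩ := ab_assemble hP.1 hT1 e e' he he' N1 (⌊c1/8 * N1⌋₊) X x1 (by
    intro v
    refine (Nat.floor_le (by positivity)).trans ((x4 v).trans (le_of_eq ?_))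
    rw [← Set.ncard_coe_finset]
    congr 2
    ext j; simp) l l1
  have hAle : (A : Multiset V) ≤ EE + DG + R := by
    rw [A3]
    refine add_le_add (add_le_add_right (sum_le_sum fun j _ => gl_sum (X j)) _) l2
  have hnd2 : (EE + DG + R).Nodup := by
    rw [Multiset.nodup_add, Multiset.nodup_add]
    refine ⟨⟨hnd, hDGnd, hDGdis⟩, r1, ?_⟩
    rw [Multiset.disjoint_left]
    intro v hv hv2
    exact r2 v hv2 (mem_union_left _ (Multiset.mem_toFinset.2 hv))
  have hAU : ∀ v ∈ A, v ∉ U := by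
    intro v hv
    have h1 := Multiset.mem_of_le hAle (Multiset.mem_coe.2 hv)
    rcases Multiset.mem_add.1 h1 with h1 | h1
    · rcases Multiset.mem_add.1 h1 with h1 | h1
      · rcases Multiset.mem_add.1 h1 with h1 | h1
        · obtain ⟨i, rfl⟩ := List.mem_ofFn.1 (Multiset.mem_coe.1 h1)
          exact hU1 i
        · obtain ⟨i, rfl⟩ := List.mem_ofFn.1 (Multiset.mem_coe.1 h1)
          exact hU2 i
      · rw [hDG, Multiset.mem_sum] at h1
        obtain ⟨j, hj, hv2⟩ := h1
        obtain ⟨a, -, rfl⟩ := Multiset.mem_map.1 hv2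
        exact fun hh => x2 j (mem_range.1 hj) a (mem_union_right _ hh)
    · exact fun hh => r2 v h1 (mem_union_right _ hh)
  refine ⟨A, hAU, A1, Multiset.coe_nodup.1 (Multiset.nodup_of_le hAle hnd2), ?_, A2, ?_⟩
  · have h1 : A.length ≤ (EE + DG + R).card := by
      have := Multiset.card_le_card hAle
      simpa using this
    rw [Multiset.card_add, Multiset.card_add, hEEc, hDGc, r3] at h1
    have h2 : (A.length : ℝ) ≤ ((2*k + N1 * d1 + K*k*N2 : ℕ) : ℝ) := by exact_mod_cast h1
    push_cast at h2
    push_cast at N2b p6 X0 p5 z3 hB1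
    nlinarith
  · intro Z hZ1 hZ2
    refine A4 Z hZ1 ?_
    have h1 : c1/16 * ζ1 * n ≤ (⌊c1/8 * N1⌋₊ : ℝ) := by
      have h2 := Nat.lt_floor_add_one (c1/8 * (N1:ℝ))
      have h3 : c1/8 * (ζ1 * n) ≤ c1/8 * N1 := by gcongr
      linarith
    have h2 : (Z.card : ℝ) ≤ (⌊c1/8 * N1⌋₊ : ℝ) := (hZ2.trans (by gcongr; exact min_le_left _ _)).trans h1
    have h3 : Z.card ≤ ⌊c1/8 * N1⌋₊ := by exact_mod_cast h2
    exact h3.trans (Nat.le_mul_of_pos_right _ (by omega))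

end TH

namespace TH
open Finset

lemma fmax (a b x n : ℝ) (hb : 0 ≤ b) (hba : b ≤ a) (hax : a ≤ x) (hn : 0 < n)
    (h : a + b ≤ 2/3 * n) : a^2 + 2*b*(x-a) ≤ max (4/9*n^2) (2/3*x*n - 1/9*n^2) := by
  rcases le_total a (n/3) with h1 | h1
  · have h2 : a^2 + 2*b*(x-a) ≤ a^2 + 2*a*(x-a) := by nlinarith
    rcases le_total (n/3) x with h3 | h3
    · refine le_trans ?_ (le_max_right _ _)
      nlinarith
    · refine le_trans ?_ (le_max_left _ _)
      nlinarith
  · have h2 : a^2 + 2*b*(x-a) ≤ a^2 + 2*(2/3*n-a)*(x-a) := by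
      nlinarith [mul_nonneg (sub_nonneg.2 hax) (show 0 ≤ 2/3*n - a - b by linarith)]
    have h4 : 0 ≤ (a - n/3) * (2/3*n - a) := mul_nonneg (by linarith) (by linarith)
    by_contra hc
    rw [not_le, max_lt_iff] at hc
    obtain ⟨c1, c2⟩ := hc
    have e1 : 0 ≤ (a - n/3) * (a^2 + 2*(2/3*n-a)*(x-a) - 4/9*n^2) := mul_nonneg (by linarith) (by linarith)
    have e2 : 0 ≤ (2/3*n - a) * (a^2 + 2*(2/3*n-a)*(x-a) - (2/3*x*n - 1/9*n^2)) := mul_nonneg (by linarith) (by linarith)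
    rcases eq_or_lt_of_le h1 with h5 | h5
    · rw [← h5] at h2 c2; nlinarith
    · have e1' : 0 < (a - n/3) * (a^2 + 2*(2/3*n-a)*(x-a) - 4/9*n^2) := mul_pos (by linarith) (by linarith)
      have : (a - n/3) * (a^2 + 2*(2/3*n-a)*(x-a) - 4/9*n^2) + (2/3*n - a) * (a^2 + 2*(2/3*n-a)*(x-a) - (2/3*x*n - 1/9*n^2)) = - (n * ((a - n/3) * (2/3*n - a))) := by ring
      have := mul_nonneg hn.le h4
      linarith

lemma thr_count (N G : ℕ) : ∑ j ∈ range N, ((if j + 1 ≤ G then 1 else 0) + (if 2*N - j ≤ G then 1 else 0)) ≤ G := by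
  rw [sum_add_distrib, sum_boole, sum_boole]
  simp only [Nat.cast_id]
  have h1 : #{x ∈ range N | x + 1 ≤ G} ≤ min N G := by
    have : #{x ∈ range N | x + 1 ≤ G} ≤ #(range (min N G)) := by
      apply card_le_card; intro x hx; simp only [mem_filter, mem_range] at *; omega
    simpa using this
  have h2 : #{x ∈ range N | 2*N - x ≤ G} ≤ G - N := by
    have : #{x ∈ range N | 2*N - x ≤ G} ≤ #(Ico (2*N-G) N) := by
      apply card_le_card; intro x hx; simp only [mem_filter, mem_range, mem_Ico] at *; omega
    rw [Nat.card_Ico] at this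
    omega
  omega

variable {V : Type} [Fintype V] [DecidableEq V]

lemma thr_exists (W : Finset V) (G : V → ℕ) (N : ℕ) (hN : 0 < N) :
    ∃ j < N, N * (#{x ∈ W | j + 1 ≤ G x} + #{x ∈ W | 2*N - j ≤ G x}) ≤ ∑ x ∈ W, G x := by
  have h : ∑ j ∈ range N, (#{x ∈ W | j + 1 ≤ G x} + #{x ∈ W | 2*N - j ≤ G x}) ≤ ∑ x ∈ W, G x := by
    calc _ = ∑ j ∈ range N, ∑ x ∈ W, ((if j + 1 ≤ G x then 1 else 0) + (if 2*N - j ≤ G x then 1 else 0)) := by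
          refine sum_congr rfl fun j _ => ?_
          rw [sum_add_distrib, sum_boole, sum_boole]; simp
      _ = ∑ x ∈ W, ∑ j ∈ range N, ((if j + 1 ≤ G x then 1 else 0) + (if 2*N - j ≤ G x then 1 else 0)) := sum_comm
      _ ≤ _ := sum_le_sum fun x _ => thr_count N (G x)
  by_contra hc
  push Not at hc
  have h2 : ∑ j ∈ range N, ∑ x ∈ W, G x < ∑ j ∈ range N, N * (#{x ∈ W | j + 1 ≤ G x} + #{x ∈ W | 2*N - j ≤ G x}) := by
    apply sum_lt_sum_of_nonempty (by simpa using hN.ne')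
    intro j hj; exact hc j (mem_range.1 hj)
  rw [← mul_sum, sum_const, card_range, smul_eq_mul] at h2
  have := Nat.lt_of_mul_lt_mul_left h2
  omega

/-- few heavy pairs -/
lemma heavy_pairs (W X : Finset V) (hX : X ⊆ W) (g : V → ℝ) (hg : ∀ x ∈ W, 0 ≤ g x)
    (δ γ : ℝ) (hδ : 0 < δ) (hγ : 0 ≤ γ) (hs : ∑ x ∈ W, g x ≤ γ * #W) (hW : 0 < #W) :
    (#{p ∈ X ×ˢ X | 3*γ + δ < g p.1 + g p.2} : ℝ) ≤
      max (4/9*(#W:ℝ)^2) (2/3*#X*#W - 1/9*(#W:ℝ)^2) := by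
  set s := 3*γ+δ with hsdef
  have hs0 : 0 < s := by positivity
  have hW' : (0:ℝ) < #W := by exact_mod_cast hW
  obtain ⟨N0, hN0⟩ := exists_nat_ge (3/2 * s/δ)
  set N := N0 + 1 with hN
  have hNr : 3/2 * s ≤ N * δ := by
    rw [div_le_iff₀ hδ] at hN0
    rw [hN]; push_cast; nlinarith
  have hN1 : (0:ℝ) < N := by rw [hN]; positivity
  set G : V → ℕ := fun x => ⌈2*N*g x/s⌉₊ with hG
  obtain ⟨j, hj, hj2⟩ := thr_exists W G N (by omega)
  have hGle : ∀ x ∈ W, (G x : ℝ) ≤ 2*N*g x/s + 1 := fun x hx =>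
    (Nat.ceil_lt_add_one (by have := hg x hx; positivity)).le
  have hsum : (∑ x ∈ W, (G x : ℝ)) ≤ (2*N*γ/s + 1) * #W := by
    calc _ ≤ ∑ x ∈ W, (2*N*g x/s + 1) := sum_le_sum hGle
      _ = 2*N/s * (∑ x ∈ W, g x) + #W := by
          rw [sum_add_distrib, mul_sum]; simp
          refine sum_congr rfl fun x _ => by ring
      _ ≤ 2*N/s * (γ * #W) + #W := by gcongr
      _ = _ := by ring
  have hj3 : (N:ℝ) * (#{x ∈ W | j + 1 ≤ G x} + #{x ∈ W | 2*N - j ≤ G x}) ≤ (2*N*γ/s + 1) * #W := by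
    refine le_trans ?_ hsum
    exact_mod_cast hj2
  have hab : (#{x ∈ W | j + 1 ≤ G x} : ℝ) + #{x ∈ W | 2*N - j ≤ G x} ≤ 2/3 * #W := by
    have h1 : 2*N*γ/s + 1 ≤ N * (2/3) := by
      have : 2*N*γ/s = 2/3 * N - 2/3 * N * δ / s := by
        field_simp; rw [hsdef]; ring
      have h2 : 1 ≤ 2/3 * N * δ/s := by rw [le_div_iff₀ hs0]; linarith
      linarith
    have h2 : (2*N*γ/s + 1) * (#W:ℝ) ≤ N * (2/3) * #W := by gcongr
    have h3 := hj3.trans h2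
    rw [mul_assoc] at h3
    exact le_of_mul_le_mul_left h3 hN1
  set A := {x ∈ X | j + 1 ≤ G x} with hA
  set B := {x ∈ X | 2*N - j ≤ G x} with hB
  have hBA : B ⊆ A := by
    intro x hx; rw [hB, mem_filter] at hx; rw [hA, mem_filter]; exact ⟨hx.1, by omega⟩
  have hAX : A ⊆ X := filter_subset _ _
  have hsub : {p ∈ X ×ˢ X | s < g p.1 + g p.2} ⊆ (A ×ˢ A) ∪ ((B ×ˢ (X \ A)) ∪ ((X \ A) ×ˢ B)) := by
    intro p hp
    simp only [mem_filter, mem_product] at hp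
    obtain ⟨⟨p1, p2⟩, p3⟩ := hp
    have e1 : 2*N + 1 ≤ G p.1 + G p.2 := by
      have h1 : 2*N*g p.1/s ≤ G p.1 := Nat.le_ceil _
      have h2 : 2*N*g p.2/s ≤ G p.2 := Nat.le_ceil _
      have h3 : (2*N:ℝ) < 2*N*g p.1/s + 2*N*g p.2/s := by
        rw [← add_div, lt_div_iff₀ hs0, ← mul_add]; gcongr
      have : ((2*N : ℕ):ℝ) < ((G p.1 + G p.2 : ℕ):ℝ) := by push_cast; linarith
      exact_mod_cast this
    simp only [mem_union, mem_product, mem_sdiff, hA, hB, mem_filter, p1, p2, true_and]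
    omega
  have hc : (#{p ∈ X ×ˢ X | s < g p.1 + g p.2} : ℝ) ≤ (#A:ℝ)^2 + 2*#B*(#X-#A) := by
    have h1 := card_le_card hsub
    have h2 : #((A ×ˢ A) ∪ ((B ×ˢ (X \ A)) ∪ ((X \ A) ×ˢ B))) ≤ #A*#A + (#B * #(X\A) + #(X\A)*#B) := by
      refine (card_union_le _ _).trans ?_
      rw [card_product]
      refine Nat.add_le_add_left ((card_union_le _ _).trans ?_) _
      rw [card_product, card_product]
    have h3 : ((#(X \ A) : ℕ):ℝ) = #X - #A := by
      rw [card_sdiff_of_subset hAX, Nat.cast_sub (card_le_card hAX)]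
    have h4 : ((#{p ∈ X ×ˢ X | s < g p.1 + g p.2} : ℕ):ℝ) ≤ ((#A*#A + (#B * #(X\A) + #(X\A)*#B) : ℕ):ℝ) := by
      exact_mod_cast h1.trans h2
    push_cast at h4
    rw [h3] at h4
    linarith
  refine hc.trans (fmax _ _ _ _ (by positivity) (by exact_mod_cast card_le_card hBA) (by exact_mod_cast card_le_card hAX) hW' ?_)
  refine le_trans ?_ hab
  have := card_le_card (filter_subset_filter (fun x => j + 1 ≤ G x) hX)
  have := card_le_card (filter_subset_filter (fun x => 2*N - j ≤ G x) hX)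
  gcongr
end TH

namespace TH
open Finset
open Classical in
lemma low_level {V : Type} (W : Finset V) (hW : 0 < #W) (w : V → ℝ) (hw : ∀ x ∈ W, 0 ≤ w x ∧ w x ≤ 1)
    (δ : ℝ) (hδ : 0 ≤ δ) (hδ1 : δ ≤ 1) :
    ∃ M : ℝ, 0 ≤ M ∧ M ≤ 1 ∧ δ * #W ≤ #{x ∈ W | w x ≤ M} ∧ (#{x ∈ W | w x < M} : ℝ) ≤ δ * #W := by
  have hWne : W.Nonempty := card_pos.1 hW
  obtain ⟨z, hz, hz2⟩ := exists_max_image W w hWne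
  have hne : {v ∈ W | δ * #W ≤ #{x ∈ W | w x ≤ w v}}.Nonempty := by
    refine ⟨z, mem_filter.2 ⟨hz, ?_⟩⟩
    rw [filter_true_of_mem hz2]
    nlinarith [(Nat.cast_nonneg (α := ℝ) #W)]
  obtain ⟨v, hv, hv2⟩ := exists_min_image _ w hne
  rw [mem_filter] at hv
  refine ⟨w v, (hw v hv.1).1, (hw v hv.1).2, hv.2, ?_⟩
  rcases ({x ∈ W | w x < w v}).eq_empty_or_nonempty with he | he
  · rw [he]; simp; positivity
  · obtain ⟨u, hu, hu2⟩ := exists_max_image _ w he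
    rw [mem_filter] at hu
    have h1 : ¬ (δ * #W ≤ #{x ∈ W | w x ≤ w u}) := by
      intro h
      have := hv2 u (mem_filter.2 ⟨hu.1, h⟩)
      linarith [hu.2]
    rw [not_le] at h1
    refine le_trans ?_ h1.le
    have : #{x ∈ W | w x < w v} ≤ #{x ∈ W | w x ≤ w u} := by
      apply card_le_card
      intro x hx
      exact mem_filter.2 ⟨(mem_filter.1 hx).1, hu2 x hx⟩
    exact_mod_cast this

section
variable {V : Type} [Fintype V] [Nonempty V] {r : ℕ}

open Classical in
def OKS (W : Finset V) (β : ℝ) (T : (Fin (r+1+2) → V) → Prop) (S : Fin (r+1) → V) : Prop :=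
  ∃ X ⊆ W, (4/9 + β) * (#W:ℝ)^2 ≤ #{p ∈ X ×ˢ X | T (st p.1 p.2 S)} ∧
    2/3 * #X * #W - 1/9 * (#W:ℝ)^2 + β * (#W:ℝ)^2 ≤ #{p ∈ X ×ˢ X | T (st p.1 p.2 S)}

lemma light_states (W : Finset V) (w : V → ℝ) (hw : ∀ x ∈ W, 0 ≤ w x ∧ w x ≤ 1)
    (T : (Fin (r+1+2) → V) → Prop) (δ β μ ω : ℝ) (hδ : 0 < δ) (hδ1 : δ ≤ 1) (hβ : 0 < β) (hμ : 0 < μ)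
    (hW : μ * Fintype.card V ≤ #W) (hω : ∑ x ∈ W, w x = ω * #W)
    (hbad : pr (fun S => ¬ OKS W β T S) ≤ (δ * μ)^(r+1) / 2) :
    (δ * μ)^(r+1) / 2 * (β * μ^2) ≤ pr (fun t : Fin (r+1+2) → V => (∀ i, t i ∈ W) ∧ T t ∧
      ∑ i, w (t i) ≤ (r+1+2) * ω + (r+1+3) * δ) := by
  classical
  have hn : (0:ℝ) < Fintype.card V := by exact_mod_cast Fintype.card_pos
  have hWp : (0:ℝ) < #W := lt_of_lt_of_le (by positivity) hW
  have hW0 : 0 < #W := by exact_mod_cast hWp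
  obtain ⟨M, hM0, hM1, hM2, hM3⟩ := low_level W hW0 w hw δ hδ.le hδ1
  set L := {x ∈ W | w x ≤ M} with hL
  set g : V → ℝ := fun x => max (w x - M) 0 with hg
  set γ : ℝ := ω - M + δ with hγ
  have hgs : ∑ x ∈ W, g x ≤ γ * #W := by
    have h1 : ∀ x ∈ W, g x ≤ w x - M + (if w x < M then M else 0) := by
      intro x hx
      have := hw x hx
      simp only [hg]
      split_ifs with h
      · apply max_le <;> linarith
      · apply max_le <;> linarith
    calc _ ≤ ∑ x ∈ W, (w x - M + (if w x < M then M else 0)) := sum_le_sum h1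
      _ = ω * #W - #W * M + #{x ∈ W | w x < M} * M := by
        rw [sum_add_distrib, sum_sub_distrib, hω, ← sum_filter]; simp
      _ ≤ ω * #W - #W * M + δ * #W := by
        have : (#{x ∈ W | w x < M} : ℝ) * M ≤ #{x ∈ W | w x < M} := mul_le_of_le_one_right (by positivity) hM1
        linarith
      _ = γ * #W := by rw [hγ]; ring
  have hg0 : ∀ x ∈ W, 0 ≤ g x := fun x _ => le_max_right _ _
  have hγ0 : 0 ≤ γ := by
    have := (sum_nonneg hg0).trans hgs
    nlinarith
  rw [pr_st]
  refine le_pr_prod (Q := fun S => (∀ i, S i ∈ L) ∧ OKS W β T S) (by positivity) ?_ ?_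
  · have h1 : pr (fun S : Fin (r+1) → V => ∀ i, S i ∈ L) = (#L / Fintype.card V : ℝ)^(r+1) := by
      rw [pr_pi (fun (_ : Fin (r+1)) x => x ∈ L)]
      simp [pr_mem_finset, div_pow]
    have h2 : (δ * μ)^(r+1) ≤ (#L / Fintype.card V : ℝ)^(r+1) := by
      gcongr
      rw [le_div_iff₀ hn]
      nlinarith
    have h3 := pr_le_add (P := fun S : Fin (r+1) → V => ∀ i, S i ∈ L)
      (Q := fun S => (∀ i, S i ∈ L) ∧ OKS W β T S) (R := fun S => ¬ OKS W β T S) (by tauto)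
    linarith
  · rintro S ⟨hS, X, hXW, hX1, hX2⟩
    have hh := heavy_pairs W X hXW g hg0 δ γ hδ hγ0 hgs hW0
    have hc : β * (#W:ℝ)^2 ≤ #{p ∈ X ×ˢ X | T (st p.1 p.2 S) ∧ ¬ (3*γ + δ < g p.1 + g p.2)} := by
      have h1 : #{p ∈ X ×ˢ X | T (st p.1 p.2 S)} ≤ #{p ∈ X ×ˢ X | T (st p.1 p.2 S) ∧ ¬ (3*γ + δ < g p.1 + g p.2)} + #{p ∈ X ×ˢ X | (3*γ + δ < g p.1 + g p.2)} := by
        refine le_trans (card_le_card ?_) (card_union_le _ _)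
        intro p hp
        simp only [mem_union, mem_filter] at *
        tauto
      have h2 : (#{p ∈ X ×ˢ X | T (st p.1 p.2 S)} : ℝ) ≤ #{p ∈ X ×ˢ X | T (st p.1 p.2 S) ∧ ¬ (3*γ + δ < g p.1 + g p.2)} + #{p ∈ X ×ˢ X | (3*γ + δ < g p.1 + g p.2)} := by exact_mod_cast h1
      rcases max_choice (4/9*(#W:ℝ)^2) (2/3*#X*#W - 1/9*(#W:ℝ)^2) with h | h <;> rw [h] at hh <;> linarith
    have h3 : β * μ^2 ≤ pr (fun p : V × V => p ∈ {p ∈ X ×ˢ X | T (st p.1 p.2 S) ∧ ¬ (3*γ + δ < g p.1 + g p.2)}) := by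
      rw [pr_mem_finset, le_div_iff₀ (by rw [Fintype.card_prod]; push_cast; positivity), Fintype.card_prod]
      push_cast
      calc β * μ^2 * (Fintype.card V * Fintype.card V : ℝ) = β * (μ * Fintype.card V)^2 := by ring
        _ ≤ β * (#W:ℝ)^2 := by gcongr
        _ ≤ _ := hc
    refine h3.trans (pr_mono ?_)
    rintro ⟨x, y⟩ hp
    simp only [mem_filter, mem_product, not_lt] at hp
    obtain ⟨⟨hx, hy⟩, hT, hxy⟩ := hp
    refine ⟨?_, hT, ?_⟩
    · intro i
      refine Fin.cases (by simpa using hXW hx) (fun i => ?_) i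
      refine Fin.cases (by simpa using hXW hy) (fun i => ?_) i
      simpa using (mem_filter.1 (hS i)).1
    · rw [Fin.sum_univ_succ, Fin.sum_univ_succ]
      have e1 : ∑ i : Fin (r+1), w (st x y S i.succ.succ) ≤ (r+1) * M := by
        calc _ ≤ ∑ i : Fin (r+1), M := by
              apply sum_le_sum; intro i _; rw [st_succ]; exact (mem_filter.1 (hS i)).2
          _ = _ := by simp
      have e2 : w x ≤ M + g x := by have := le_max_left (w x - M) 0; simp only [hg]; linarith
      have e3 : w y ≤ M + g y := by have := le_max_left (w y - M) 0; simp only [hg]; linarith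
      have e4 : M ≤ ω + δ := by linarith
      have e5 : (r:ℝ) * M ≤ r * (ω + δ) := by gcongr
      change w x + (w y + _) ≤ _
      have : w x + w y ≤ 2 * M + 3*γ + δ := by linarith
      rw [hγ] at this
      linarith
end
end TH

namespace TH
open Finset
section
variable {V : Type} [Fintype V] [Nonempty V] {r : ℕ}

lemma tile_exists (W : Finset V) (w : V → ℝ) (hw : ∀ x ∈ W, 0 ≤ w x ∧ w x ≤ 1)
    (T : (Fin (r+1+2) → V) → Prop) (δ β μ ω : ℝ) (hδ : 0 < δ) (hδ1 : δ ≤ 1) (hβ : 0 < β) (hμ : 0 < μ)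
    (hW : μ * Fintype.card V ≤ #W) (hω : ∑ x ∈ W, w x = ω * #W)
    (hbad : pr (fun S => ¬ OKS W β T S) ≤ (δ * μ)^(r+1) / 2) (m : ℕ)
    (hn : (((r+1+2) * m : ℕ) : ℝ)^2 < ((δ * μ)^(r+1) / 2 * (β * μ^2))^(m^(r+1+2)) * Fintype.card V) :
    ∃ X : Fin (r+1+2) × Fin m → V, Function.Injective X ∧ (∀ p, X p ∈ W) ∧ Mix T X ∧
      ∑ p, w (X p) ≤ m * ((r+1+2) * ω + (r+1+3) * δ) := by
  have h1 := light_states W w hw T δ β μ ω hδ hδ1 hβ hμ hW hω hbad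
  have h2 := box m _ _ (by positivity) h1
  have hnp : (0:ℝ) < Fintype.card V := by exact_mod_cast Fintype.card_pos
  have h3 := pr_not_injective (V := V) (ι := Fin (r+1+2) × Fin m)
  rw [Fintype.card_prod, Fintype.card_fin, Fintype.card_fin] at h3
  rw [Fintype.card_fin] at h2
  have h4 : (((r+1+2) * m : ℕ) : ℝ)^2 / Fintype.card V < ((δ * μ)^(r+1) / 2 * (β * μ^2))^(m^(r+1+2)) := by
    rw [div_lt_iff₀ hnp]; exact hn
  obtain ⟨X, hX, hinj⟩ := exists_of_pr_lt (lt_of_le_of_lt h3 (lt_of_lt_of_le h4 h2))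
  rw [not_not] at hinj
  refine ⟨X, hinj, ?_, fun g => (hX g).2.1, ?_⟩
  · rintro ⟨i, j⟩
    exact (hX (fun _ => j)).1 i
  · rw [Fintype.sum_prod_type_right]
    calc _ ≤ ∑ j : Fin m, ((r+1+2) * ω + (r+1+3) * δ) := sum_le_sum fun j _ => (hX (fun _ => j)).2.2
      _ = _ := by rw [sum_const]; simp only [card_univ, Fintype.card_fin, nsmul_eq_mul]
end

section
variable {V : Type} [DecidableEq V]
def Qf (a : V → V → ℝ) (W : Finset V) : ℝ := ∑ x ∈ W, ∑ y ∈ W, a x y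
def Df (a : V → V → ℝ) (W : Finset V) (x : V) : ℝ := ∑ y ∈ W, (a x y + a y x)

lemma Df_sum (a : V → V → ℝ) (W : Finset V) : ∑ x ∈ W, Df a W x = 2 * Qf a W := by
  unfold Df Qf
  simp only [sum_add_distrib]
  rw [sum_comm (f := fun x y => a y x)]; ring

lemma Qf_sdiff (a : V → V → ℝ) (W F : Finset V) (hF : F ⊆ W) :
    Qf a (W \ F) = Qf a W - ∑ x ∈ F, Df a W x + Qf a F := by
  unfold Df Qf
  simp only [sum_add_distrib]
  rw [sum_comm (s := F) (t := W) (f := fun x y => a y x)]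
  simp only [← sum_sdiff hF, sum_add_distrib]
  ring

lemma Qf_abs (a : V → V → ℝ) (ha : ∀ x y, |a x y| ≤ 2) (W : Finset V) : |Qf a W| ≤ 2 * (#W:ℝ)^2 := by
  unfold Qf
  calc _ ≤ ∑ x ∈ W, ∑ y ∈ W, (2:ℝ) := (abs_sum_le_sum_abs _ _).trans (sum_le_sum fun x _ =>
        (abs_sum_le_sum_abs _ _).trans (sum_le_sum fun y _ => ha x y))
    _ = _ := by simp; ring

lemma Df_abs (a : V → V → ℝ) (ha : ∀ x y, |a x y| ≤ 2) (W : Finset V) (x : V) : |Df a W x| ≤ 4 * (#W:ℝ) := by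
  unfold Df
  calc _ ≤ ∑ y ∈ W, (4:ℝ) := (abs_sum_le_sum_abs _ _).trans (sum_le_sum fun y _ =>
        (abs_add_le _ _).trans (by have := ha x y; have := ha y x; linarith))
    _ = _ := by simp; ring

lemma Qf_arith (Q D E n m : ℝ) (hn : 0 < n) (hm : 0 ≤ m) (h40' : 40 * m ≤ n) (hQ : -(2 * n ^ 2) ≤ Q ∧ Q ≤ 2 * n ^ 2)
    (hQF : -(2 * m ^ 2) ≤ E) (hD : -(m * (4 * n)) ≤ D ∧ D ≤ m * (4 * n)) :
    Q / n^2 + 1/n * (m * (2 * (Q/n^2)) - D/n) - 80*m^2/n^2 ≤ (Q - D + E) / (n-m)^2 := by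
  have hnm : 0 < n - m := by nlinarith
  rw [le_div_iff₀ (by positivity)]
  obtain ⟨u, hu⟩ : ∃ u, Q = u * n^2 := ⟨Q / n^2, by field_simp⟩
  obtain ⟨v, hv⟩ : ∃ v, m = v * n := ⟨m / n, by field_simp⟩
  obtain ⟨d, hd⟩ : ∃ d, D = d * n^2 := ⟨D / n^2, by field_simp⟩
  obtain ⟨e, he⟩ : ∃ e, E = e * n^2 := ⟨E / n^2, by field_simp⟩
  subst hu hv hd he
  have hn2 : 0 < n^2 := by positivity
  have u1 : -2 ≤ u := by by_contra hc; push Not at hc; nlinarith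
  have u2 : u ≤ 2 := by by_contra hc; push Not at hc; nlinarith
  have v0 : 0 ≤ v := by by_contra hc; push Not at hc; nlinarith
  have v1 : 40 * v ≤ 1 := by by_contra hc; push Not at hc; nlinarith
  have d1 : -(4*v) ≤ d := le_of_mul_le_mul_right (by linarith [hD.1] : -(4*v) * n^2 ≤ d * n^2) hn2
  have d2 : d ≤ 4*v := le_of_mul_le_mul_right (by linarith [hD.2] : d * n^2 ≤ (4*v) * n^2) hn2
  have e1 : -(2*v^2) ≤ e := le_of_mul_le_mul_right (by linarith [hQF] : -(2*v^2) * n^2 ≤ e * n^2) hn2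
  have key : (u + (2*u*v - d) - 80 * v^2) * (1-v)^2 ≤ u - d + e := by
    have i0 : |u*v| ≤ 2*v := by
      rw [abs_mul, abs_of_nonneg v0]
      have : |u| ≤ 2 := abs_le.2 ⟨u1, u2⟩
      gcongr
    rw [abs_le] at i0
    have i1 : |2*u*v-d| ≤ 8*v := by rw [abs_le]; constructor <;> linarith [i0.1, i0.2]
    have i2 : (2*u*v-d) * ((1-v)^2 - 1) ≤ 8*v * (2*v) := by
      refine (le_abs_self _).trans ?_
      rw [abs_mul]
      have : |(1-v)^2-1| ≤ 2*v := by rw [abs_le]; constructor <;> nlinarith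
      gcongr
    have i3 : 80*v^2 * (1/2) ≤ 80 * v^2 * (1-v)^2 := by gcongr; nlinarith
    have i4 : u * v^2 ≤ 2 * v^2 := by gcongr
    nlinarith
  have lhs : (u * n^2/n^2 + 1/n * (v*n*(2*(u*n^2/n^2)) - d*n^2/n) - 80*(v*n)^2/n^2) * (n - v*n)^2 = (u + (2*u*v - d) - 80 * v^2) * (1-v)^2 * n^2 := by
    field_simp
  rw [lhs]
  calc _ ≤ (u - d + e) * n^2 := by gcongr
    _ = _ := by ring

lemma Qf_step (a : V → V → ℝ) (ha : ∀ x y, |a x y| ≤ 2) (W F : Finset V) (hF : F ⊆ W)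
    (h40 : 40 * #F ≤ #W) (hW : 0 < #W) :
    Qf a W / (#W:ℝ)^2 + 1/#W * (∑ x ∈ F, (2 * Qf a W/(#W:ℝ)^2 - Df a W x/#W)) - 80*(#F:ℝ)^2/(#W:ℝ)^2
      ≤ Qf a (W \ F) / (#(W \ F):ℝ)^2 := by
  have hn : (0:ℝ) < #W := by exact_mod_cast hW
  have h40' : 40 * (#F:ℝ) ≤ #W := by exact_mod_cast h40
  have hc : (#(W \ F):ℝ) = #W - #F := by rw [card_sdiff_of_subset hF, Nat.cast_sub (card_le_card hF)]
  rw [hc, Qf_sdiff a W F hF]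
  have hQ := Qf_abs a ha W
  have hQF := Qf_abs a ha F
  have hD : |∑ x ∈ F, Df a W x| ≤ #F * (4 * (#W:ℝ)) := by
    calc _ ≤ ∑ x ∈ F, (4 * (#W:ℝ)) := (abs_sum_le_sum_abs _ _).trans (sum_le_sum fun x _ => Df_abs a ha W x)
      _ = _ := by simp
  rw [sum_sub_distrib, ← sum_div, sum_const, nsmul_eq_mul]
  have := Qf_arith (Qf a W) (∑ x ∈ F, Df a W x) (Qf a F) #W #F hn (by positivity) h40' (abs_le.1 hQ) (abs_le.1 hQF).1 (abs_le.1 hD)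
  rw [sum_div, ← mul_div_assoc, ← mul_div_assoc] at this
  exact this

lemma exp_step (a : V → V → ℝ) (ha : ∀ x y, |a x y| ≤ 2) (W F : Finset V) (hF : F ⊆ W) (R : ℝ) (hR : 1 ≤ R)
    (h40 : 40 * R * #F ≤ #W) (hW : 0 < #W) :
    Real.exp (-(R * (Qf a (W \ F) / (#(W \ F):ℝ)^2))) ≤ Real.exp (-(R * (Qf a W / (#W:ℝ)^2))) *
      (1 + R/#W * (∑ x ∈ F, (Df a W x/#W - 2 * Qf a W/(#W:ℝ)^2)) + 180 * R^2 * (#F:ℝ)^2/(#W:ℝ)^2) := by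
  have hn : (0:ℝ) < #W := by exact_mod_cast hW
  have hm : (0:ℝ) ≤ #F := by positivity
  have h40' : 40 * (#F:ℝ) ≤ #W := by nlinarith
  have h1 := Qf_step a ha W F hF (by exact_mod_cast h40') hW
  set y := ∑ x ∈ F, (Df a W x/#W - 2 * Qf a W/(#W:ℝ)^2) with hy
  have hy2 : ∑ x ∈ F, (2 * Qf a W/(#W:ℝ)^2 - Df a W x/#W) = - y := by
    rw [hy, ← sum_neg_distrib]; exact sum_congr rfl fun x _ => by ring
  rw [hy2] at h1
  have hya : |y| ≤ 8 * #F := by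
    calc _ ≤ ∑ x ∈ F, (8:ℝ) := (abs_sum_le_sum_abs _ _).trans (sum_le_sum fun x _ => ?_)
      _ = _ := by simp; ring
    have e1 := Df_abs a ha W x
    have e2 := Qf_abs a ha W
    refine (abs_sub _ _).trans ?_
    have e3 : |Df a W x/#W| ≤ 4 := by
      rw [abs_div, abs_of_pos hn, div_le_iff₀ hn]; exact e1
    have e4 : |2 * Qf a W/(#W:ℝ)^2| ≤ 4 := by
      rw [abs_div, abs_of_pos (show (0:ℝ) < (#W:ℝ)^2 by positivity), div_le_iff₀ (by positivity), abs_mul, abs_two]; linarith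
    linarith
  set n : ℝ := (#W : ℝ)
  set m : ℝ := (#F : ℝ)
  set z : ℝ := R/n * y + 80*R*m^2/n^2 with hz
  obtain ⟨v, hv⟩ : ∃ v, m = v * n := ⟨m / n, by field_simp⟩
  have v0 : 0 ≤ v := by by_contra hc; push Not at hc; nlinarith
  have v1 : 40 * R * v ≤ 1 := by
    have : (40 * R * v) * n ≤ 1 * n := by rw [hv] at h40; linarith
    exact le_of_mul_le_mul_right this hn
  have hzv : 80*R*m^2/n^2 = 80*R*v^2 := by rw [hv]; field_simp
  have hRy : |R/n*y| ≤ 8*R*v := by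
    rw [abs_mul, abs_of_nonneg (by positivity : 0 ≤ R/n), div_mul_eq_mul_div, div_le_iff₀ hn]
    have := mul_le_mul_of_nonneg_left hya (show 0 ≤ R by linarith)
    rw [hv] at this; linarith
  have hza : |z| ≤ 10*R*v := by
    rw [hz, hzv]
    refine (abs_add_le _ _).trans ?_
    rw [abs_of_nonneg (show 0 ≤ 80*R*v^2 by positivity)]
    have : 40*v ≤ 1 := by nlinarith
    have : 80*R*v^2 ≤ 2*R*v := by
      have := mul_le_mul_of_nonneg_left this (show 0 ≤ 2*R*v by positivity)
      nlinarith
    linarith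
  have hz1 : |z| ≤ 1 := hza.trans (by nlinarith)
  have hexp : Real.exp z ≤ 1 + z + z^2 := by
    have := Real.abs_exp_sub_one_sub_id_le hz1
    rw [abs_le] at this; linarith
  have hz2 : z^2 ≤ 100*R^2*v^2 := by
    rw [← sq_abs]
    calc |z|^2 ≤ (10*R*v)^2 := by gcongr
      _ = _ := by ring
  have hfin : Real.exp z ≤ 1 + R/n*y + 180*R^2*m^2/n^2 := by
    have e1 : 180*R^2*m^2/n^2 = 180*R^2*v^2 := by rw [hv]; field_simp
    rw [e1]
    have e2 : 80*R*v^2 ≤ 80*R^2*v^2 := by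
      have : R ≤ R^2 := by nlinarith
      gcongr
    rw [hz, hzv] at *
    linarith
  calc _ ≤ Real.exp (-(R * (Qf a W/n^2)) + z) := by
        apply Real.exp_le_exp.2
        have := mul_le_mul_of_nonneg_left h1 (show 0 ≤ R by linarith)
        have e : R * (Qf a W / n ^ 2 + 1 / n * -y - 80 * m ^ 2 / n ^ 2) = R * (Qf a W / n ^ 2) - z := by rw [hz]; ring
        linarith
    _ = Real.exp (-(R * (Qf a W/n^2))) * Real.exp z := Real.exp_add _ _
    _ ≤ _ := by gcongr
end
end TH

namespace TH
open Finset
section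
variable {V : Type} [DecidableEq V] {J : Type} [Fintype J]

noncomputable def wt (R : ℝ) (a : V → V → ℝ) (W : Finset V) : ℝ := Real.exp (-(R * (Qf a W / (#W:ℝ)^2)))
noncomputable def Phi (R : ℝ) (a : J → V → V → ℝ) (W : Finset V) : ℝ := ∑ j, wt R (a j) W
noncomputable def Wt (R : ℝ) (a : J → V → V → ℝ) (W : Finset V) (x : V) : ℝ :=
  ∑ j, wt R (a j) W * (Df (a j) W x / #W)
noncomputable def Wb (R : ℝ) (a : J → V → V → ℝ) (W : Finset V) : ℝ :=
  ∑ j, wt R (a j) W * (2 * Qf (a j) W / (#W:ℝ)^2)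

lemma Phi_step (R : ℝ) (hR : 1 ≤ R) (a : J → V → V → ℝ) (ha : ∀ j x y, |a j x y| ≤ 2) (W F : Finset V)
    (hF : F ⊆ W) (h : 360 * R^2 * #F ≤ #W) (hW : 0 < #W)
    (hs : ∑ x ∈ F, Wt R a W x ≤ #F * Wb R a W + Phi R a W * (#F / (2*R))) :
    Phi R a (W \ F) * #(W \ F) ≤ Phi R a W * #W := by
  have hn : (0:ℝ) < #W := by exact_mod_cast hW
  have hm : (0:ℝ) ≤ #F := by positivity
  have hR2 : R ≤ R^2 := by nlinarith
  have h40 : 40 * R * #F ≤ #W := by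
    refine le_trans ?_ h
    gcongr ?_ * _
    linarith
  have hc : (#(W \ F):ℝ) = #W - #F := by rw [card_sdiff_of_subset hF, Nat.cast_sub (card_le_card hF)]
  have h1 : Phi R a (W \ F) ≤ ∑ j, wt R (a j) W *
      (1 + R/#W * (∑ x ∈ F, (Df (a j) W x/#W - 2 * Qf (a j) W/(#W:ℝ)^2)) + 180 * R^2 * (#F:ℝ)^2/(#W:ℝ)^2) :=
    sum_le_sum fun j _ => exp_step (a j) (ha j) W F hF R hR h40 hW
  have h2 : ∑ j, wt R (a j) W *
      (1 + R/#W * (∑ x ∈ F, (Df (a j) W x/#W - 2 * Qf (a j) W/(#W:ℝ)^2)) + 180 * R^2 * (#F:ℝ)^2/(#W:ℝ)^2)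
      = Phi R a W + R/#W * (∑ x ∈ F, Wt R a W x - #F * Wb R a W) + Phi R a W * (180 * R^2 * (#F:ℝ)^2/(#W:ℝ)^2) := by
    unfold Phi Wt Wb
    rw [sum_comm (s := F), mul_sum (s := univ) (a := (#F:ℝ)), ← sum_sub_distrib, mul_sum, sum_mul, ← sum_add_distrib, ← sum_add_distrib]
    refine sum_congr rfl fun j _ => ?_
    rw [sum_sub_distrib, sum_const, nsmul_eq_mul, ← mul_sum]
    ring
  rw [h2] at h1
  have hPhi : 0 ≤ Phi R a W := sum_nonneg fun j _ => (Real.exp_pos _).le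
  have h3 : R/#W * (∑ x ∈ F, Wt R a W x - #F * Wb R a W) ≤ Phi R a W * (#F/(2*#W)) := by
    calc _ ≤ R/#W * (Phi R a W * (#F / (2*R))) := by gcongr; linarith
      _ = _ := by field_simp
  have h4 : 180 * R^2 * (#F:ℝ)^2/(#W:ℝ)^2 ≤ #F/(2*#W) := by
    rw [div_le_div_iff₀ (by positivity) (by positivity)]
    have := mul_le_mul_of_nonneg_left h (show (0:ℝ) ≤ #F * #W by positivity)
    nlinarith
  have h5 : Phi R a (W \ F) ≤ Phi R a W * (1 + #F/#W) := by
    have := mul_le_mul_of_nonneg_left h4 hPhi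
    have e : Phi R a W * (1 + #F/#W) = Phi R a W + Phi R a W * (#F/(2*#W)) + Phi R a W * (#F/(2*#W)) := by
      field_simp; ring
    linarith
  rw [hc]
  have hFW : (#F:ℝ) ≤ #W := by exact_mod_cast card_le_card hF
  calc _ ≤ Phi R a W * (1 + #F/#W) * (#W - #F) := by
        apply mul_le_mul_of_nonneg_right h5; linarith
    _ = Phi R a W * (#W - #F^2/#W) := by field_simp; ring
    _ ≤ _ := by
      apply mul_le_mul_of_nonneg_left _ hPhi
      have : (0:ℝ) ≤ #F^2/#W := by positivity
      linarith
end

section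
variable {V : Type} [Fintype V] [Nonempty V] [DecidableEq V] {J : Type} [Fintype J] [Nonempty J] {r : ℕ}

lemma Phi_tile (R : ℝ) (hR : 1 ≤ R) (a : J → V → V → ℝ) (ha : ∀ j x y, |a j x y| ≤ 2) (W : Finset V)
    (T : (Fin (r+1+2) → V) → Prop) (β μ : ℝ) (hβ : 0 < β) (hμ : 0 < μ)
    (hW : μ * Fintype.card V ≤ #W) 
    (hbad : pr (fun S => ¬ OKS W β T S) ≤ (1/(32*R) * μ)^(r+1) / 2) (m : ℕ)
    (hn : (((r+1+2) * m : ℕ) : ℝ)^2 < ((1/(32*R) * μ)^(r+1) / 2 * (β * μ^2))^(m^(r+1+2)) * Fintype.card V)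
    (hn2 : 360 * R^2 * ((r+1+2)*m : ℕ) ≤ μ * Fintype.card V) :
    ∃ X : Fin (r+1+2) × Fin m → V, Function.Injective X ∧ (∀ p, X p ∈ W) ∧ Mix T X ∧
      Phi R a (W \ univ.image X) * #(W \ univ.image X) ≤ Phi R a W * #W := by
  have hnp : (0:ℝ) < Fintype.card V := by exact_mod_cast Fintype.card_pos
  have hWp : (0:ℝ) < #W := lt_of_lt_of_le (by positivity) hW
  have hPhi : 0 < Phi R a W := sum_pos (fun j _ => Real.exp_pos _) univ_nonempty
  have hWt : ∀ x, |Wt R a W x| ≤ 4 * Phi R a W := by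
    intro x
    unfold Wt Phi
    rw [mul_sum]
    refine (abs_sum_le_sum_abs _ _).trans (sum_le_sum fun j _ => ?_)
    rw [abs_mul, abs_div, abs_of_pos hWp, abs_of_pos (show 0 < wt R (a j) W from Real.exp_pos _), mul_comm]
    have := Df_abs (a j) (ha j) W x
    have h2 : |Df (a j) W x|/#W ≤ 4 := by rw [div_le_iff₀ hWp]; exact this
    exact mul_le_mul_of_nonneg_right h2 (Real.exp_pos _).le
  have hWsum : ∑ x ∈ W, Wt R a W x = Wb R a W * #W := by
    unfold Wt Wb
    rw [sum_comm, sum_mul]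
    refine sum_congr rfl fun j _ => ?_
    rw [← mul_sum, ← sum_div, Df_sum]
    field_simp
  obtain ⟨X, x1, x2, x3, x4⟩ := tile_exists W (fun x => (Wt R a W x + 4 * Phi R a W)/(8 * Phi R a W)) (by
      intro x _
      have := abs_le.1 (hWt x)
      constructor
      · apply div_nonneg <;> linarith
      · rw [div_le_one (by positivity)]; linarith) T (1/(32*R)) β μ ((Wb R a W + 4 * Phi R a W)/(8 * Phi R a W))
      (by positivity) (by rw [div_le_one (by positivity)]; linarith) hβ hμ hW (by
        rw [← sum_div, sum_add_distrib, hWsum, sum_const, nsmul_eq_mul]; ring) hbad m hn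
  refine ⟨X, x1, x2, x3, ?_⟩
  have hcard : #(univ.image X) = (r+1+2) * m := by
    rw [card_image_of_injective _ x1]; simp
  apply Phi_step R hR a ha W _ _ _ (by exact_mod_cast hWp)
  · rw [sum_image (fun _ _ _ _ h => x1 h), hcard]
    rw [← sum_div, div_le_iff₀ (by positivity), sum_add_distrib, sum_const, nsmul_eq_mul] at x4
    have e1 : (m:ℝ) * ((r+1+2) * ((Wb R a W + 4 * Phi R a W)/(8 * Phi R a W)) + (r+1+3) * (1/(32*R))) * (8 * Phi R a W)
      = m * (r+1+2) * (Wb R a W + 4 * Phi R a W) + Phi R a W * (m * (r+1+3)/(4*R)) := by field_simp; ring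
    rw [e1] at x4
    simp only [card_univ, Fintype.card_prod, Fintype.card_fin] at x4
    push_cast at x4 ⊢
    have e2 : Phi R a W * (m * (r+1+3)/(4*R)) ≤ Phi R a W * (((r:ℝ)+1+2) * m / (2*R)) := by
      apply mul_le_mul_of_nonneg_left _ hPhi.le
      rw [div_le_div_iff₀ (by positivity) (by positivity)]
      have : (0:ℝ) ≤ m * R * (r+2) := by positivity
      nlinarith
    linarith
  · intro v hv
    obtain ⟨p, _, rfl⟩ := mem_image.1 hv
    exact x2 p
  · rw [hcard]; exact hn2.trans hW

lemma tile_iterate {ι : Type} [Fintype ι] [Nonempty ι] (Good : Finset V → Prop) (Tl : (ι → V) → Prop) (b : ℝ)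
    (hstep : ∀ W, Good W → b ≤ #W → ∃ X : ι → V, Function.Injective X ∧ (∀ p, X p ∈ W) ∧ Tl X ∧ Good (W \ univ.image X)) :
    ∀ (s : ℕ) (W : Finset V), #W = s → Good W → ∃ (N : ℕ) (X : ℕ → ι → V), (∀ i < N, Tl (X i)) ∧
      ∑ i ∈ range N, (univ : Finset ι).val.map (X i) ≤ W.val ∧ N * Fintype.card ι ≤ #W ∧ (#W : ℝ) ≤ N * Fintype.card ι + max b 0 := by
  intro s
  induction s using Nat.strong_induction_on with
  | _ s ih =>
  intro W hWs hG
  by_cases hb : b ≤ #W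
  · obtain ⟨X, x1, x2, x3, x4⟩ := hstep W hG hb
    have hsub : univ.image X ⊆ W := by
      intro v hv
      obtain ⟨p, _, rfl⟩ := mem_image.1 hv
      exact x2 p
    have hcard : #(univ.image X) = Fintype.card ι := by
      rw [card_image_of_injective _ x1]; simp
    have hpos : 0 < Fintype.card ι := Fintype.card_pos
    have hc2 := card_sdiff_of_subset hsub
    have hc3 := card_le_card hsub
    obtain ⟨N, Y, y1, y2, y3, y4⟩ := ih #(W \ univ.image X) (by omega) _ rfl x4
    refine ⟨N+1, fun i => Nat.casesOn i X Y, ?_, ?_, ?_, ?_⟩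
    · rintro (_ | i) hi
      · exact x3
      · exact y1 i (by omega)
    · rw [sum_range_succ']
      have e : W.val = (W \ univ.image X).val + (univ.image X).val := by
        rw [← Finset.disjUnion_val _ _ sdiff_disjoint]
        congr 1
        rw [Finset.disjUnion_eq_union, sdiff_union_of_subset hsub]
      rw [e, image_val_of_injOn x1.injOn]
      exact add_le_add y2 le_rfl
    · have : #W = #(W \ univ.image X) + Fintype.card ι := by omega
      rw [this, add_mul]; omega
    · have : #W = #(W \ univ.image X) + Fintype.card ι := by omega
      rw [this]; push_cast; linarith
  · refine ⟨0, fun _ _ => Classical.arbitrary V, by simp, by simp, by simp, ?_⟩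
    push Not at hb
    simp; left; exact hb.le
end
end TH

namespace TH
open Finset
section
variable {V : Type} [Fintype V] [Nonempty V] [DecidableEq V] {r : ℕ}

open Classical in
noncomputable def aK (β : ℝ) (T : (Fin (r+1+2) → V) → Prop) (S : Fin (r+1) → V) (X : V → Prop) (ε : Bool) (x y : V) : ℝ :=
  (if X x ∧ X y ∧ T (st x y S) then 1 else 0) -
   (if ε = true then ((if X x then 1 else 0) + (if X y then 1 else 0))/3 - 1/9 + β/2 else 4/9 + β/2)

lemma aK_abs (β : ℝ) (hβ : 0 < β) (hβ1 : β ≤ 1) (T : (Fin (r+1+2) → V) → Prop) (S : Fin (r+1) → V) (X : V → Prop) (ε : Bool) (x y : V) :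
    |aK β T S X ε x y| ≤ 2 := by
  unfold aK
  rw [abs_le]
  constructor <;> split_ifs <;> linarith

open Classical in
lemma Qf_aK (β : ℝ) (T : (Fin (r+1+2) → V) → Prop) (S : Fin (r+1) → V) (X : V → Prop) (ε : Bool) (W : Finset V) :
    Qf (aK β T S X ε) W = #{p ∈ W.filter X ×ˢ W.filter X | T (st p.1 p.2 S)} -
      (if ε = true then 2/3*#(W.filter X)*#W - 1/9*(#W:ℝ)^2 + β/2*(#W:ℝ)^2 else (4/9+β/2)*(#W:ℝ)^2) := by
  unfold Qf aK
  simp only [sum_sub_distrib]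
  congr 1
  · rw [← sum_product', sum_boole]
    congr 2
    ext p; simp only [mem_filter, mem_product]; tauto
  · cases ε
    · simp; ring
    · simp only [if_true, sum_add_distrib, sum_sub_distrib, ← sum_div, sum_boole, sum_const, nsmul_eq_mul, ← mul_sum]
      have e : ∑ x ∈ W, ((#{y ∈ W | X x} : ℕ) : ℝ) = #W * #(W.filter X) := by
        calc _ = ∑ x ∈ W, (if X x then (#W:ℝ) else 0) := by
              refine sum_congr rfl fun x _ => ?_
              by_cases h : X x <;> simp [h]
          _ = _ := by rw [← sum_filter, sum_const, nsmul_eq_mul, mul_comm]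
      rw [e]
      ring

/-- the family of kernels -/
noncomputable def aF (β : ℝ) (T : (Fin (r+1+2) → V) → Prop) (X : (Fin (r+1) → V) → V → Prop)
    (j : (Fin (r+1) → V) × Bool) : V → V → ℝ :=
  open Classical in if GoodX β T j.1 (X j.1) then aK β T j.1 (X j.1) j.2 else fun _ _ => 1

lemma aF_abs (β : ℝ) (hβ : 0 < β) (hβ1 : β ≤ 1) (T : (Fin (r+1+2) → V) → Prop) (X : (Fin (r+1) → V) → V → Prop)
    (j : (Fin (r+1) → V) × Bool) (x y : V) : |aF β T X j x y| ≤ 2 := by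
  unfold aF
  split_ifs
  · exact aK_abs β hβ hβ1 _ _ _ _ _ _
  · norm_num

lemma aF_univ (β : ℝ) (hβ : 0 < β) (hβ1 : β ≤ 1) (T : (Fin (r+1+2) → V) → Prop) (X : (Fin (r+1) → V) → V → Prop)
    (j : (Fin (r+1) → V) × Bool) : β/2 * (Fintype.card V : ℝ)^2 ≤ Qf (aF β T X j) univ := by
  classical
  have hnp : (0:ℝ) < Fintype.card V := by exact_mod_cast Fintype.card_pos
  unfold aF
  split_ifs with h
  · rw [Qf_aK]
    obtain ⟨h1, h2⟩ := h
    have e1 : pr (fun p : V × V => X j.1 p.1 ∧ X j.1 p.2 ∧ T (st p.1 p.2 j.1)) =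
        #{p ∈ (univ.filter (X j.1)) ×ˢ (univ.filter (X j.1)) | T (st p.1 p.2 j.1)} / (Fintype.card V:ℝ)^2 := by
      rw [pr_def, Fintype.card_prod]
      push_cast
      rw [sq]
      congr 3
      ext p; simp only [mem_filter, mem_product, mem_univ, true_and]; tauto
    have e2 : pr (X j.1) = #(univ.filter (X j.1)) / (Fintype.card V:ℝ) := by
      rw [pr_def]
    rw [e1, le_div_iff₀ (by positivity)] at h1 h2
    rw [e2] at h2
    have e3 : (2/3*(#(univ.filter (X j.1)) / (Fintype.card V:ℝ)) - 1/9 + β)*(Fintype.card V:ℝ)^2 = 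
      2/3*#(univ.filter (X j.1)) * Fintype.card V - 1/9 * (Fintype.card V:ℝ)^2 + β * (Fintype.card V:ℝ)^2 := by
      field_simp
    rw [e3] at h2
    rw [card_univ]
    split_ifs <;> linarith
  · unfold Qf
    simp
    nlinarith

lemma OKS_of_aF (β : ℝ) (T : (Fin (r+1+2) → V) → Prop) (X : (Fin (r+1) → V) → V → Prop)
    (S : Fin (r+1) → V) (hS : GoodX β T S (X S)) (W : Finset V) (h : ∀ ε, 0 ≤ Qf (aF β T X (S, ε)) W) :
    OKS W (β/2) T S := by
  classical
  unfold aF at h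
  simp only [hS, if_true, Qf_aK] at h
  have h1 := h false
  have h2 := h true
  simp only [if_true, Bool.false_eq_true, if_false] at h1 h2
  exact ⟨W.filter (X S), filter_subset _ _, by linarith, by linarith⟩

lemma pr_neg_le (R : ℝ) (hR : 0 ≤ R) (β : ℝ) (T : (Fin (r+1+2) → V) → Prop) (X : (Fin (r+1) → V) → V → Prop)
    (W : Finset V) : pr (fun S => ∃ ε, Qf (aF β T X (S, ε)) W < 0) ≤ Phi R (aF β T X) W / (Fintype.card V : ℝ)^(r+1) := by
  classical
  rw [pr_def]
  have hc : (Fintype.card (Fin (r+1) → V) : ℝ) = (Fintype.card V : ℝ)^(r+1) := by simp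
  rw [hc]
  gcongr
  unfold Phi
  rw [Fintype.sum_prod_type, card_eq_sum_ones]
  push_cast
  rw [sum_filter]
  refine sum_le_sum fun S _ => ?_
  split_ifs with h
  · obtain ⟨ε, hε⟩ := h
    have h1 : 1 ≤ wt R (aF β T X (S, ε)) W := by
      unfold wt
      rw [Real.one_le_exp_iff]
      have : Qf (aF β T X (S, ε)) W / (#W:ℝ)^2 ≤ 0 := div_nonpos_of_nonpos_of_nonneg hε.le (by positivity)
      nlinarith
    exact h1.trans (single_le_sum (f := fun ε => wt R (aF β T X (S, ε)) W) (fun ε _ => (Real.exp_pos _).le) (mem_univ ε))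
  · exact sum_nonneg fun ε _ => (Real.exp_pos _).le

lemma Phi_start (R : ℝ) (hR : 0 ≤ R) (β : ℝ) (hβ : 0 < β) (hβ1 : β ≤ 1) (T : (Fin (r+1+2) → V) → Prop) (X : (Fin (r+1) → V) → V → Prop)
    (W : Finset V) (hW : (1 - β/24) * Fintype.card V ≤ #W) :
    Phi R (aF β T X) W ≤ 2 * (Fintype.card V : ℝ)^(r+1) * Real.exp (-(R * (β/4))) := by
  have hnp : (0:ℝ) < Fintype.card V := by exact_mod_cast Fintype.card_pos
  have hWp : (0:ℝ) < #W := lt_of_lt_of_le (by nlinarith) hW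
  have hWn : (#W:ℝ) ≤ Fintype.card V := by exact_mod_cast card_le_univ W
  have key : ∀ j, β/4 ≤ Qf (aF β T X j) W / (#W:ℝ)^2 := by
    intro j
    rw [le_div_iff₀ (by positivity)]
    have h1 := aF_univ β hβ hβ1 T X j
    have h2 := Qf_sdiff (aF β T X j) univ Wᶜ (subset_univ _)
    rw [show (univ : Finset V) \ Wᶜ = W by simp] at h2
    have h3 := (abs_le.1 (Qf_abs _ (aF_abs β hβ hβ1 T X j) Wᶜ)).1
    have hc : (#Wᶜ : ℝ) = Fintype.card V - #W := by
      rw [card_compl, Nat.cast_sub (card_le_univ W)]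
    have h4 : ∑ x ∈ Wᶜ, Df (aF β T X j) univ x ≤ #Wᶜ * (4 * Fintype.card V) := by
      calc _ ≤ ∑ x ∈ Wᶜ, (4 * (Fintype.card V : ℝ)) := sum_le_sum fun x _ => by
            have := (abs_le.1 (Df_abs _ (aF_abs β hβ hβ1 T X j) univ x)).2
            rwa [card_univ] at this
        _ = _ := by simp
    have h5 : (#Wᶜ:ℝ) ≤ β/24 * Fintype.card V := by rw [hc]; linarith
    have h6 : (#Wᶜ:ℝ) ≤ Fintype.card V := by nlinarith
    have h7 : (#Wᶜ:ℝ)^2 ≤ β/24 * Fintype.card V * Fintype.card V := by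
      rw [sq]; gcongr
    have h8 : (#Wᶜ:ℝ) * (4 * Fintype.card V) ≤ β/24 * Fintype.card V * (4 * Fintype.card V) := by gcongr
    have h9 : (#W:ℝ)^2 ≤ (Fintype.card V:ℝ)^2 := by gcongr
    nlinarith
  unfold Phi
  calc _ ≤ ∑ j : (Fin (r+1) → V) × Bool, Real.exp (-(R * (β/4))) := by
        refine sum_le_sum fun j _ => Real.exp_le_exp.2 ?_
        have := mul_le_mul_of_nonneg_left (key j) hR
        linarith
    _ = _ := by simp; ring

end

lemma choose_R (q : ℕ) (b μ : ℝ) (hb : 0 < b) (hμ : 0 < μ) : ∃ R : ℝ, 1 ≤ R ∧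
    2 * Real.exp (-(R * b)) / μ ≤ (1/(32*R) * μ)^q / 4 := by
  have h := Real.tendsto_pow_mul_exp_neg_atTop_nhds_zero q
  have hpos : 0 < (μ * b/32)^q * μ/8 := by positivity
  have h1 := h.eventually (gt_mem_nhds hpos)
  obtain ⟨x, hx, hx2⟩ := (h1.and (Filter.eventually_ge_atTop (max b 1))).exists
  have hxb : b ≤ x := (le_max_left _ _).trans hx2
  have hx0 : 0 < x := lt_of_lt_of_le hb hxb
  refine ⟨x / b, by rw [le_div_iff₀ hb]; linarith, ?_⟩
  rw [div_mul_cancel₀ _ hb.ne']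
  have e : (1/(32*(x/b)) * μ)^q = (μ * b/32)^q / x^q := by
    rw [← div_pow]; congr 1; field_simp
  rw [e, div_div, div_le_div_iff₀ hμ (by positivity)]
  nlinarith

theorem tiling (r : ℕ) (β μ : ℝ) (hβ : 0 < β) (hβ1 : β ≤ 1) (hμ : 0 < μ) :
    ∃ η : ℝ, 0 < η ∧ ∀ m : ℕ, 0 < m → ∃ n0 : ℕ, ∀ (V : Type) [Fintype V] [Nonempty V]
      (T : (Fin (r+1+2) → V) → Prop), pr (fun S => ¬ GoodS β T S) ≤ η → n0 ≤ Fintype.card V →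
      ∀ W : Finset V, (1 - β/24) * Fintype.card V ≤ #W →
      ∃ (N : ℕ) (X : ℕ → Fin (r+1+2) × Fin m → V), (∀ i < N, Mix T (X i)) ∧
      ∑ i ∈ range N, (univ : Finset (Fin (r+1+2) × Fin m)).val.map (X i) ≤ W.val ∧
        N * ((r+1+2) * m) ≤ #W ∧ (#W : ℝ) ≤ N * ((r+1+2) * m : ℕ) + μ * Fintype.card V := by
  obtain ⟨R, hR, hR2⟩ := choose_R (r+1) (β/4) μ (by positivity) hμ
  refine ⟨(1/(32*R) * μ)^(r+1) / 4, by positivity, fun m hm => ?_⟩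
  set c : ℝ := ((1/(32*R) * μ)^(r+1) / 2 * (β/2 * μ^2))^(m^(r+1+2)) with hc
  have hc0 : 0 < c := by positivity
  obtain ⟨n0, hn0⟩ := exists_nat_gt (max ((((r+1+2) * m : ℕ) : ℝ)^2 / c) (360 * R^2 * ((r+1+2)*m : ℕ) / μ))
  refine ⟨n0, fun V _ _ T hT hn W hW => ?_⟩
  classical
  have hnp : (0:ℝ) < Fintype.card V := by exact_mod_cast Fintype.card_pos
  have hn1 : max ((((r+1+2) * m : ℕ) : ℝ)^2 / c) (360 * R^2 * ((r+1+2)*m : ℕ) / μ) < Fintype.card V :=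
    hn0.trans_le (by exact_mod_cast hn)
  rw [max_lt_iff, div_lt_iff₀ hc0, div_lt_iff₀ hμ] at hn1
  have hX : ∀ S : Fin (r+1) → V, ∃ X : V → Prop, GoodS β T S → GoodX β T S X := by
    intro S
    by_cases h : GoodS β T S
    · obtain ⟨X, hX⟩ := h; exact ⟨X, fun _ => hX⟩
    · exact ⟨fun _ => True, fun h2 => absurd h2 h⟩
  choose X hX using hX
  have : Nonempty (Fin m) := ⟨⟨0, hm⟩⟩
  have hstart := Phi_start R (by linarith) β hβ hβ1 T X W hW
  obtain ⟨N, Y, y1, y2, y3, y4⟩ := tile_iterate (V := V) (ι := Fin (r+1+2) × Fin m)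
    (fun U => Phi R (aF β T X) U * #U ≤ Phi R (aF β T X) W * #W) (fun Z => Mix T Z) (μ * Fintype.card V) (by
      intro U hU hU2
      have hUp : (0:ℝ) < #U := lt_of_lt_of_le (by positivity) hU2
      have hPhi0 : ∀ U, 0 ≤ Phi R (aF β T X) U := fun U => sum_nonneg fun j _ => (Real.exp_pos _).le
      have hPhi : Phi R (aF β T X) U / (Fintype.card V:ℝ)^(r+1) ≤ (1/(32*R) * μ)^(r+1) / 4 := by
        refine le_trans ?_ hR2
        rw [div_le_div_iff₀ (by positivity) hμ]
        have e1 : Phi R (aF β T X) U * (μ * Fintype.card V) ≤ Phi R (aF β T X) W * Fintype.card V := by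
          calc _ ≤ Phi R (aF β T X) U * #U := mul_le_mul_of_nonneg_left hU2 (hPhi0 _)
            _ ≤ Phi R (aF β T X) W * #W := hU
            _ ≤ _ := mul_le_mul_of_nonneg_left (by exact_mod_cast card_le_univ W) (hPhi0 _)
        have e2 : Phi R (aF β T X) U * μ ≤ Phi R (aF β T X) W := by
          rw [← mul_assoc] at e1
          exact le_of_mul_le_mul_right e1 hnp
        linarith
      have hbad : pr (fun S => ¬ OKS U (β/2) T S) ≤ (1/(32*R) * μ)^(r+1) / 2 := by
        have h1 := pr_le_add (P := fun S => ¬ OKS U (β/2) T S) (Q := fun S => ¬ GoodS β T S)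
          (R := fun S => ∃ ε, Qf (aF β T X (S, ε)) U < 0) (by
            intro S hS
            by_contra hc
            push Not at hc
            exact hS (OKS_of_aF β T X S (hX S hc.1) U hc.2))
        have h2 := pr_neg_le R (by linarith) β T X U
        linarith
      obtain ⟨Z, z1, z2, z3, z4⟩ := Phi_tile R hR (aF β T X) (aF_abs β hβ hβ1 T X) U T (β/2) μ (by positivity) hμ hU2 hbad m
        (by rw [mul_comm (Fintype.card V : ℝ)] at hn1; exact hn1.1) (by linarith [hn1.2])
      exact ⟨Z, z1, z2, z3, z4.trans hU⟩) _ W rfl le_rfl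
  rw [max_eq_left (by positivity)] at y4
  rw [Fintype.card_prod, Fintype.card_fin, Fintype.card_fin] at y3 y4
  exact ⟨N, Y, y1, y2, y3, y4⟩
end TH

namespace TH
open Finset

section final
variable {V : Type} [Fintype V] [Nonempty V] {k : ℕ}

lemma cyc {P : (Fin k → V) → Prop} (hk : 0 < k) (M : ℕ) (l c : ℕ → List V) (a b : ℕ → Fin k → V)
    (hl : ∀ i ≤ M, Item P (a i) (l i) (b i)) (hc : ∀ i < M, Conn P (b i) (c i) (a (i+1)))
    (hc2 : Conn P (b M) (c M) (a 0))
    (hS : ∑ i ∈ range (M+1), (l i : Multiset V) + ∑ i ∈ range (M+1), (c i : Multiset V) = (univ : Finset V).val) :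
    ∃ f : ZMod (Fintype.card V) → V, Function.Bijective f ∧
      ∀ i, P (fun j : Fin k => f (i + (j.1 : ZMod (Fintype.card V)))) := by
  have h := J_item a b l c M hl hc
  have h2 := h.conn hc2
  obtain ⟨-, ⟨l2, h3⟩, -⟩ := h
  have hco : ((J l c M ++ c M : List V) : Multiset V) = (univ : Finset V).val := by
    rw [← Multiset.coe_add, J_coe, ← hS, sum_range_succ (fun i => (c i : Multiset V)) M]
    abel
  refine close_cycle hk (a 0) (J l c M ++ c M) (l2 ++ c M) (by rw [h3]; simp) ?_ ?_ h2
  · rw [← Multiset.coe_nodup, hco]; exact univ.nodup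
  · intro v
    rw [← Multiset.mem_coe, hco]; simp

lemma assemble {P : (Fin k → V) → Prop} (hk : 0 < k) (M : ℕ) (l c : ℕ → List V) (a b : ℕ → Fin k → V)
    (hl : ∀ i ≤ M, Item P (a i) (l i) (b i)) (hc : ∀ i < M, Conn P (b i) (c i) (a (i+1)))
    (hc2 : Conn P (b M) (c M) (a 0)) (B : ℝ)
    (habs : ∀ Z : Finset V, k ∣ Z.card → (Z.card : ℝ) ≤ B →
      ∃ A' : List V, Item P (a 0) A' (b 0) ∧ (A' : Multiset V) = l 0 + Z.val)
    (S : Multiset V)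
    (hS : ∑ i ∈ range (M+1), (l i : Multiset V) + ∑ i ∈ range (M+1), (c i : Multiset V) = S)
    (hnd : S.Nodup) (hmod : k ∣ Fintype.card V - S.card) (hB : ((Fintype.card V : ℝ) - S.card) ≤ B) :
    ∃ f : ZMod (Fintype.card V) → V, Function.Bijective f ∧
      ∀ i, P (fun j : Fin k => f (i + (j.1 : ZMod (Fintype.card V)))) := by
  classical
  set Z : Finset V := univ \ ⟨S, hnd⟩ with hZ
  have hSZ : S + Z.val = (univ : Finset V).val := by
    rw [hZ, Finset.sdiff_val]
    exact add_tsub_cancel_of_le (Multiset.le_iff_subset hnd |>.2 (fun v _ => Finset.mem_univ v))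
  have hcard : S.card + Z.card = Fintype.card V := by
    have := congrArg Multiset.card hSZ
    rw [Multiset.card_add] at this
    exact this
  obtain ⟨A', h1, h2⟩ := habs Z (by rwa [show Z.card = Fintype.card V - S.card by omega]) (by
    have : (S.card : ℝ) + Z.card = Fintype.card V := by exact_mod_cast hcard
    linarith)
  refine cyc hk M (Function.update l 0 A') c a b ?_ hc hc2 ?_
  · intro i hi
    rcases Nat.eq_zero_or_pos i with rfl | h0
    · simpa using h1
    · rw [Function.update_of_ne (by omega)]; exact hl i hi
  · rw [← hSZ, ← hS, sum_range_succ', sum_range_succ' (fun i => (l i : Multiset V))]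
    simp only [Function.update_self, h2]
    have : ∀ i, Function.update l 0 A' (i+1) = l (i+1) := fun i => Function.update_of_ne (by omega) _ _
    simp only [this]
    abel

/-- path through a tile -/
lemma tile_path {r m' : ℕ} {P T : (Fin (r+1+2) → V) → Prop}
    (hP : ∀ (σ : Equiv.Perm (Fin (r+1+2))) t, P t → P (t ∘ σ)) (hT : ∀ t, T t → P t)
    (X : Fin (r+1+2) × Fin (m'+1) → V) (hX : Mix T X) :
    ∃ (a b : Fin (r+1+2) → V) (l : List V), T a ∧ T b ∧ Item P a l b ∧
      (l : Multiset V) = univ.val.map X := by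
  set cp : ℕ → Fin (r+1+2) → V := fun j i => X (i, Fin.ofNat (m'+1) j) with hcp
  have hTc : ∀ j, T (cp j) := fun j => hX (fun _ => Fin.ofNat (m'+1) j)
  refine ⟨cp 0, cp m', J (fun j => List.ofFn (cp j)) (fun _ => []) m', hTc _, hTc _,
    J_item cp cp _ _ m' (fun i _ => item_single (hT _ (hTc i))) (fun i _ => conn_lk hP ?_), ?_⟩
  · intro g
    apply hT
    have := hX (fun x => if g x then Fin.ofNat (m'+1) i else Fin.ofNat (m'+1) (i+1))
    convert this using 2 with x
    by_cases h : g x <;> simp [h, hcp]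
  · rw [J_coe]
    simp only [Multiset.coe_nil, sum_const_zero, add_zero]
    rw [val_map_sum, Fintype.sum_prod_type, sum_comm, ← Fin.sum_univ_eq_sum_range (fun j => (List.ofFn (cp j) : Multiset V))]
    refine sum_congr rfl fun j _ => ?_
    rw [ofFn_sum]
    refine sum_congr rfl fun i _ => ?_
    simp [hcp]

/-- special item -/
lemma special_item {P : (Fin k → V) → Prop} (u : Fin (k+1) → V)
    (h1 : P (fun i => u i.castSucc)) (h2 : P (fun i => u i.succ)) :
    Item P (fun i => u i.castSucc) (List.ofFn u) (fun i => u i.succ) := by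
  refine ⟨?_, ⟨[u (Fin.last k)], by rw [List.ofFn_succ']; simp⟩, ⟨[u 0], by rw [List.ofFn_succ]; simp⟩⟩
  rintro t ⟨s, s', h⟩
  have hlen := congrArg List.length h
  simp at hlen
  rcases s with _ | ⟨x, s⟩
  · have : List.ofFn t = List.ofFn (fun i => u i.castSucc) := by
      have h3 : List.ofFn t ++ s' = List.ofFn (fun i => u i.castSucc) ++ [u (Fin.last k)] := by
        rw [← List.nil_append (List.ofFn t), h, List.ofFn_succ']; simp
      exact (List.append_inj h3 (by simp)).1
    rw [List.ofFn_injective this]; exact h1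
  · have hs : s = [] := List.eq_nil_of_length_eq_zero (by simp at hlen; omega)
    have hs' : s' = [] := List.eq_nil_of_length_eq_zero (by simp at hlen; omega)
    subst hs hs'
    have h3 : x = u 0 ∧ t = fun i => u i.succ := by
      rw [List.ofFn_succ] at h
      simpa using h
    rw [h3.2]; exact h2

end final
end TH

namespace TH
open Finset

section spec
variable {V : Type} [Fintype V] [Nonempty V]

lemma pr_P_lower {q : ℕ} {α : ℝ} (hα : 0 < α) (P : (Fin (q+2) → V) → Prop) (hP : Hyp q α P) :
    (1 - (q:ℝ)^2 / Fintype.card V) * (5/9) ≤ pr P := by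
  rw [pr_st]
  have h := pr_not_injective (V := V) (ι := Fin q)
  rw [pr_not, Fintype.card_fin] at h
  refine le_pr_prod (Q := fun S => Function.Injective S) (by norm_num) (by linarith) ?_
  intro S hS
  have := hP.2.1 S hS
  linarith

def endEquiv (V : Type) (K : ℕ) : (Fin K → V) × (V × V) ≃ (Fin (K+2) → V) where
  toFun p := Fin.cons p.2.1 (Fin.snoc p.1 p.2.2 : Fin (K+1) → V)
  invFun u := (fun j => u j.castSucc.succ, (u 0, u (Fin.last _)))
  left_inv p := by
    rcases p with ⟨Y, x, z⟩
    simp [← Fin.succ_last]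
  right_inv u := by
    funext i
    refine Fin.cases ?_ (fun i => ?_) i
    · simp
    · refine Fin.lastCases ?_ (fun i => ?_) i
      · simp
      · simp

lemma second_moment {K : ℕ} (P : (Fin (K+1) → V) → Prop)
    (hP : ∀ (σ : Equiv.Perm (Fin (K+1))) t, P t → P (t ∘ σ)) :
    (pr P)^2 ≤ pr (fun u : Fin (K+2) → V => P (fun i => u i.castSucc) ∧ P (fun i => u i.succ)) := by
  classical
  set f : (Fin K → V) → ℝ := fun Y => pr (fun x : V => P (Fin.cons x Y)) with hf
  have h1 : pr P = (∑ Y, f Y) / Fintype.card (Fin K → V) := by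
    rw [pr_fin_succ, ← pr_equiv (Equiv.prodComm (Fin K → V) V), pr_prod]
    rfl
  have h2 : ∀ Y, f Y ^ 2 ≤ pr (fun p : V × V => P (Fin.cons p.1 Y) ∧ P (Fin.cons p.2 Y)) := by
    intro Y
    rw [sq]
    refine le_pr_prod (Q := fun x => P (Fin.cons x Y)) (pr_nonneg _) le_rfl ?_
    intro x hx
    exact pr_mono fun z hz => ⟨hx, hz⟩
  have h3 : pr (fun p : (Fin K → V) × (V × V) => P (Fin.cons p.2.1 p.1) ∧ P (Fin.cons p.2.2 p.1)) ≤
      pr (fun u : Fin (K+2) → V => P (fun i => u i.castSucc) ∧ P (fun i => u i.succ)) := by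
    rw [← pr_equiv (endEquiv V K) (fun u : Fin (K+2) → V => P (fun i => u i.castSucc) ∧ P (fun i => u i.succ))]
    refine pr_mono ?_
    rintro ⟨Y, x, z⟩ ⟨a, b⟩
    constructor
    · convert a using 1
      funext i
      refine Fin.cases ?_ (fun i => ?_) i
      · simp [endEquiv]
      · simp only [endEquiv, Equiv.coe_fn_mk, Fin.cons_succ]
        rw [← Fin.succ_castSucc]
        simp
    · have := hP (finRotate _) _ b
      convert this using 1
      funext i
      simp only [endEquiv, Equiv.coe_fn_mk, Fin.cons_succ]
      rw [Fin.snoc_eq_cons_rotate]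
      rfl
  refine le_trans ?_ h3
  rw [pr_prod, h1, div_pow]
  have hN : (0:ℝ) < Fintype.card (Fin K → V) := by exact_mod_cast Fintype.card_pos
  have h4 := sq_sum_le_card_mul_sum_sq (s := (univ : Finset (Fin K → V))) (f := f)
  rw [card_univ] at h4
  calc (∑ Y, f Y)^2 / (Fintype.card (Fin K → V) : ℝ)^2
      ≤ (Fintype.card (Fin K → V) * ∑ Y, f Y ^ 2) / (Fintype.card (Fin K → V) : ℝ)^2 := by gcongr
    _ = (∑ Y, f Y ^ 2) / (Fintype.card (Fin K → V) : ℝ) := by field_simp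
    _ ≤ _ := by gcongr with Y; exact h2 Y

lemma special_exists {K : ℕ} (P T : (Fin (K+1) → V) → Prop)
    (hP : ∀ (σ : Equiv.Perm (Fin (K+1))) t, P t → P (t ∘ σ))
    (h1 : (11:ℝ)/20 ≤ pr P) (h2 : pr (fun t => P t ∧ ¬ T t) ≤ 1/9 + 1/100) (U : Finset V)
    (hn : 50 * (K+2:ℝ)^2 ≤ Fintype.card V) (hU : 50 * (K+2:ℝ) * U.card ≤ Fintype.card V) :
    ∃ u : Fin (K+2) → V, Function.Injective u ∧ (∀ i, u i ∉ U) ∧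
      T (fun i => u i.castSucc) ∧ T (fun i => u i.succ) := by
  have hn0 : (0:ℝ) < Fintype.card V := by exact_mod_cast Fintype.card_pos
  have a := second_moment P hP
  have b1 : pr (fun u : Fin (K+2) → V => P (fun i => u i.castSucc) ∧ ¬ T (fun i => u i.castSucc)) ≤ 1/9+1/100 :=
    le_trans (le_of_eq (pr_comp_inj (V := V) (Fin.castSucc : Fin (K+1) → Fin (K+2)) (Fin.castSucc_injective _) (fun t => P t ∧ ¬ T t))) h2
  have b2 : pr (fun u : Fin (K+2) → V => P (fun i => u i.succ) ∧ ¬ T (fun i => u i.succ)) ≤ 1/9+1/100 :=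
    le_trans (le_of_eq (pr_comp_inj (V := V) (Fin.succ : Fin (K+1) → Fin (K+2)) (Fin.succ_injective _) (fun t => P t ∧ ¬ T t))) h2
  have b3 := pr_not_injective (V := V) (ι := Fin (K+2))
  have b4 := pr_hit (V := V) (ι := Fin (K+2)) U
  have c3 : ((Fintype.card (Fin (K+2)) : ℕ) : ℝ)^2 / Fintype.card V ≤ 1/50 := by
    rw [div_le_iff₀ hn0, Fintype.card_fin]; push_cast; linarith
  have c4 : ((Fintype.card (Fin (K+2)) : ℕ) : ℝ) * (U.card / Fintype.card V) ≤ 1/50 := by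
    rw [← mul_div_assoc, div_le_iff₀ hn0, Fintype.card_fin]; push_cast; linarith
  have d := pr_le_add3
    (P := fun u : Fin (K+2) → V => (P (fun i => u i.castSucc) ∧ ¬ T (fun i => u i.castSucc)) ∨
      (P (fun i => u i.succ) ∧ ¬ T (fun i => u i.succ)) ∨ (¬ Function.Injective u ∨ ∃ i, u i ∈ U)) (fun u h => h)
  have d2 := pr_or_le (fun u : Fin (K+2) → V => ¬ Function.Injective u) (fun u => ∃ i, u i ∈ U)
  obtain ⟨u, ⟨u1, u2⟩, u3⟩ := exists_of_pr_lt (lt_of_lt_of_le (by nlinarith) a)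
    (P := fun u : Fin (K+2) → V => (P (fun i => u i.castSucc) ∧ ¬ T (fun i => u i.castSucc)) ∨
      (P (fun i => u i.succ) ∧ ¬ T (fun i => u i.succ)) ∨ (¬ Function.Injective u ∨ ∃ i, u i ∈ U))
  push Not at u3
  exact ⟨u, u3.2.2.1, u3.2.2.2, u3.1 u1, u3.2.1 u2⟩

lemma specials {K : ℕ} (P T : (Fin (K+1) → V) → Prop)
    (hP : ∀ (σ : Equiv.Perm (Fin (K+1))) t, P t → P (t ∘ σ)) (hT : ∀ t, T t → P t)
    (h1 : (11:ℝ)/20 ≤ pr P) (h2 : pr (fun t => P t ∧ ¬ T t) ≤ 1/9 + 1/100) (U : Multiset V) (hUnd : U.Nodup)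
    (hn : 50 * (K+2:ℝ)^2 ≤ Fintype.card V) (s : ℕ)
    (hU : 50 * (K+2:ℝ) * (U.card + s * (K+2)) ≤ Fintype.card V) :
    ∃ (a b : ℕ → Fin (K+1) → V) (l : ℕ → List V), (∀ i < s, T (a i) ∧ T (b i) ∧ Item P (a i) (l i) (b i) ∧
      (l i).length = K+2) ∧ (U + ∑ i ∈ range s, (l i : Multiset V)).Nodup := by
  classical
  induction s with
  | zero =>
    have v : V := Classical.arbitrary V
    exact ⟨fun _ _ => v, fun _ _ => v, fun _ => [], by simp, by simpa using hUnd⟩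
  | succ s ih =>
    obtain ⟨a, b, l, h, hnd⟩ := ih (by
      refine le_trans ?_ hU
      push_cast
      gcongr
      linarith)
    have hc : (U + ∑ i ∈ range s, (l i : Multiset V)).card = U.card + s * (K+2) := by
      rw [Multiset.card_add, Multiset.card_sum, sum_congr rfl (g := fun _ => K+2)]
      · simp
      · intro i hi
        rw [Multiset.coe_card]; exact (h i (mem_range.1 hi)).2.2.2
    obtain ⟨u, u1, u2, u3, u4⟩ := special_exists P T hP h1 h2 (U + ∑ i ∈ range s, (l i : Multiset V)).toFinset hn (by
      have h5 : ((U + ∑ i ∈ range s, (l i : Multiset V)).toFinset.card : ℝ) ≤ U.card + s * (K+2) := by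
        have := Multiset.toFinset_card_le (U + ∑ i ∈ range s, (l i : Multiset V))
        rw [hc] at this
        exact_mod_cast this
      refine le_trans ?_ hU
      gcongr
      refine h5.trans ?_
      push_cast
      have : (0:ℝ) ≤ K+2 := by positivity
      nlinarith)
    refine ⟨Function.update a s (fun i => u i.castSucc), Function.update b s (fun i => u i.succ),
      Function.update l s (List.ofFn u), ?_, ?_⟩
    · intro i hi
      rcases Nat.lt_succ_iff_lt_or_eq.1 hi with hi | rfl
      · simp only [Function.update_of_ne hi.ne]
        exact h i hi
      · simp only [Function.update_self]
        exact ⟨u3, u4, special_item u (hT _ u3) (hT _ u4), by simp⟩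
    · rw [sum_range_succ, Function.update_self, ← add_assoc, Multiset.nodup_add]
      have : ∑ i ∈ range s, ((Function.update l s (List.ofFn u) i : List V) : Multiset V) = ∑ i ∈ range s, (l i : Multiset V) := by
        refine sum_congr rfl fun i hi => ?_
        rw [Function.update_of_ne (mem_range.1 hi).ne]
      rw [this]
      refine ⟨hnd, Multiset.coe_nodup.2 (List.nodup_ofFn.2 u1), ?_⟩
      rw [Multiset.disjoint_left]
      intro v hv hv2
      obtain ⟨i, rfl⟩ := List.mem_ofFn.1 (Multiset.mem_coe.1 hv2)
      exact u2 i (Multiset.mem_toFinset.2 hv)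

end spec
end TH

namespace TH
open Finset

section hyp
variable {V : Type} [Fintype V] [Nonempty V] [DecidableEq V]

lemma image_st {q : ℕ} (x y : V) (S : Fin q → V) :
    univ.image (st x y S) = {x, y} ∪ univ.image S := by
  ext v
  simp only [mem_image, mem_univ, true_and, mem_union, mem_insert, mem_singleton]
  constructor
  · rintro ⟨i, rfl⟩
    refine Fin.cases (by simp) (fun i => ?_) i
    refine Fin.cases (by simp) (fun i => ?_) i
    right; exact ⟨i, by simp⟩
  · rintro ((rfl | rfl) | ⟨i, rfl⟩)
    · exact ⟨0, by simp⟩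
    · exact ⟨1, by simp⟩
    · exact ⟨i.succ.succ, by simp⟩

lemma hyp_of_degree {q : ℕ} (α : ℝ) (E : Finset (Finset V)) (hE : ∀ e ∈ E, e.card = q+2)
    (hdeg : ∀ S : Finset V, S.card = q →
      (5 / 9 + α) * (Fintype.card V : ℝ)^2 / 2 ≤ ((E.filter fun e => S ⊆ e).card : ℝ)) :
    Hyp q α (fun t : Fin (q+2) → V => univ.image t ∈ E) := by
  refine ⟨?_, ?_, ?_⟩
  · intro σ t ht
    have : univ.image (t ∘ σ) = univ.image t := by
      rw [← image_image, image_univ_equiv]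
    simpa [this] using ht
  · intro S hS
    have hc : (univ.image S).card = q := by
      rw [card_image_of_injective _ hS]; simp
    have hd := hdeg _ hc
    have hn : (0:ℝ) < Fintype.card V := by exact_mod_cast Fintype.card_pos
    rw [pr_def, Fintype.card_prod, le_div_iff₀ (by push_cast; positivity)]
    have key : 2 * (E.filter fun e => univ.image S ⊆ e).card ≤
        (univ.filter (fun p : V × V => univ.image (st p.1 p.2 S) ∈ E)).card := by
      rw [card_eq_sum_card_fiberwise (f := fun p : V × V => univ.image (st p.1 p.2 S))
        (t := E.filter fun e => univ.image S ⊆ e)]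
      · rw [mul_comm, ← smul_eq_mul]
        apply card_nsmul_le_sum
        intro e he
        rw [mem_filter] at he
        have h2 : (e \ univ.image S).card = 2 := by
          rw [card_sdiff_of_subset he.2, hE e he.1, hc]; omega
        obtain ⟨x, y, hxy, h3⟩ := card_eq_two.1 h2
        have h4 : {x, y} ∪ univ.image S = e := by
          rw [← h3]; exact sdiff_union_of_subset he.2
        have h5 : ({(x,y),(y,x)} : Finset (V × V)).card = 2 := by
          rw [card_pair]; simp [hxy]
        refine h5.symm.le.trans (card_le_card ?_)
        intro p hp
        rw [mem_insert, mem_singleton] at hp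
        rw [mem_filter, mem_filter]
        rcases hp with rfl | rfl
        · simp only [image_st]
          rw [h4]; simp [he.1]
        · simp only [image_st]
          rw [pair_comm, h4]; simp [he.1]
      · intro p hp
        simp only [coe_filter, mem_univ, true_and, Set.mem_ofPred_eq] at hp ⊢
        refine ⟨hp, ?_⟩
        rw [image_st]; exact subset_union_right
    have key2 : (2:ℝ) * (E.filter fun e => univ.image S ⊆ e).card ≤
        (univ.filter (fun p : V × V => univ.image (st p.1 p.2 S) ∈ E)).card := by exact_mod_cast key
    refine le_trans ?_ (key2.trans (le_of_eq ?_))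
    · push_cast; nlinarith
    · congr 2
      ext p; simp
  · intro t ht
    have h1 := hE _ ht
    have h2 : (univ.image t).card = (univ : Finset (Fin (q+2))).card := by rw [h1]; simp
    exact fun a b h => (card_image_iff.1 h2) (by simp) (by simp) h

lemma pick_two {k : ℕ} (P T1 T2 : (Fin k → V) → Prop) (hP : ∀ t, P t → Function.Injective t)
    (hT : ∀ t, T1 t → P t)
    (h1 : (11:ℝ)/20 ≤ pr P) (h2 : pr (fun t => P t ∧ ¬ T1 t) ≤ 1/9 + 1/100)
    (h3 : pr (fun t => P t ∧ ¬ T2 t) ≤ 1/9 + 1/100) (hn : 10 * (k:ℝ)^2 ≤ Fintype.card V) :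
    ∃ e e' : Fin k → V, T1 e ∧ T2 e ∧ T1 e' ∧ T2 e' ∧
      ((List.ofFn e : Multiset V) + (List.ofFn e' : Multiset V)).Nodup := by
  have hn0 : (0:ℝ) < Fintype.card V := by exact_mod_cast Fintype.card_pos
  have gen : ∀ U : Finset V, U.card ≤ k → ∃ e : Fin k → V, T1 e ∧ T2 e ∧ P e ∧ ∀ i, e i ∉ U := by
    intro U hU
    have a := pr_hit (V := V) (ι := Fin k) U
    have b : ((Fintype.card (Fin k) : ℕ) : ℝ) * (U.card / Fintype.card V) ≤ 1/10 := by
      rw [← mul_div_assoc, div_le_iff₀ hn0, Fintype.card_fin]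
      have : (k:ℝ) * U.card ≤ k * k := by gcongr
      nlinarith
    have d := pr_le_add3
      (P := fun t : Fin k → V => (P t ∧ ¬ T1 t) ∨ (P t ∧ ¬ T2 t) ∨ ∃ i, t i ∈ U) (fun u h => h)
    obtain ⟨e, e1, e2⟩ := exists_of_pr_lt (P := fun t : Fin k → V => (P t ∧ ¬ T1 t) ∨ (P t ∧ ¬ T2 t) ∨ ∃ i, t i ∈ U)
      (Q := P) (by linarith)
    push Not at e2
    exact ⟨e, e2.1 e1, e2.2.1 e1, e1, e2.2.2⟩
  obtain ⟨e, a1, a2, a3, -⟩ := gen ∅ (by simp)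
  obtain ⟨e', b1, b2, b3, b4⟩ := gen (univ.image e) (card_image_le.trans (by simp))
  refine ⟨e, e', a1, a2, b1, b2, ?_⟩
  rw [Multiset.nodup_add]
  refine ⟨Multiset.coe_nodup.2 (List.nodup_ofFn.2 (hP _ a3)), Multiset.coe_nodup.2 (List.nodup_ofFn.2 (hP _ b3)), ?_⟩
  rw [Multiset.disjoint_left]
  intro v hv hv2
  obtain ⟨i, rfl⟩ := List.mem_ofFn.1 (Multiset.mem_coe.1 hv2)
  obtain ⟨j, hj⟩ := List.mem_ofFn.1 (Multiset.mem_coe.1 hv)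
  exact b4 i (mem_image.2 ⟨j, mem_univ _, hj⟩)

end hyp
end TH

namespace TH
open Finset

def sq {α : Type} (x : α) (f : ℕ → α) (s : ℕ) (g : ℕ → α) (i : ℕ) : α :=
  if i = 0 then x else if i - 1 < s then f (i-1) else g (i-1-s)

lemma sq_ind {α : Type} (x : α) (f : ℕ → α) (s N : ℕ) (g : ℕ → α) (Q : α → Prop) (h1 : Q x)
    (h2 : ∀ i < s, Q (f i)) (h3 : ∀ i < N, Q (g i)) (i : ℕ) (hi : i ≤ s + N) : Q (sq x f s g i) := by
  unfold sq
  split_ifs with a b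
  · exact h1
  · exact h2 _ b
  · exact h3 _ (by omega)

lemma sq_sum {α β : Type} [AddCommMonoid β] (F : α → β) (x : α) (f : ℕ → α) (s N : ℕ) (g : ℕ → α) :
    ∑ i ∈ range (s + N + 1), F (sq x f s g i) = F x + ∑ i ∈ range s, F (f i) + ∑ i ∈ range N, F (g i) := by
  rw [sum_range_succ', sum_range_add]
  have h0 : sq x f s g 0 = x := by simp [sq]
  have h1 : ∀ i ∈ range s, F (sq x f s g (i+1)) = F (f i) := by
    intro i hi
    have := mem_range.1 hi
    simp [sq, this]
  have h2 : ∀ i ∈ range N, F (sq x f s g (s+i+1)) = F (g i) := by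
    intro i hi
    simp [sq]
  rw [h0, sum_congr rfl h1, sum_congr rfl h2]
  abel

section endg
variable {V : Type} [Fintype V] [Nonempty V]

lemma endgame {k : ℕ} (hk : 0 < k) {P T : (Fin k → V) → Prop} (hT : ∀ t, T t → P t)
    (A : List V) (e e' : Fin k → V) (he : T e) (he' : T e') (hA : Item P e A e') (hAd : k ∣ A.length)
    (R : Multiset V) (D B : ℝ)
    (hpool : ∀ (M : ℕ) (a b : ℕ → Fin k → V), (M:ℝ) ≤ D → (∀ i < M, T (b i) ∧ T (a (i+1))) →
      ∃ l : ℕ → List V, (∀ i < M, Conn P (b i) (l i) (a (i+1)) ∧ k ∣ (l i).length) ∧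
        ∑ i ∈ range M, (l i : Multiset V) ≤ R)
    (habs : ∀ Z : Finset V, k ∣ Z.card → (Z.card : ℝ) ≤ B →
      ∃ A' : List V, Item P e A' e' ∧ (A' : Multiset V) = A + Z.val)
    (s : ℕ) (hs : s = Fintype.card V % k) (as bs : ℕ → Fin k → V) (ls : ℕ → List V)
    (hls : ∀ i < s, T (as i) ∧ T (bs i) ∧ Item P (as i) (ls i) (bs i) ∧ (ls i).length = k + 1)
    (N m : ℕ) (at' bt : ℕ → Fin k → V) (lt : ℕ → List V)
    (hlt : ∀ i < N, T (at' i) ∧ T (bt i) ∧ Item P (at' i) (lt i) (bt i) ∧ (lt i).length = k * m)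
    (hnd : ((A : Multiset V) + ∑ i ∈ range s, (ls i : Multiset V) + ∑ i ∈ range N, (lt i : Multiset V) + R).Nodup)
    (hD : ((s + N + 1 : ℕ) : ℝ) ≤ D)
    (hB : (Fintype.card V : ℝ) ≤ B + A.length + N * (k * m : ℕ)) :
    ∃ f : ZMod (Fintype.card V) → V, Function.Bijective f ∧
      ∀ i, P (fun j : Fin k => f (i + (j.1 : ZMod (Fintype.card V)))) := by
  classical
  let it : ℕ → (Fin k → V) × (Fin k → V) × List V :=
    sq (e, e', A) (fun i => (as i, bs i, ls i)) s (fun i => (at' i, bt i, lt i))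
  have hit : ∀ i ≤ s + N, T (it i).1 ∧ T (it i).2.1 ∧ Item P (it i).1 (it i).2.2 (it i).2.1 := by
    intro i hi
    refine sq_ind _ _ s N _ (fun x : (Fin k → V) × (Fin k → V) × List V => T x.1 ∧ T x.2.1 ∧ Item P x.1 x.2.2 x.2.1)
      ⟨he, he', hA⟩ ?_ ?_ i hi
    · intro i hi; exact ⟨(hls i hi).1, (hls i hi).2.1, (hls i hi).2.2.1⟩
    · intro i hi; exact ⟨(hlt i hi).1, (hlt i hi).2.1, (hlt i hi).2.2.1⟩
  have hsum : ∑ i ∈ range (s+N+1), ((it i).2.2 : Multiset V) =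
      (A : Multiset V) + ∑ i ∈ range s, (ls i : Multiset V) + ∑ i ∈ range N, (lt i : Multiset V) :=
    sq_sum (fun x : (Fin k → V) × (Fin k → V) × List V => (x.2.2 : Multiset V)) _ _ s N _
  have h0 : it 0 = (e, e', A) := by simp [it, sq]
  obtain ⟨c, c1, c2⟩ := hpool (s+N+1) (fun i => if i = s+N+1 then e else (it i).1) (fun i => (it i).2.1) hD (by
    intro i hi
    refine ⟨(hit i (by omega)).2.1, ?_⟩
    split_ifs with h
    · exact he
    · exact (hit (i+1) (by omega)).1)
  have hle : ∑ i ∈ range (s+N+1), ((it i).2.2 : Multiset V) + ∑ i ∈ range (s+N+1), (c i : Multiset V) ≤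
      (A : Multiset V) + ∑ i ∈ range s, (ls i : Multiset V) + ∑ i ∈ range N, (lt i : Multiset V) + R := by
    rw [hsum]; exact add_le_add le_rfl c2
  have hcs : (∑ i ∈ range s, (ls i : Multiset V)).card = s * (k+1) := by
    rw [Multiset.card_sum, sum_congr rfl (g := fun _ => k+1)]
    · simp
    · intro i hi; rw [Multiset.coe_card]; exact (hls i (mem_range.1 hi)).2.2.2
  have hct : (∑ i ∈ range N, (lt i : Multiset V)).card = N * (k*m) := by
    rw [Multiset.card_sum, sum_congr rfl (g := fun _ => k*m)]
    · simp
    · intro i hi; rw [Multiset.coe_card]; exact (hlt i (mem_range.1 hi)).2.2.2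
  obtain ⟨x, hx⟩ : k ∣ (∑ i ∈ range (s+N+1), (c i : Multiset V)).card := by
    rw [Multiset.card_sum]
    refine dvd_sum fun i hi => ?_
    rw [Multiset.coe_card]; exact (c1 i (mem_range.1 hi)).2
  have hcard : (∑ i ∈ range (s+N+1), ((it i).2.2 : Multiset V) + ∑ i ∈ range (s+N+1), (c i : Multiset V)).card
      = A.length + s * (k+1) + N * (k*m) + k * x := by
    rw [Multiset.card_add, hx, hsum, Multiset.card_add, Multiset.card_add, hcs, hct, Multiset.coe_card]
  refine assemble hk (s+N) (fun i => (it i).2.2) c (fun i => (it i).1) (fun i => (it i).2.1)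
    (fun i hi => (hit i hi).2.2) ?_ ?_ B ?_ _ rfl (Multiset.nodup_of_le hle hnd) ?_ ?_
  · intro i hi
    have := (c1 i (by omega)).1
    rwa [if_neg (by omega)] at this
  · have := (c1 (s+N) (by omega)).1
    rw [if_pos rfl] at this
    rw [h0]; exact this
  · rw [h0]; exact habs
  · rw [hcard]
    obtain ⟨y, hy⟩ := hAd
    have h1 := Nat.mod_add_div (Fintype.card V) k
    rw [← hs] at h1
    rw [← h1, hy, show k * y + s * (k+1) + N * (k*m) + k * x = s + k * (y + s + N * m + x) by ring,
      Nat.add_sub_add_left]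
    exact Nat.dvd_sub (dvd_mul_right _ _) (dvd_mul_right _ _)
  · rw [hcard]
    push_cast
    push_cast at hB
    have : (0:ℝ) ≤ s * (k+1) + k * x := by positivity
    linarith

end endg
end TH

namespace TH
open Finset

set_option maxHeartbeats 2000000 in
theorem main_thm (r : ℕ) (α : ℝ) (hα : 0 < α) (hα1 : α ≤ 1) :
    ∃ n0 : ℕ, ∀ (V : Type) [Fintype V] [Nonempty V] (P : (Fin (r+1+2) → V) → Prop),
      Hyp (r+1) α P → n0 ≤ Fintype.card V →
      ∃ f : ZMod (Fintype.card V) → V, Function.Bijective f ∧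
        ∀ i, P (fun j : Fin (r+1+2) => f (i + (j.1 : ZMod (Fintype.card V)))) := by
  classical
  set κ : ℝ := ((r+1+2 : ℕ) : ℝ) with hκ
  have hκ3 : 3 ≤ κ := by rw [hκ]; exact_mod_cast (by omega : 3 ≤ r+1+2)
  set θ : ℝ := min (1/(200*(κ+1))) (α/2/96) with hθ
  have hθ0 : 0 < θ := by positivity
  obtain ⟨ρ0, nA, hρ0, habs⟩ := absorber r α hα θ hθ0
  set ρ : ℝ := min ρ0 θ with hρ
  have hρp : 0 < ρ := by positivity
  obtain ⟨η, hη, htil⟩ := tiling r (α/2) (ρ/4) (by positivity) (by linarith) (by positivity)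
  obtain ⟨K, c, nS, hc, hstr⟩ := structure_thm (r+1) α hα (min η (1/100)) (by positivity)
  obtain ⟨ζ, hζ, hζa, -⟩ := exists_small (2 * ((K*(r+1+2):ℕ):ℝ)^2 + 2 * (K*(r+1+2):ℕ)) (min (c/8) (ρ/4))
    (by positivity) (by positivity)
  obtain ⟨nP, hpool⟩ := pool (r+1+2) K c ζ hc hζ
  obtain ⟨m', hm'⟩ := exists_nat_ge (16/(c*ζ))
  obtain ⟨nT, htil⟩ := htil (m'+1) (by omega)
  set y : ℝ := min (min (min ζ (c/8)) (min (α/2/48) (c*ζ/16))) (min (ρ/4) 1) with hy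
  have hy0 : 0 < y := by positivity
  set C : ℝ := 200 * (κ+1)^3 + ((K*(r+1+2):ℕ):ℝ) * (2*κ) with hC
  obtain ⟨nB, hnB⟩ := exists_nat_ge (C/y)
  refine ⟨max (max nA nS) (max nP (max nT nB)), ?_⟩
  intro V _ _ P hP hn
  have hnA : nA ≤ Fintype.card V := by omega
  have hnS : nS ≤ Fintype.card V := by omega
  have hnP : nP ≤ Fintype.card V := by omega
  have hnT : nT ≤ Fintype.card V := by omega
  have hnB' : nB ≤ Fintype.card V := by omega
  set n : ℝ := (Fintype.card V : ℝ) with hnn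
  have hnp : (0:ℝ) < n := by rw [hnn]; exact_mod_cast (Fintype.card_pos (α := V))
  have hCn : C ≤ y * n := by
    have h1 := hnB.trans (Nat.cast_le.2 hnB')
    rw [div_le_iff₀ hy0] at h1
    linarith
  have hKk : 0 ≤ ((K*(r+1+2):ℕ):ℝ) * (2*κ) := by positivity
  have hC0 : 200 * (κ+1)^3 ≤ C := by linarith
  have hC1 : ((K*(r+1+2):ℕ):ℝ) * (2*κ) ≤ C := by
    have : 0 ≤ 200 * (κ+1)^3 := by positivity
    linarith
  have hk2 : κ * (κ+1) ≤ (κ+1)^3 := by nlinarith [sq_nonneg κ]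
  have hk3 : 1 + κ ≤ (κ+1)^3 := by nlinarith [sq_nonneg κ]
  have hk4 : (κ+1)^2 ≤ (κ+1)^3 := by nlinarith [sq_nonneg (κ+1)]
  have hk5 : κ^2 ≤ (κ+1)^3 := by nlinarith [sq_nonneg κ]
  have hk6 : κ * (κ+1)^2 ≤ (κ+1)^3 := by nlinarith [sq_nonneg (κ+1)]
  have y1 : y * n ≤ ζ * n := by
    gcongr; exact (min_le_left _ _).trans ((min_le_left _ _).trans (min_le_left _ _))
  have y2 : y * n ≤ c/8 * n := by
    gcongr; exact (min_le_left _ _).trans ((min_le_left _ _).trans (min_le_right _ _))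
  have y3 : y * n ≤ α/2/48 * n := by
    gcongr; exact (min_le_left _ _).trans ((min_le_right _ _).trans (min_le_left _ _))
  have y4 : y * n ≤ c*ζ/16 * n := by
    gcongr; exact (min_le_left _ _).trans ((min_le_right _ _).trans (min_le_right _ _))
  have y5 : y * n ≤ ρ/4 * n := by
    gcongr; exact (min_le_right _ _).trans (min_le_left _ _)
  have y6 : y * n ≤ 1 * n := by
    gcongr; exact (min_le_right _ _).trans (min_le_right _ _)
  have t1 : θ * n ≤ α/2/96 * n := by gcongr; exact min_le_right _ _
  have t2 : 50 * (κ+1) * (θ * n) ≤ 1/4 * n := by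
    have h1 : θ ≤ 1/(200*(κ+1)) := min_le_left _ _
    calc 50 * (κ+1) * (θ * n) ≤ 50 * (κ+1) * (1/(200*(κ+1)) * n) := by gcongr
      _ = 1/4 * n := by field_simp; norm_num
  have t3 : ρ * n ≤ θ * n := by gcongr; exact min_le_right _ _
  have t4 : ρ * n ≤ ρ0 * n := by gcongr; exact min_le_left _ _
  -- the objects
  obtain ⟨T1, a1, a2, a3⟩ := habs V P hP hnA
  obtain ⟨T, b1, b2, b3, b4⟩ := hstr V P hP hnS
  have b4' : pr (fun t => P t ∧ ¬ T t) ≤ 1/9 + 1/100 := b4.trans (by linarith [min_le_right η ((1:ℝ)/100)])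
  have b3' := b3.trans (min_le_left _ _)
  have hPl : (11:ℝ)/20 ≤ pr P := by
    refine le_trans ?_ (pr_P_lower hα P hP)
    have h1 : ((r+1:ℕ):ℝ)^2 / n ≤ 1/100 := by
      rw [div_le_iff₀ hnp]
      have : ((r+1:ℕ):ℝ) ≤ κ := by rw [hκ]; exact_mod_cast (by omega : r+1 ≤ r+1+2)
      have h2 : ((r+1:ℕ):ℝ)^2 ≤ κ^2 := by gcongr
      linarith
    rw [← hnn]
    linarith
  obtain ⟨e, e', e1, e2, e3, e4, e5⟩ := pick_two P T1 T hP.2.2 a1 hPl a2 b4' (by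
    rw [← hnn, ← hκ]; linarith)
  set N2 := ⌈ζ * n⌉₊ with hN2
  obtain ⟨p1, p2⟩ := ceil_bound ζ hζ (Fintype.card V) (by rw [← hnn]; linarith)
  rw [← hnn, ← hN2] at p1 p2
  have v0 : ζ * (2 * ((K*(r+1+2):ℕ):ℝ)^2 + 2 * (K*(r+1+2):ℕ)) * n ≤ min (c/8) (ρ/4) * n :=
    mul_le_mul_of_nonneg_right hζa hnp.le
  have v1 : min (c/8) (ρ/4) * n ≤ c/8 * n := by gcongr; exact min_le_left _ _
  have v2 : min (c/8) (ρ/4) * n ≤ ρ/4 * n := by gcongr; exact min_le_right _ _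
  have N2a : ((K*(r+1+2):ℕ):ℝ)^2 * N2 ≤ 2 * ζ * ((K*(r+1+2):ℕ):ℝ)^2 * n := by
    calc ((K*(r+1+2):ℕ):ℝ)^2 * N2 ≤ ((K*(r+1+2):ℕ):ℝ)^2 * (2 * ζ * n) := by gcongr
      _ = _ := by ring
  have N2b : ((K*(r+1+2):ℕ):ℝ) * N2 ≤ 2 * ζ * ((K*(r+1+2):ℕ):ℝ) * n := by
    calc ((K*(r+1+2):ℕ):ℝ) * N2 ≤ ((K*(r+1+2):ℕ):ℝ) * (2 * ζ * n) := by gcongr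
      _ = _ := by ring
  have q5 : 0 ≤ 2 * ζ * ((K*(r+1+2):ℕ):ℝ)^2 * n := by positivity
  have q6 : 0 ≤ 2 * ζ * ((K*(r+1+2):ℕ):ℝ) * n := by positivity
  have X0 : 2 * ζ * ((K*(r+1+2):ℕ):ℝ)^2 * n + 2 * ζ * ((K*(r+1+2):ℕ):ℝ) * n ≤ (min (c/8) (ρ/4)) * n := by
    refine le_trans (le_of_eq (by ring)) v0
  set EE : Multiset V := (List.ofFn e : Multiset V) + (List.ofFn e' : Multiset V) with hEE
  have hEEc : ((EE.toFinset.card : ℕ) : ℝ) ≤ 2 * κ := by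
    have h1 : EE.toFinset.card ≤ EE.card := Multiset.toFinset_card_le _
    have h2 : EE.card = 2 * (r+1+2) := by
      rw [hEE, Multiset.card_add, Multiset.coe_card, Multiset.coe_card, List.length_ofFn, List.length_ofFn, two_mul]
    rw [h2] at h1
    rw [hκ]
    exact_mod_cast h1
  obtain ⟨R, r1, r2, r3, r4⟩ := hpool V P T EE.toFinset N2 hP.1 hnP ⟨e, e2⟩ b2 (by
      rw [← hnn]
      calc ((K*(r+1+2):ℕ):ℝ) * EE.toFinset.card ≤ ((K*(r+1+2):ℕ):ℝ) * (2*κ) := by gcongr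
        _ ≤ c/8 * n := by linarith) (by rw [← hnn]; linarith) p1
  have hRc : (R.card : ℝ) ≤ ρ/4 * n := by
    rw [r3, Nat.cast_mul]
    linarith
  have hρn : 0 < ρ * n := by positivity
  obtain ⟨A, A0, A1, A2, A3, A4, A5⟩ := a3 e e' e1 e3 e5 R.toFinset (by
      rw [← hnn]
      have h1 : (R.toFinset.card : ℝ) ≤ R.card := by exact_mod_cast Multiset.toFinset_card_le R
      linarith)
    (by
      intro i hi
      exact r2 _ (Multiset.mem_toFinset.1 hi) (Multiset.mem_toFinset.2 (Multiset.mem_add.2 (Or.inl (Multiset.mem_coe.2 (List.mem_ofFn.2 ⟨i, rfl⟩))))))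
    (by
      intro i hi
      exact r2 _ (Multiset.mem_toFinset.1 hi) (Multiset.mem_toFinset.2 (Multiset.mem_add.2 (Or.inr (Multiset.mem_coe.2 (List.mem_ofFn.2 ⟨i, rfl⟩))))))
  rw [← hnn] at A3
  have hUnd : ((A : Multiset V) + R).Nodup := by
    rw [Multiset.nodup_add]
    refine ⟨Multiset.coe_nodup.2 A2, r1, ?_⟩
    rw [Multiset.disjoint_left]
    intro v hv hv2
    exact A0 v (Multiset.mem_coe.1 hv) (Multiset.mem_toFinset.2 hv2)
  obtain ⟨s, hs⟩ : ∃ s, s = Fintype.card V % (r+1+2) := ⟨_, rfl⟩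
  have hsκ : (s:ℝ) ≤ κ := by
    have : s < r+1+2 := by rw [hs]; exact Nat.mod_lt _ (by omega)
    rw [hκ]; exact_mod_cast this.le
  have hsκ2 : (s:ℝ) * (κ+1) ≤ κ * (κ+1) := by gcongr
  have hκK : (((r+1+1 : ℕ):ℝ) + 2) = κ + 1 := by rw [hκ]; push_cast; ring
  obtain ⟨as, bs, ls, s1, s2⟩ := specials (K := r+1+1) P T hP.1 b1 hPl b4' ((A : Multiset V) + R) hUnd
    (by rw [hκK, ← hnn]; linarith) s (by
      rw [hκK, ← hnn, Multiset.card_add, Multiset.coe_card]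
      push_cast
      have h1 : 50 * (κ+1) * (((A.length:ℝ) + R.card) + s * (κ+1)) ≤
          50 * (κ+1) * ((θ * n + θ * n) + κ * (κ+1)) := by
        gcongr
        linarith
      refine h1.trans ?_
      have h2 : 50 * (κ+1) * ((θ * n + θ * n) + κ * (κ+1)) = 2 * (50 * (κ+1) * (θ * n)) + 50 * (κ * (κ+1)^2) := by ring
      rw [h2]
      linarith)
  set SS : Multiset V := (A : Multiset V) + R + ∑ i ∈ range s, (ls i : Multiset V) with hSS
  have hcs : (∑ i ∈ range s, (ls i : Multiset V)).card = s * (r+1+2+1) := by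
    rw [Multiset.card_sum, sum_congr rfl (g := fun _ => r+1+2+1)]
    · simp
    · intro i hi; rw [Multiset.coe_card]; exact (s1 i (mem_range.1 hi)).2.2.2
  have hSSc : SS.card = A.length + R.card + s * (r+1+2+1) := by
    rw [hSS, Multiset.card_add, Multiset.card_add, hcs, Multiset.coe_card]
  have hSScR : (SS.card : ℝ) = A.length + R.card + s * (κ+1) := by
    rw [hSSc, hκ]; push_cast; ring
  set W : Finset V := univ \ ⟨SS, s2⟩ with hW
  have hSW : SS + W.val = (univ : Finset V).val := by
    rw [hW, Finset.sdiff_val]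
    exact add_tsub_cancel_of_le (Multiset.le_iff_subset s2 |>.2 (fun v _ => Finset.mem_univ v))
  have hWc : (SS.card : ℝ) + W.card = n := by
    have h1 := congrArg Multiset.card hSW
    rw [Multiset.card_add] at h1
    rw [hnn]
    exact_mod_cast h1
  obtain ⟨N, X, g1, g2, g3, g4⟩ := htil V T b3' hnT W (by
    rw [← hnn]
    have : (1 - α/2/24) * n = n - α/2/96 * n - α/2/96 * n - α/2/48 * n := by ring
    rw [this]
    linarith)
  rw [← hnn] at g4
  have htp : ∀ i : ℕ, ∃ x : (Fin (r+1+2) → V) × (Fin (r+1+2) → V) × List V, i < N →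
      T x.1 ∧ T x.2.1 ∧ Item P x.1 x.2.2 x.2.1 ∧ (x.2.2 : Multiset V) = univ.val.map (X i) := by
    intro i
    by_cases hi : i < N
    · obtain ⟨a, b, l, z1, z2, z3, z4⟩ := tile_path hP.1 b1 (X i) (g1 i hi)
      exact ⟨(a, b, l), fun _ => ⟨z1, z2, z3, z4⟩⟩
    · exact ⟨(e, e, []), fun h => absurd h hi⟩
  choose tp htp using htp
  have hts : ∑ i ∈ range N, ((tp i).2.2 : Multiset V) ≤ W.val := by
    rw [sum_congr rfl fun i hi => (htp i (mem_range.1 hi)).2.2.2]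
    exact g2
  have hfull : ((A : Multiset V) + ∑ i ∈ range s, (ls i : Multiset V) +
      ∑ i ∈ range N, ((tp i).2.2 : Multiset V) + R).Nodup := by
    have h1 : SS + ∑ i ∈ range N, ((tp i).2.2 : Multiset V) ≤ (univ : Finset V).val := by
      rw [← hSW]; exact add_le_add le_rfl hts
    refine Multiset.nodup_of_le (le_trans (le_of_eq ?_) h1) univ.nodup
    rw [hSS]; abel
  have hsD : ((s + N + 1 : ℕ) : ℝ) ≤ c/8 * N2 := by
    have h1 : (N:ℝ) * (16/(c*ζ)) ≤ n := by
      have h2 : (N:ℝ) * ((r+1+2) * (m'+1)) ≤ W.card := by exact_mod_cast g3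
      have h3 : (W.card : ℝ) ≤ n := by
        have : (0:ℝ) ≤ SS.card := by positivity
        linarith
      have h4 : 16/(c*ζ) ≤ (r+1+2) * (m'+1) := by
        have : (0:ℝ) ≤ r := by positivity
        have h5 : (0:ℝ) ≤ m' := by positivity
        nlinarith
      calc (N:ℝ) * (16/(c*ζ)) ≤ N * ((r+1+2) * (m'+1)) := by gcongr
        _ ≤ n := h2.trans h3
    have h2 : (N:ℝ) ≤ c*ζ/16 * n := by
      rw [mul_div_assoc', div_le_iff₀ (by positivity)] at h1
      linarith
    have h3 : c/8 * (ζ * n) ≤ c/8 * N2 := by gcongr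
    push_cast
    linarith
  refine endgame (by omega) b1 A e e' e2 e4 A1 A4 R (c/8 * N2) (ρ * n) r4
    (fun Z z1 z2 => A5 Z z1 (z2.trans t4)) s hs as bs ls s1 N (m'+1) (fun i => (tp i).1) (fun i => (tp i).2.1)
    (fun i => (tp i).2.2) ?_ hfull hsD ?_
  · intro i hi
    obtain ⟨z1, z2, z3, z4⟩ := htp i hi
    refine ⟨z1, z2, z3, ?_⟩
    have := congrArg Multiset.card z4
    simpa using this
  · rw [← hnn]
    linarith

end TH

/-- Theorem 1.2 (main theorem): for every `k ≥ 3` and `α > 0` there is `n₀` such that every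
`k`-uniform hypergraph on `n ≥ n₀` vertices with minimum `(k-2)`-degree at least
`(5/9 + α) n²/2` contains a Hamiltonian cycle. -/
theorem stmt19 (k : ℕ) (hk : 3 ≤ k) (α : ℝ) (hα : 0 < α) :
    ∃ n₀ : ℕ, ∀ (V : Type) [Fintype V] [DecidableEq V] (E : Finset (Finset V)),
      n₀ ≤ Fintype.card V →
      (∀ e ∈ E, e.card = k) →
      (∀ S : Finset V, S.card = k - 2 →
        (5 / 9 + α) * (Fintype.card V : ℝ) ^ 2 / 2 ≤ ((E.filter fun e => S ⊆ e).card : ℝ)) →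
      ∃ f : ZMod (Fintype.card V) → V, Function.Bijective f ∧
        ∀ i : ZMod (Fintype.card V),
          Finset.image (fun j : Fin k => f (i + (j.1 : ZMod (Fintype.card V)))) Finset.univ
            ∈ E := by
  obtain ⟨r, rfl⟩ : ∃ r, k = r + 1 + 2 := ⟨k - 3, by omega⟩
  obtain ⟨n0, h0⟩ := TH.main_thm r (min α 1) (by positivity) (min_le_right _ _)
  refine ⟨max n0 1, ?_⟩
  intro V _ _ E hn hE hdeg
  have hne : Nonempty V := Fintype.card_pos_iff.1 (by omega)
  refine h0 V (fun t => Finset.univ.image t ∈ E) ?_ (by omega)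
  refine TH.hyp_of_degree (q := r + 1) (min α 1) E hE ?_
  intro S hS
  refine le_trans ?_ (hdeg S (by omega))
  gcongr
  exact min_le_left _ _
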